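/- Let p be a prime with p > 5 and p ∉ {7, 11, 19, 31}. Then PSL(2,p) has a witness to failure of order 3 if and only if p % 10 ∈ {1, 9} (i.e., p ≡ ±1 mod 10). -/

import Mathlib

section Defs

variable {G : Type*} [Group G]

/-- `g` is a generating sequence of `G`: the set of its entries generates `G`. -/
def IsGenSeq {n : ℕ} (g : Fin n → G) : Prop :=
  Subgroup.closure (Set.range g) = ⊤

/-- `g` is irredundant: for each `i`, the entries other than `g i` do not generate `G`. -/
def IsIrred {n : ℕ} (g : Fin n → G) : Prop :=
  ∀ i : Fin n, Subgroup.closure (g '' {j | j ≠ i}) ≠ ⊤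

/-- `m(G)`: the largest length of an irredundant generating sequence of `G`. -/
noncomputable def maxIrredLen (G : Type*) [Group G] : ℕ :=
  sSup {n | ∃ g : Fin n → G, IsGenSeq g ∧ IsIrred g}

/-- `G` satisfies the replacement property. -/
def ReplacementProperty (G : Type*) [Group G] : Prop :=
  ∀ g : Fin (maxIrredLen G) → G, IsGenSeq g → IsIrred g →
    ∀ x : G, x ≠ 1 → ∃ i, IsGenSeq (Function.update g i x)

/-- `x` is a witness to failure of the replacement property for `G`. -/
def IsWitnessToFailure {G : Type*} [Group G] (x : G) : Prop :=
  x ≠ 1 ∧ ∃ g : Fin (maxIrredLen G) → G, IsGenSeq g ∧ IsIrred g ∧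
    ∀ i, ¬ IsGenSeq (Function.update g i x)

/-- A family of subgroups is in general position. -/
def InGeneralPosition {n : ℕ} (H : Fin n → Subgroup G) : Prop :=
  ∀ j, ¬ ((⨅ i ∈ ({j}ᶜ : Set (Fin n)), H i) ≤ H j)

/-- The sequence of subgroups `M` corresponds to the sequence of elements `g`. -/
def Corresponds {n : ℕ} (M : Fin n → Subgroup G) (g : Fin n → G) : Prop :=
  (∀ i j, j ≠ i → g i ∈ M j) ∧ ∀ i, g i ∉ M i

end Defs

/-- `PSL(2,p)`. -/
abbrev PSL (p : ℕ) : Type := Matrix.ProjectiveSpecialLinearGroup (Fin 2) (ZMod p)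

/-! ### Arithmetic in `ℤ[φ, √2]` -/

/-- The element `a + b φ + (c + d φ) √2` of `ℤ[φ, √2]`, where `φ² = φ + 1`. -/
structure GoldInt where
  a : ℤ
  b : ℤ
  c : ℤ
  d : ℤ

namespace GoldInt

def eqb (x y : GoldInt) : Bool := x.a == y.a && x.b == y.b && x.c == y.c && x.d == y.d

theorem eq_of_eqb {x y : GoldInt} (h : eqb x y = true) : x = y := by
  cases x; cases y; simp_all [eqb]

def add (x y : GoldInt) : GoldInt := ⟨x.a + y.a, x.b + y.b, x.c + y.c, x.d + y.d⟩

def sub (x y : GoldInt) : GoldInt := ⟨x.a - y.a, x.b - y.b, x.c - y.c, x.d - y.d⟩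

def neg (x : GoldInt) : GoldInt := ⟨-x.a, -x.b, -x.c, -x.d⟩

def mul (x y : GoldInt) : GoldInt :=
  ⟨x.a * y.a + x.b * y.b + 2 * (x.c * y.c + x.d * y.d),
   x.a * y.b + x.b * y.a + x.b * y.b + 2 * (x.c * y.d + x.d * y.c + x.d * y.d),
   x.a * y.c + x.b * y.d + x.c * y.a + x.d * y.b,
   x.a * y.d + x.b * y.c + x.b * y.d + x.c * y.b + x.d * y.a + x.d * y.b⟩

def const (n : ℤ) : GoldInt := ⟨n, 0, 0, 0⟩

/-- Call-by-value application for kernel evaluation. -/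
def forceInt {α : Type} (n : ℤ) (k : ℤ → α) : α :=
  match n with
  | .ofNat 0 => k 0
  | .ofNat (m + 1) => k (.ofNat (Nat.succ m))
  | .negSucc 0 => k (-1)
  | .negSucc (m + 1) => k (.negSucc (Nat.succ m))

theorem forceInt_eq {α : Type} (n : ℤ) (k : ℤ → α) : forceInt n k = k n := by
  unfold forceInt
  split <;> rfl

def force {α : Type} (x : GoldInt) (k : GoldInt → α) : α :=
  forceInt x.a fun a => forceInt x.b fun b => forceInt x.c fun c => forceInt x.d fun d =>
    k ⟨a, b, c, d⟩

theorem force_eq {α : Type} (x : GoldInt) (k : GoldInt → α) : force x k = k x := by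
  simp only [force, forceInt_eq]

def scale (n : ℤ) (x : GoldInt) : GoldInt := ⟨n * x.a, n * x.b, n * x.c, n * x.d⟩

/-- The absolute norm down to `ℤ`. -/
def norm (x : GoldInt) : ℤ :=
  let u := x.a * x.a + x.b * x.b - 2 * (x.c * x.c + x.d * x.d)
  let v := 2 * (x.a * x.b) + x.b * x.b - 2 * (2 * (x.c * x.d) + x.d * x.d)
  u * u + u * v - v * v

/-- The norm is a non-zero integer whose only prime factors are `2, 3, 5, 7, 11, 19, 31`. -/
def smooth (x : GoldInt) : Bool := force x fun x =>
  (2 * 3 * 5 * 7 * 11 * 19 * 31) ^ 20 % x.norm.natAbs == 0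

variable {K : Type*} [Field K]

/-- Evaluation in a field at given values of `φ` and `√2`. -/
def ev (f r : K) (x : GoldInt) : K := x.a + x.b * f + (x.c + x.d * f) * r

variable {f r : K}

theorem ev_add (x y : GoldInt) : ev f r (add x y) = ev f r x + ev f r y := by
  simp only [ev, add]; push_cast; ring

theorem ev_sub (x y : GoldInt) : ev f r (sub x y) = ev f r x - ev f r y := by
  simp only [ev, sub]; push_cast; ring

theorem ev_neg (x : GoldInt) : ev f r (neg x) = -ev f r x := by
  simp only [ev, neg]; push_cast; ring

theorem ev_scale (n : ℤ) (x : GoldInt) : ev f r (scale n x) = n * ev f r x := by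
  simp only [ev, scale]; push_cast; ring

theorem ev_const (n : ℤ) : ev f r (const n) = n := by
  simp [ev, const]

theorem ev_mul (hf : f ^ 2 = f + 1) (hr : r ^ 2 = 2) (x y : GoldInt) :
    ev f r (mul x y) = ev f r x * ev f r y := by
  simp only [ev, mul]; push_cast
  linear_combination (-(x.b * y.b + 2 * x.d * y.d : K) - (x.b * y.d + x.d * y.b) * r) * hf
    - ((x.c + x.d * f) * (y.c + y.d * f) : K) * hr

theorem ev_ne_zero (hf : f ^ 2 = f + 1) (hr : r ^ 2 = 2)
    (hK : ((2 * 3 * 5 * 7 * 11 * 19 * 31 : ℕ) : K) ≠ 0) {x : GoldInt} (hx : smooth x = true) :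
    ev f r x ≠ 0 := by
  intro h
  have hN : ((norm x : ℤ) : K) = 0 := by
    have h1 : (x.a * x.a + x.b * x.b - 2 * (x.c * x.c + x.d * x.d) : K)
        + (2 * (x.a * x.b) + x.b * x.b - 2 * (2 * (x.c * x.d) + x.d * x.d)) * f = 0 := by
      simp only [ev] at h
      linear_combination (x.a + x.b * f - (x.c + x.d * f) * r : K) * h
        + (-(x.b * x.b) + 2 * x.d * x.d : K) * hf + (x.c + x.d * f : K) ^ 2 * hr
    simp only [norm]; push_cast
    set u : K := x.a * x.a + x.b * x.b - 2 * (x.c * x.c + x.d * x.d)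
    set v : K := 2 * (x.a * x.b) + x.b * x.b - 2 * (2 * (x.c * x.d) + x.d * x.d)
    linear_combination (u + v - v * f) * h1 + v ^ 2 * hf
  have hd : (x.norm.natAbs : ℕ) ∣ (2 * 3 * 5 * 7 * 11 * 19 * 31) ^ 20 := by
    rw [smooth, force_eq, beq_iff_eq] at hx
    exact Nat.dvd_of_mod_eq_zero hx
  have h0 : ((x.norm.natAbs : ℕ) : K) = 0 := by
    rcases Int.natAbs_eq x.norm with h' | h' <;> rw [h'] at hN <;> simpa using hN
  obtain ⟨c, hc⟩ := hd
  apply hK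
  have := congrArg (Nat.cast : ℕ → K) hc
  rw [Nat.cast_mul, h0, zero_mul, Nat.cast_pow] at this
  exact pow_eq_zero_iff (by norm_num) |>.1 this

end GoldInt

namespace GoldInt

def labels4 : List GoldInt := [⟨0,0,0,0⟩, ⟨1,0,0,0⟩, ⟨-1,0,0,0⟩, ⟨0,0,1,0⟩, ⟨0,0,-1,0⟩]

def labels5 : List GoldInt :=
  [⟨0,0,0,0⟩, ⟨1,0,0,0⟩, ⟨-1,0,0,0⟩, ⟨0,1,0,0⟩, ⟨0,-1,0,0⟩, ⟨1,-1,0,0⟩, ⟨-1,1,0,0⟩]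

/-- All possible traces of elements of an exceptional group, up to `±2`. -/
def labels : List GoldInt := labels4 ++ labels5.drop 3

/-- Representatives of the labels up to sign. -/
def posLabels : List GoldInt :=
  [⟨0,0,0,0⟩, ⟨1,0,0,0⟩, ⟨0,0,1,0⟩, ⟨0,1,0,0⟩, ⟨1,-1,0,0⟩]

def pm2 : List GoldInt := [⟨2,0,0,0⟩, ⟨-2,0,0,0⟩]

/-- Some member of `l` may have the same value as `z`. -/
def mayMem (l : List GoldInt) (z : GoldInt) : Bool := force z fun z =>
  l.any fun x => !smooth (sub z x)

/-- The square of the trace of a product of three involutions with given pairwise traces. -/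
def triple (a b d : GoldInt) : GoldInt :=
  sub (sub (sub (sub ⟨4,0,0,0⟩ (mul a a)) (mul b b)) (mul d d)) (mul a (mul b d))

def triOk (l : List GoldInt) (a b d : GoldInt) : Bool :=
  mayMem ((l ++ pm2).map fun x => mul x x) (triple a b d) &&
  mayMem (l ++ pm2) (add (mul a b) d) && mayMem (l ++ pm2) (add (mul a d) b) &&
  mayMem (l ++ pm2) (add (mul b d) a)

def memb (l : List GoldInt) (z : GoldInt) : Bool := l.any (eqb z)

def isZero (z : GoldInt) : Bool := eqb z ⟨0,0,0,0⟩

def twoZero (a b d : GoldInt) : Bool :=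
  (isZero a && isZero b) || (isZero a && isZero d) || (isZero b && isZero d)

def excOk (l : List GoldInt) (a b d : GoldInt) : Bool :=
  memb l a && memb l b && memb l d && triOk l a b d

def exc (a b d : GoldInt) : Bool :=
  !twoZero a b d && smooth (triple a b d) && (excOk labels4 a b d || excOk labels5 a b d)

def legal (a b d : GoldInt) : Bool :=
  twoZero a b d || !smooth (triple a b d) || excOk labels4 a b d || excOk labels5 a b d

/-- The Gram determinant of four involutions with given pairwise traces. -/
def gram (a q e d f g : GoldInt) : GoldInt :=
  let x := mul a g
  let y := mul q f
  let z := mul e d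
  let s := add (mul a a) (add (mul q q) (add (mul e e) (add (mul d d) (add (mul f f) (mul g g)))))
  let t := add (mul a (mul q d)) (add (mul a (mul e f)) (add (mul q (mul e g)) (mul d (mul f g))))
  add (sub ⟨16,0,0,0⟩ (mul ⟨4,0,0,0⟩ (add s t)))
    (sub (add (mul x x) (add (mul y y) (mul z z)))
      (mul ⟨2,0,0,0⟩ (add (mul x y) (add (mul x z) (mul y z)))))

def eqUpToSign (x y : GoldInt × GoldInt × GoldInt) : Bool :=
  (eqb x.1 y.1 && eqb x.2.1 y.2.1 && eqb x.2.2 y.2.2) ||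
  (eqb x.1 (neg y.1) && eqb x.2.1 (neg y.2.1) && eqb x.2.2 (neg y.2.2))

/-- Can an involution having traces `v` against three given involutions (with pairwise traces
`a = t₁₂`, `b = t₁₃`, `d = t₂₃`) be recognised, after at most `n` conjugations by these three,
as one of them? -/
def reach (a b d : GoldInt) : ℕ → GoldInt × GoldInt × GoldInt → Bool
  | 0, v => eqUpToSign v (⟨-2,0,0,0⟩, a, b) || eqUpToSign v (a, ⟨-2,0,0,0⟩, d) ||
      eqUpToSign v (b, d, ⟨-2,0,0,0⟩)
  | n + 1, v => reach a b d 0 v ||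
      !isZero v.1 && reach a b d n (neg v.1, add (mul v.1 a) v.2.1, add (mul v.1 b) v.2.2) ||
      !isZero v.2.1 && reach a b d n (add (mul v.2.1 a) v.1, neg v.2.1, add (mul v.2.1 d) v.2.2) ||
      !isZero v.2.2 && reach a b d n (add (mul v.2.2 b) v.1, add (mul v.2.2 d) v.2.1, neg v.2.2)

theorem four_involutions_check :
    (posLabels.all fun q => labels.all fun a => posLabels.all fun d => !exc q a d ||
      labels.all fun e => posLabels.all fun g => !exc q e g ||
        labels.all fun f => !legal a e f || !legal d g f || smooth (gram a q e d f g) ||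
          reach a q d 1 (e, f, g) || reach e q g 1 (a, f, d) ||
          reach a q d 2 (e, f, g) || reach e q g 2 (a, f, d) ||
          reach a q d 3 (e, f, g) || reach e q g 3 (a, f, d) ||
          reach a q d 4 (e, f, g) || reach e q g 4 (a, f, d) ||
          reach a q d 6 (e, f, g) || reach e q g 6 (a, f, d)) = true := by
  decide +kernel

end GoldInt

/-! ### Quaternions with coordinates in `ℤ[φ, √2]` -/

/-- The coordinates of twice a quaternion over `ℤ[φ, √2]`. -/
structure GoldQuat where
  w : GoldInt
  x : GoldInt
  y : GoldInt
  z : GoldInt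

namespace GoldQuat

open GoldInt

def force {α : Type} (s : GoldQuat) (k : GoldQuat → α) : α :=
  s.w.force fun w => s.x.force fun x => s.y.force fun y => s.z.force fun z => k ⟨w, x, y, z⟩

theorem force_eq {α : Type} (s : GoldQuat) (k : GoldQuat → α) : force s k = k s := by
  simp only [force, GoldInt.force_eq]

def forceList {α : Type} (l : List GoldQuat) (k : List GoldQuat → α) : α :=
  match l with
  | [] => k []
  | a :: t => force a fun a => forceList t fun t => k (a :: t)

theorem forceList_eq {α : Type} (l : List GoldQuat) (k : List GoldQuat → α) :
    forceList l k = k l := by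
  induction l generalizing k with
  | nil => rfl
  | cons a t ih => simp only [forceList, force_eq, ih]

def eqb (s t : GoldQuat) : Bool :=
  GoldInt.eqb s.w t.w && GoldInt.eqb s.x t.x && GoldInt.eqb s.y t.y && GoldInt.eqb s.z t.z

def mul (s t : GoldQuat) : GoldQuat :=
  ⟨sub (sub (sub (s.w.mul t.w) (s.x.mul t.x)) (s.y.mul t.y)) (s.z.mul t.z),
   add (add (s.w.mul t.x) (s.x.mul t.w)) (sub (s.y.mul t.z) (s.z.mul t.y)),
   add (add (s.w.mul t.y) (s.y.mul t.w)) (sub (s.z.mul t.x) (s.x.mul t.z)),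
   add (add (s.w.mul t.z) (s.z.mul t.w)) (sub (s.x.mul t.y) (s.y.mul t.x))⟩

def conj (s : GoldQuat) : GoldQuat := ⟨s.w, s.x.neg, s.y.neg, s.z.neg⟩

def smul (n : ℤ) (s : GoldQuat) : GoldQuat :=
  ⟨scale n s.w, scale n s.x, scale n s.y, scale n s.z⟩

def normSq (s : GoldQuat) : GoldInt :=
  add (add (s.w.mul s.w) (s.x.mul s.x)) (add (s.y.mul s.y) (s.z.mul s.z))

def basis : List GoldQuat :=
  [⟨const 2, const 0, const 0, const 0⟩, ⟨const 0, const 2, const 0, const 0⟩,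
   ⟨const 0, const 0, const 2, const 0⟩, ⟨const 0, const 0, const 0, const 2⟩]

def signs : List ℤ := [1, -1]

/-- The 24 Hurwitz units. -/
def hurwitz : List GoldQuat :=
  basis ++ basis.map (smul (-1)) ++
    signs.flatMap fun a => signs.flatMap fun b => signs.flatMap fun c => signs.map fun d =>
      ⟨const a, const b, const c, const d⟩

def evenPerms (a b c d : GoldInt) : List GoldQuat :=
  [⟨a, b, c, d⟩, ⟨a, c, d, b⟩, ⟨a, d, b, c⟩, ⟨b, a, d, c⟩, ⟨c, a, b, d⟩, ⟨d, a, c, b⟩,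
   ⟨b, c, a, d⟩, ⟨c, d, a, b⟩, ⟨d, b, a, c⟩, ⟨b, d, c, a⟩, ⟨c, b, d, a⟩, ⟨d, c, b, a⟩]

/-- The elements of the binary octahedral group that are not Hurwitz units. -/
def octa : List GoldQuat :=
  signs.flatMap fun a => signs.flatMap fun b =>
    evenPerms ⟨0, 0, a, 0⟩ ⟨0, 0, b, 0⟩ (const 0) (const 0)

/-- The elements of one of the binary icosahedral groups that are not Hurwitz units. -/
def icosa : List GoldQuat :=
  signs.flatMap fun a => signs.flatMap fun b => signs.flatMap fun c =>
    evenPerms (const 0) ⟨a, 0, 0, 0⟩ ⟨0, b, 0, 0⟩ ⟨c, -c, 0, 0⟩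

/-- The elements of the other binary icosahedral group that are not Hurwitz units. -/
def icosa' : List GoldQuat :=
  signs.flatMap fun a => signs.flatMap fun b => signs.flatMap fun c =>
    evenPerms (const 0) ⟨a, 0, 0, 0⟩ ⟨b, -b, 0, 0⟩ ⟨0, c, 0, 0⟩

def memb (l : List GoldQuat) (s : GoldQuat) : Bool := l.any (eqb s)

def octaRep : GoldQuat := ⟨⟨0, 0, 1, 0⟩, ⟨0, 0, 1, 0⟩, const 0, const 0⟩

def icosaRep : GoldQuat := ⟨const 0, const 1, ⟨0, 1, 0, 0⟩, ⟨1, -1, 0, 0⟩⟩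

def icosaRep' : GoldQuat := ⟨const 0, const 1, ⟨1, -1, 0, 0⟩, ⟨0, 1, 0, 0⟩⟩

def octaReps : List GoldQuat :=
  [⟨⟨0, 0, 1, 0⟩, ⟨0, 0, 1, 0⟩, const 0, const 0⟩, ⟨const 0, ⟨0, 0, 1, 0⟩, ⟨0, 0, 1, 0⟩, const 0⟩]

def icosaReps : List GoldQuat :=
  [⟨const 0, const 1, ⟨0, 1, 0, 0⟩, ⟨1, -1, 0, 0⟩⟩, ⟨const 1, const 0, ⟨1, -1, 0, 0⟩, ⟨0, 1, 0, 0⟩⟩,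
   ⟨⟨0, 1, 0, 0⟩, ⟨1, -1, 0, 0⟩, const 0, const 1⟩, ⟨⟨1, -1, 0, 0⟩, ⟨0, 1, 0, 0⟩, const 1, const 0⟩]

def icosaReps' : List GoldQuat :=
  [⟨const 0, const 1, ⟨1, -1, 0, 0⟩, ⟨0, 1, 0, 0⟩⟩, ⟨const 1, const 0, ⟨0, 1, 0, 0⟩, ⟨1, -1, 0, 0⟩⟩,
   ⟨⟨1, -1, 0, 0⟩, ⟨0, 1, 0, 0⟩, const 0, const 1⟩, ⟨⟨0, 1, 0, 0⟩, ⟨1, -1, 0, 0⟩, const 1, const 0⟩]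

/-- Is `t`, up to sign, conjugate under the Hurwitz units to a member of `l`? -/
def conjTo (l : List GoldQuat) (t : GoldQuat) : Bool :=
  force t fun t => l.any fun r => (GoldInt.eqb r.w t.w || GoldInt.eqb r.w t.w.neg) &&
    hurwitz.any fun h => force (h.mul t) fun u => force (r.mul h) fun v =>
      eqb u v || eqb u (smul (-1) v)

/-- Do all members of `l` lie in the double coset of `r` modulo the Hurwitz units? -/
def inDoubleCoset (r t : GoldQuat) : Bool :=
  basis.any fun b => force (r.conj.mul (b.mul t)) fun u => hurwitz.any fun h => eqb (smul 4 h) u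

theorem octa_conj : octa.all (conjTo octaReps) = true := by decide +kernel

theorem icosa_conj : icosa.all (conjTo icosaReps) = true := by decide +kernel

theorem icosa'_conj : icosa'.all (conjTo icosaReps') = true := by decide +kernel

theorem octa_coset : octaReps.all (inDoubleCoset octaRep) = true := by decide +kernel

theorem icosa_coset : icosaReps.all (inDoubleCoset icosaRep) = true := by decide +kernel

theorem icosa'_coset : icosaReps'.all (inDoubleCoset icosaRep') = true := by decide +kernel

/-- Can the quaternion with the given coordinates have norm one, and traces in `l` against all
Hurwitz units? -/
def possible (l : List GoldInt) (t : GoldQuat) : Bool :=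
  !smooth (sub t.normSq (const 4)) &&
    signs.all fun a => signs.all fun b => signs.all fun c =>
      mayMem (l.map (scale 2))
        (add (add t.w (scale a t.x)) (add (scale b t.y) (scale c t.z)))

def labels3 : List GoldInt :=
  [⟨0,0,0,0⟩, ⟨1,0,0,0⟩, ⟨-1,0,0,0⟩, ⟨2,0,0,0⟩, ⟨-2,0,0,0⟩]

def enum (l : List GoldInt) (p : GoldQuat → Bool) : Bool :=
  l.all fun a => l.all fun b => l.all fun c => l.all fun d => p ⟨a, b, c, d⟩

theorem enum_labels3 :
    enum labels3 (fun t => smooth (sub t.normSq (const 4)) || memb hurwitz t) = true := by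
  decide +kernel

theorem enum_labels4 :
    enum labels4 (fun t => !possible labels4 t || memb octa t) = true := by
  decide +kernel

theorem enum_labels5 :
    enum labels5 (fun t => !possible labels5 t || memb icosa t || memb icosa' t) = true := by
  decide +kernel

def noLabel (l : List GoldInt) (n : ℤ) (v : GoldInt) : Bool :=
  !mayMem (l.map (scale n)) v

theorem octa_icosa_check :
    (octaReps.all fun s => (icosa ++ icosa').all fun t => (s.mul t.conj).w.force fun v =>
      smooth v && noLabel labels4 2 v && noLabel labels5 2 v) = true := by
  decide +kernel

theorem icosa_icosa'_check :
    (icosaReps.all fun s => icosa'.all fun t => smooth (s.mul t.conj).w) = true := by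
  decide +kernel

/-- Some values in `ℤ[φ]` that are not twice an element of `labels4`. -/
def nonLabels4 : List GoldInt :=
  [⟨3, 0, 0, 0⟩, ⟨-3, 0, 0, 0⟩, ⟨3, -1, 0, 0⟩, ⟨-3, 1, 0, 0⟩, ⟨2, 1, 0, 0⟩, ⟨-2, -1, 0, 0⟩,
   ⟨2, -1, 0, 0⟩, ⟨-2, 1, 0, 0⟩, ⟨2, -3, 0, 0⟩, ⟨-2, 3, 0, 0⟩, ⟨1, 1, 0, 0⟩, ⟨-1, -1, 0, 0⟩,
   ⟨1, 0, 0, 0⟩, ⟨-1, 0, 0, 0⟩, ⟨1, -2, 0, 0⟩, ⟨-1, 2, 0, 0⟩, ⟨1, -3, 0, 0⟩, ⟨-1, 3, 0, 0⟩]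

/-- Some values in `ℤ[φ]` that are not twice an element of `labels5`. -/
def nonLabels5 : List GoldInt :=
  [⟨3, 0, 0, 0⟩, ⟨-3, 0, 0, 0⟩, ⟨3, -1, 0, 0⟩, ⟨-3, 1, 0, 0⟩, ⟨2, 1, 0, 0⟩, ⟨-2, -1, 0, 0⟩,
   ⟨2, -1, 0, 0⟩, ⟨-2, 1, 0, 0⟩, ⟨1, 1, 0, 0⟩, ⟨-1, -1, 0, 0⟩, ⟨1, 0, 0, 0⟩, ⟨-1, 0, 0, 0⟩,
   ⟨1, -2, 0, 0⟩, ⟨-1, 2, 0, 0⟩, ⟨1, -1, 0, 0⟩, ⟨-1, 1, 0, 0⟩, ⟨0, 1, 0, 0⟩, ⟨0, -1, 0, 0⟩]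

theorem nonLabels4_check : nonLabels4.all (noLabel labels4 2) = true := by decide +kernel

theorem nonLabels5_check : nonLabels5.all (noLabel labels5 2) = true := by decide +kernel

def hit (l : List GoldInt) (n : ℤ) (s : GoldQuat) : Bool :=
  s.w.force fun v => l.any fun x => GoldInt.eqb (scale n x) v

def crossCheck (l nl : List GoldInt) : Bool :=
  forceList hurwitz fun hur => icosaReps.all fun s =>
    icosa'.all fun t => force t fun t => hit nl 1 (s.mul t.conj) || hit nl 1 (s.mul t) ||
      noLabel l 1 s.w || noLabel l 1 t.w || hur.all fun e => memb (basis.take 1 ++ (basis.take 1).map (smul (-1))) e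
        || hit nl 2 (s.mul (e.mul t)) || hit nl 2 (s.mul (t.mul e))

theorem crossCheck_labels4 : crossCheck labels4 nonLabels4 = true := by decide +kernel

theorem crossCheck_labels5 : crossCheck labels5 nonLabels5 = true := by decide +kernel

end GoldQuat

/-! ### Lines of traceless matrices fixed by elements of `SL(2, K)` -/

section Lines

open Matrix

abbrev SL2 (K : Type*) [Field K] : Type _ := Matrix.SpecialLinearGroup (Fin 2) K

abbrev M2 (K : Type*) : Type _ := Matrix (Fin 2) (Fin 2) K

variable {K : Type*} [Field K]

theorem M2.eq_of_trace_eq_zero {v : M2 K} (h : v.trace = 0) :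
    v = !![v 0 0, v 0 1; v 1 0, -v 0 0] := by
  rw [trace_fin_two] at h
  ext i j
  fin_cases i <;> fin_cases j <;> simp
  linear_combination h

theorem M2.anticomm {u v : M2 K} (hu : u.trace = 0) (hv : v.trace = 0) :
    u * v + v * u = (u * v).trace • (1 : M2 K) := by
  rw [M2.eq_of_trace_eq_zero hu, M2.eq_of_trace_eq_zero hv]
  ext i j
  fin_cases i <;> fin_cases j <;> simp [trace_fin_two] <;> ring

theorem M2.cayley (g : M2 K) : g * g = g.trace • g - g.det • (1 : M2 K) := by
  rw [eta_fin_two g]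
  ext i j
  fin_cases i <;> fin_cases j <;> simp [trace_fin_two, det_fin_two] <;> ring

theorem M2.exists_smul_of_commute {u v : M2 K} (hu : u.trace = 0) (hv : v.trace = 0)
    (h2 : (2 : K) ≠ 0) (hu0 : u ≠ 0) (h : u * v = v * u) : ∃ c : K, v = c • u := by
  rw [M2.eq_of_trace_eq_zero hu] at h hu0 ⊢
  rw [M2.eq_of_trace_eq_zero hv] at h ⊢
  generalize u 0 0 = a at *
  generalize u 0 1 = b at *
  generalize u 1 0 = c at *
  generalize v 0 0 = a' at *
  generalize v 0 1 = b' at *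
  generalize v 1 0 = c' at *
  have e00 := congrFun (congrFun h 0) 0
  have e01 := congrFun (congrFun h 0) 1
  have e10 := congrFun (congrFun h 1) 0
  simp only [mul_fin_two, of_apply, cons_val', cons_val_zero, cons_val_one,
    cons_val_fin_one] at e00 e01 e10
  have k1 : a * b' = a' * b := mul_left_cancel₀ h2 (by linear_combination e01)
  have k2 : c * a' = c' * a := mul_left_cancel₀ h2 (by linear_combination e10)
  have k3 : b * c' = b' * c := by linear_combination e00
  by_cases ha : a = 0
  · by_cases hb : b = 0
    · have hc : c ≠ 0 := fun hc => hu0 (by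
        subst ha hb hc; ext i j; fin_cases i <;> fin_cases j <;> simp)
      refine ⟨c' / c, ?_⟩
      subst ha hb
      ext i j
      fin_cases i <;> fin_cases j <;> simp_all
    · refine ⟨b' / b, ?_⟩
      subst ha
      have : a' = 0 := by simpa [hb] using k1.symm
      subst this
      ext i j
      fin_cases i <;> fin_cases j <;> simp [hb]
      field_simp
      linear_combination k3
  · refine ⟨a' / a, ?_⟩
    ext i j
    fin_cases i <;> fin_cases j <;> simp [ha] <;> field_simp
    · linear_combination k1
    · linear_combination -k2

theorem M2.mul_comm_of_mul_comm {u v w : M2 K} (hu : u.trace = 0) (hv : v.trace = 0)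
    (h2 : (2 : K) ≠ 0) (hu0 : u ≠ 0) (h : u * v = v * u) (huw : u * w = w * u) :
    v * w = w * v := by
  obtain ⟨c, rfl⟩ := M2.exists_smul_of_commute hu hv h2 hu0 h
  simp [huw]

/-- The elements of `SL(2, K)` whose conjugation action preserves the line of `v`. -/
def fixer (v : M2 K) : Subgroup (SL2 K) where
  carrier := {g | ∃ l : K, l ≠ 0 ∧ g.1 * v = l • (v * g.1)}
  one_mem' := ⟨1, one_ne_zero, by simp⟩
  mul_mem' := by
    rintro g h ⟨l, hl, hg⟩ ⟨m, hm, hh⟩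
    refine ⟨l * m, mul_ne_zero hl hm, ?_⟩
    rw [Matrix.SpecialLinearGroup.coe_mul, mul_assoc, hh, mul_smul_comm, ← mul_assoc, hg,
      smul_mul_assoc,
      smul_smul, mul_assoc, mul_comm m]
  inv_mem' := by
    rintro g ⟨l, hl, hg⟩
    refine ⟨l⁻¹, inv_ne_zero hl, ?_⟩
    have h1 : (g⁻¹).1 * g.1 = 1 := by rw [← Matrix.SpecialLinearGroup.coe_mul, inv_mul_cancel]; simp
    have h2 : g.1 * (g⁻¹).1 = 1 := by rw [← Matrix.SpecialLinearGroup.coe_mul, mul_inv_cancel]; simp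
    calc (g⁻¹).1 * v = l⁻¹ • ((g⁻¹).1 * (l • (v * g.1)) * (g⁻¹).1) := by
          rw [mul_smul_comm, smul_mul_assoc, smul_smul, inv_mul_cancel₀ hl, one_smul, mul_assoc,
            mul_assoc, h2, mul_one]
      _ = l⁻¹ • (v * (g⁻¹).1) := by rw [← hg, ← mul_assoc, h1, one_mul]

theorem mem_fixer_of_commute {g : SL2 K} {v : M2 K} (h : g.1 * v = v * g.1) : g ∈ fixer v :=
  ⟨1, one_ne_zero, by simpa using h⟩

theorem neg_one_mem_fixer (v : M2 K) : (-1 : SL2 K) ∈ fixer v :=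
  mem_fixer_of_commute (by simp)

theorem mem_fixer_smul {g : SL2 K} {v : M2 K} (c : K) (h : g ∈ fixer v) : g ∈ fixer (c • v) := by
  obtain ⟨l, hl, h⟩ := h
  exact ⟨l, hl, by rw [mul_smul_comm, h, smul_mul_assoc, smul_comm]⟩

theorem mem_fixer_congr {g : SL2 K} {u v : M2 K} (h2 : (2 : K) ≠ 0) (hu : u.trace = 0)
    (hv : v.trace = 0) (hu0 : u ≠ 0) (h : u * v = v * u) (hg : g ∈ fixer u) : g ∈ fixer v := by
  obtain ⟨c, rfl⟩ := M2.exists_smul_of_commute hu hv h2 hu0 h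
  exact mem_fixer_smul c hg

theorem mem_fixer_commutator {g : SL2 K} {u v : M2 K} (hu : g ∈ fixer u) (hv : g ∈ fixer v) :
    g ∈ fixer (u * v - v * u) := by
  obtain ⟨l, hl, hu⟩ := hu
  obtain ⟨m, hm, hv⟩ := hv
  refine ⟨l * m, mul_ne_zero hl hm, ?_⟩
  have h1 : g.1 * (u * v) = (l * m) • (u * v * g.1) := by
    rw [← mul_assoc, hu, smul_mul_assoc, mul_assoc, hv, mul_smul_comm, smul_smul, mul_assoc]
  have h2 : g.1 * (v * u) = (l * m) • (v * u * g.1) := by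
    rw [← mul_assoc, hv, smul_mul_assoc, mul_assoc, hu, mul_smul_comm, smul_smul, mul_assoc,
      mul_comm m]
  rw [mul_sub, h1, h2, sub_mul, smul_sub]

/-- The trace-free part of twice `g`. -/
def axis (g : M2 K) : M2 K := (2 : K) • g - g.trace • (1 : M2 K)

theorem trace_axis (g : M2 K) : (axis g).trace = 0 := by
  simp [axis, trace_fin_two]; ring

theorem axis_mul_comm_iff {g v : M2 K} (h2 : (2 : K) ≠ 0) :
    axis g * v = v * axis g ↔ g * v = v * g := by
  simp only [axis, sub_mul, mul_sub, smul_mul_assoc, mul_smul_comm, one_mul, mul_one]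
  constructor
  · intro h
    have := sub_left_injective h
    exact smul_right_injective _ h2 this
  · intro h
    rw [h]

theorem axis_eq_zero_iff {g : SL2 K} (h2 : (2 : K) ≠ 0) : axis g.1 = 0 ↔ g = 1 ∨ g = -1 := by
  constructor
  · intro h
    have e00 := congrFun (congrFun h 0) 0
    have e01 := congrFun (congrFun h 0) 1
    have e10 := congrFun (congrFun h 1) 0
    simp [axis, trace_fin_two] at e00 e01 e10
    have hd := g.2
    rw [det_fin_two] at hd
    have k01 := e01.resolve_left h2
    have k10 := e10.resolve_left h2
    have k : g.1 1 1 = g.1 0 0 := by linear_combination -e00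
    rw [k01, k10, k] at hd
    have : (g.1 0 0 - 1) * (g.1 0 0 + 1) = 0 := by linear_combination hd
    rcases mul_eq_zero.1 this with h | h
    · left
      ext i j
      fin_cases i <;> fin_cases j <;> simp [k, k01, k10] <;> linear_combination h
    · right
      ext i j
      fin_cases i <;> fin_cases j <;> simp [k, k01, k10] <;> linear_combination h
  · rintro (rfl | rfl) <;> ext i j <;> fin_cases i <;> fin_cases j <;> simp [axis]

theorem axis_ne_zero_of_trace {g : SL2 K} (h2 : (2 : K) ≠ 0) (h : g.1.trace ≠ 2)
    (h' : g.1.trace ≠ -2) : axis g.1 ≠ 0 := by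
  rw [Ne, axis_eq_zero_iff h2]
  rintro (rfl | rfl)
  · exact h (by simp)
  · exact h' (by simp)

/-- An element fixing the line of `v` commutes with `v`, or it has trace zero, or `v` is nilpotent;
in the last two cases it is orthogonal to `v`. -/
theorem fixer_cases {g : SL2 K} {v : M2 K} (h : g ∈ fixer v) :
    g.1 * v = v * g.1 ∨ (g.1 * v).trace = 0 ∧ (g.1.trace = 0 ∨ v.det = 0) := by
  obtain ⟨l, hl, h⟩ := h
  by_cases h1 : l = 1
  · left; rw [h, h1, one_smul]
  right
  have ht := congrArg Matrix.trace h
  rw [trace_smul, trace_mul_comm v, smul_eq_mul] at ht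
  refine ⟨by
    have : (l - 1) * (g.1 * v).trace = 0 := by linear_combination -ht
    exact (mul_eq_zero.1 this).resolve_left (sub_ne_zero.2 h1), ?_⟩
  by_cases hv : v.det = 0
  · exact .inr hv
  left
  have hv' : IsUnit v.det := isUnit_iff_ne_zero.2 hv
  have h3 : g.1 = l • (v * g.1 * v⁻¹) := by
    rw [← smul_mul_assoc, ← h, mul_assoc, mul_nonsing_inv _ hv', mul_one]
  have h4 := congrArg Matrix.trace h3
  rw [trace_smul, trace_mul_comm, ← mul_assoc, nonsing_inv_mul _ hv', one_mul, smul_eq_mul] at h4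
  have : (l - 1) * g.1.trace = 0 := by linear_combination -h4
  exact (mul_eq_zero.1 this).resolve_left (sub_ne_zero.2 h1)

theorem mem_fixer_of_orthogonal {g : SL2 K} {v : M2 K} (hv : v.trace = 0) (hg : g.1.trace = 0)
    (h : (g.1 * v).trace = 0) : g ∈ fixer v := by
  refine ⟨-1, by simp, ?_⟩
  have := M2.anticomm hg hv
  rw [h, zero_smul] at this
  rw [eq_neg_of_add_eq_zero_left this, neg_smul, one_smul]

theorem mem_fixer_axis (g : SL2 K) : g ∈ fixer (axis g.1) :=
  mem_fixer_of_commute (by simp [axis, mul_sub, sub_mul])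

theorem trace_mul_commutator {u v : M2 K} : (u * (u * v - v * u)).trace = 0 := by
  rw [mul_sub, trace_sub, ← mul_assoc, ← mul_assoc, trace_mul_comm (u * v) u, ← mul_assoc, sub_self]

theorem trace_commutator (u v : M2 K) : (u * v - v * u).trace = 0 := by
  rw [trace_sub, trace_mul_comm, sub_self]

theorem trace_mul_commutator' {u v : M2 K} : (v * (u * v - v * u)).trace = 0 := by
  rw [← neg_sub, mul_neg, trace_neg, trace_mul_commutator, neg_zero]

/-- A traceless matrix orthogonal to two others is proportional to their commutator. -/
theorem commute_commutator_of_orthogonal {u v z : M2 K} (hu : u.trace = 0) (hv : v.trace = 0)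
    (hz : z.trace = 0) (h : (z * u).trace = 0) (h' : (z * v).trace = 0) :
    z * (u * v - v * u) = (u * v - v * u) * z := by
  have e1 := M2.anticomm hz hu
  have e2 := M2.anticomm hz hv
  rw [h, zero_smul] at e1
  rw [h', zero_smul] at e2
  have e1 := eq_neg_of_add_eq_zero_left e1
  have e2 := eq_neg_of_add_eq_zero_left e2
  rw [mul_sub, sub_mul, ← mul_assoc, ← mul_assoc, e1, e2, neg_mul, neg_mul, mul_assoc, mul_assoc,
    e1, e2, mul_neg, mul_neg, neg_neg, neg_neg, mul_assoc, mul_assoc]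

theorem commute_of_orthogonal {u v z z' : M2 K} (h2 : (2 : K) ≠ 0) (hu : u.trace = 0)
    (hv : v.trace = 0) (hz : z.trace = 0) (hz' : z'.trace = 0) (huv : u * v ≠ v * u)
    (h1 : (z * u).trace = 0) (h1' : (z * v).trace = 0) (h3 : (z' * u).trace = 0)
    (h3' : (z' * v).trace = 0) : z * z' = z' * z :=
  M2.mul_comm_of_mul_comm (trace_commutator u v) hz h2 (sub_ne_zero.2 huv)
    (commute_commutator_of_orthogonal hu hv hz h1 h1').symm
    (commute_commutator_of_orthogonal hu hv hz' h3 h3').symm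

end Lines

section Reducible

open Matrix

variable {K : Type*} [Field K]

theorem M2.mul_self {v : M2 K} (hv : v.trace = 0) : v * v = (-v.det) • (1 : M2 K) := by
  rw [M2.cayley, hv]; simp

theorem M2.trace_mul_self {v : M2 K} (hv : v.trace = 0) : (v * v).trace = -2 * v.det := by
  rw [M2.mul_self hv, trace_smul]; simp [mul_comm]

theorem M2.gram {u v w : M2 K} (hu : u.trace = 0) (hv : v.trace = 0) (hw : w.trace = 0) :
    2 * ((u * u).trace * (v * v).trace * (w * w).trace
      + 2 * (u * v).trace * (v * w).trace * (u * w).trace - (u * u).trace * (v * w).trace ^ 2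
      - (v * v).trace * (u * w).trace ^ 2 - (w * w).trace * (u * v).trace ^ 2)
      = -(u * (v * w - w * v)).trace ^ 2 := by
  rw [M2.eq_of_trace_eq_zero hu, M2.eq_of_trace_eq_zero hv, M2.eq_of_trace_eq_zero hw]
  simp [trace_fin_two, mul_sub]
  ring

theorem M2.commute_of_det_eq_zero {u v : M2 K} (hu : u.trace = 0) (hv : v.trace = 0)
    (hu' : u.det = 0) (hv' : v.det = 0) (h : (u * v).trace = 0) :
    u * v = v * u := by
  rw [det_fin_two] at hu' hv'
  rw [M2.eq_of_trace_eq_zero hu] at hu' h ⊢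
  rw [M2.eq_of_trace_eq_zero hv] at hv' h ⊢
  generalize u 0 0 = a at *
  generalize u 0 1 = b at *
  generalize u 1 0 = c at *
  generalize v 0 0 = a' at *
  generalize v 0 1 = b' at *
  generalize v 1 0 = c' at *
  simp [trace_fin_two] at hu' hv' h
  have e1 : b * c' = c * b' := by
    have : (b * c' - c * b') ^ 2 = 0 := by
      linear_combination (b * c' + c * b' - 2 * a * a') * h + (4 * b' * c') * hu' +
        (-4 * a * a) * hv'
    linear_combination pow_eq_zero_iff (two_ne_zero) |>.1 this
  have e2 : a * b' = a' * b := by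
    have : (a * b' - a' * b) ^ 2 = 0 := by
      linear_combination (-b * b') * h - b' ^ 2 * hu' - b ^ 2 * hv'
    linear_combination pow_eq_zero_iff (two_ne_zero) |>.1 this
  have e3 : a * c' = a' * c := by
    have : (a * c' - a' * c) ^ 2 = 0 := by
      linear_combination (-c * c') * h - c' ^ 2 * hu' - c ^ 2 * hv'
    linear_combination pow_eq_zero_iff (two_ne_zero) |>.1 this
  ext i j
  fin_cases i <;> fin_cases j <;> simp
  · linear_combination e1
  · linear_combination 2 * e2
  · linear_combination -2 * e3
  · linear_combination -e1

/-- A subgroup of `SL(2, K)` is reducible if it preserves a line of traceless matrices. -/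
def Red (H : Subgroup (SL2 K)) : Prop := ∃ v : M2 K, v ≠ 0 ∧ v.trace = 0 ∧ H ≤ fixer v

theorem Red.mono {H H' : Subgroup (SL2 K)} (h : Red H) (hle : H' ≤ H) : Red H' := by
  obtain ⟨v, h0, ht, hv⟩ := h
  exact ⟨v, h0, ht, hle.trans hv⟩

theorem trace_eq_of_commute_nilpotent {c : SL2 K} {v : M2 K} (h2 : (2 : K) ≠ 0) (hv0 : v ≠ 0)
    (hv : v.trace = 0) (hd : v.det = 0) (h : c.1 * v = v * c.1) :
    c.1.trace = 2 ∨ c.1.trace = -2 := by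
  obtain ⟨s, hs⟩ := M2.exists_smul_of_commute hv (trace_axis c.1) h2 hv0
    ((axis_mul_comm_iff h2).2 h).symm
  have h1 : (axis c.1).det = 4 - c.1.trace ^ 2 := by
    have := c.2
    rw [det_fin_two] at this
    simp [axis, det_fin_two, trace_fin_two]
    linear_combination 4 * this
  rw [hs, det_smul, hd, mul_zero] at h1
  have : (c.1.trace - 2) * (c.1.trace + 2) = 0 := by linear_combination h1
  rcases mul_eq_zero.1 this with h | h
  · left; linear_combination h
  · right; linear_combination h

theorem SL2.mul_inv_val (g : SL2 K) : g.1 * (g⁻¹).1 = 1 := by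
  rw [← Matrix.SpecialLinearGroup.coe_mul, mul_inv_cancel]; simp

theorem SL2.inv_mul_val (g : SL2 K) : (g⁻¹).1 * g.1 = 1 := by
  rw [← Matrix.SpecialLinearGroup.coe_mul, inv_mul_cancel]; simp

theorem SL2.trace_conj (g h : SL2 K) : (h * g * h⁻¹).1.trace = g.1.trace := by
  rw [Matrix.SpecialLinearGroup.coe_mul, trace_mul_comm, ← Matrix.SpecialLinearGroup.coe_mul]
  simp

/-- The subgroup contains no unipotent elements, up to sign. -/
def Semisimple (H : Subgroup (SL2 K)) : Prop :=
  ∀ h ∈ H, h.1.trace = 2 ∨ h.1.trace = -2 → h = 1 ∨ h = -1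

theorem commute_commutator_of_fixer {a h : SL2 K} {v : M2 K} (ha : a ∈ fixer v)
    (hh : h ∈ fixer v) : (a * h * a⁻¹ * h⁻¹).1 * v = v * (a * h * a⁻¹ * h⁻¹).1 := by
  obtain ⟨l, hl, ha⟩ := ha
  obtain ⟨m, hm, hh⟩ := hh
  have e : (a * h * a⁻¹ * h⁻¹).1 * (h * a).1 = (a * h).1 := by
    rw [← Matrix.SpecialLinearGroup.coe_mul, show a * h * a⁻¹ * h⁻¹ * (h * a) = a * h by group]
  have e1 : (a * h).1 * v = (l * m) • (v * (a * h).1) := by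
    rw [Matrix.SpecialLinearGroup.coe_mul, mul_assoc, hh, mul_smul_comm, ← mul_assoc, ha,
      smul_mul_assoc, smul_smul, mul_assoc, mul_comm m]
  have e2 : (h * a).1 * v = (l * m) • (v * (h * a).1) := by
    rw [Matrix.SpecialLinearGroup.coe_mul, mul_assoc, ha, mul_smul_comm, ← mul_assoc, hh,
      smul_mul_assoc, smul_smul, mul_assoc]
  have e3 : (a * h * a⁻¹ * h⁻¹).1 * v * (h * a).1 = v * (a * h * a⁻¹ * h⁻¹).1 * (h * a).1 := by
    rw [mul_assoc v, e]
    apply smul_right_injective _ (mul_ne_zero hl hm)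
    simp only
    rw [← e1, mul_assoc, ← mul_smul_comm, ← e2, ← mul_assoc, e]
  calc _ = (a * h * a⁻¹ * h⁻¹).1 * v * (h * a).1 * ((h * a)⁻¹).1 := by
          rw [mul_assoc _ (h * a).1, SL2.mul_inv_val, mul_one]
    _ = _ := by rw [e3, mul_assoc _ (h * a).1, SL2.mul_inv_val, mul_one]

/-- A reducible semisimple group fixes the axis of each of its elements of nonzero trace. -/
theorem Red.mem_fixer_axis {H : Subgroup (SL2 K)} (h2 : (2 : K) ≠ 0) (hH : Red H)
    (hs : Semisimple H) {a h : SL2 K} (ha : a ∈ H) (hat : a.1.trace ≠ 0) (hh : h ∈ H) :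
    h ∈ fixer (axis a.1) := by
  obtain ⟨v, hv0, hvt, hv⟩ := hH
  rcases fixer_cases (hv ha) with hc | ⟨-, h | hd⟩
  · exact mem_fixer_congr h2 hvt (trace_axis _) hv0 ((axis_mul_comm_iff h2).2 hc).symm (hv hh)
  · exact absurd h hat
  have hc := hs _ (H.mul_mem (H.mul_mem (H.mul_mem ha hh) (H.inv_mem ha)) (H.inv_mem hh))
    (trace_eq_of_commute_nilpotent h2 hv0 hvt hd (commute_commutator_of_fixer (hv ha) (hv hh)))
  rcases hc with hc | hc
  · apply mem_fixer_of_commute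
    rw [eq_comm, axis_mul_comm_iff h2, ← Matrix.SpecialLinearGroup.coe_mul,
      ← Matrix.SpecialLinearGroup.coe_mul]
    congr 1
    rw [mul_inv_eq_one, mul_inv_eq_iff_eq_mul] at hc
    exact hc
  · exfalso
    have e : a = -(h * a * h⁻¹) := by
      have : a * h = (-1) * (h * a) := by rw [← hc]; group
      simpa [mul_assoc] using eq_mul_inv_of_mul_eq this
    have e' := congrArg (fun g : SL2 K => g.1.trace) e
    simp only [Matrix.SpecialLinearGroup.coe_neg, trace_neg, SL2.trace_conj] at e'
    exact hat ((mul_eq_zero.1 (show 2 * a.1.trace = 0 by linear_combination e')).resolve_left h2)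

theorem fixer_of_trace_eq_zero {g : SL2 K} {v : M2 K} (hg : g.1.trace = 0) (hv : v.trace = 0) :
    g ∈ fixer v ↔ g.1 * v = v * g.1 ∨ (g.1 * v).trace = 0 := by
  constructor
  · intro h
    rcases fixer_cases h with h | ⟨h, -⟩
    · exact .inl h
    · exact .inr h
  · rintro (h | h)
    · exact mem_fixer_of_commute h
    · exact mem_fixer_of_orthogonal hv hg h

theorem exists_fin_four (k : Fin 4) :
    ∃ i j l : Fin 4, i ≠ k ∧ j ≠ k ∧ l ≠ k ∧ i ≠ j ∧ i ≠ l ∧ j ≠ l := by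
  revert k; decide

theorem exists_fin_four' {i k : Fin 4} (h : i ≠ k) :
    ∃ j l : Fin 4, j ≠ k ∧ l ≠ k ∧ i ≠ j ∧ i ≠ l ∧ j ≠ l := by
  revert i k; decide

theorem no_three_lines_of_trace_ne_zero (h2 : (2 : K) ≠ 0) {g : Fin 4 → SL2 K} {v : Fin 4 → M2 K}
    {k : Fin 4} (hk : (g k).1.trace ≠ 0) (hk1 : g k ≠ 1) (hk2 : g k ≠ -1)
    (hv0 : ∀ i ≠ k, v i ≠ 0) (hv : ∀ i ≠ k, (v i).trace = 0)
    (h : ∀ i ≠ k, ∀ j, g j ∈ fixer (v i) ↔ j ≠ i) : False := by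
  have ha : axis (g k).1 ≠ 0 := by rw [Ne, axis_eq_zero_iff h2]; tauto
  have hne : ∀ i j, i ≠ k → j ≠ k → i ≠ j → v i * v j ≠ v j * v i := fun i j hi hj hij e =>
    (h i hi i).1 (mem_fixer_congr h2 (hv j hj) (hv i hi) (hv0 j hj) e.symm
      ((h j hj i).2 hij)) rfl
  have hcom : ∀ i j, i ≠ k → j ≠ k → i ≠ j → (g k).1 * v i = v i * (g k).1 →
      (g k).1 * v j ≠ v j * (g k).1 := fun i j hi hj hij e e' =>
    hne i j hi hj hij (M2.mul_comm_of_mul_comm (trace_axis (g k).1) (hv i hi) h2 ha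
      ((axis_mul_comm_iff h2).2 e) ((axis_mul_comm_iff h2).2 e'))
  have hort : ∀ i, i ≠ k → (g k).1 * v i ≠ v i * (g k).1 →
      (v i).det = 0 ∧ (axis (g k).1 * v i).trace = 0 := by
    intro i hi e
    rcases fixer_cases ((h i hi k).2 hi.symm) with h' | ⟨h1, h' | h'⟩
    · exact absurd h' e
    · exact absurd h' hk
    · exact ⟨h', by simp [axis, sub_mul, h1, hv i hi]⟩
  have main : ∀ i j l, i ≠ k → j ≠ k → l ≠ k → i ≠ j → i ≠ l → j ≠ l →
      (g k).1 * v i ≠ v i * (g k).1 → (g k).1 * v j ≠ v j * (g k).1 → False := by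
    intro i j l hi hj hl hij hil hjl ni nj
    obtain ⟨di, oi⟩ := hort i hi ni
    obtain ⟨dj, oj⟩ := hort j hj nj
    have hw := commute_commutator_of_orthogonal (hv i hi) (hv j hj) (trace_axis _) oi oj
    by_cases nl : (g k).1 * v l = v l * (g k).1
    · refine (h l hl l).1 (mem_fixer_congr h2 (trace_commutator (v i) (v j)) (hv l hl)
        (sub_ne_zero.2 (hne i j hi hj hij)) ?_ (mem_fixer_commutator ((h i hi l).2 hil.symm)
        ((h j hj l).2 hjl.symm))) rfl
      exact M2.mul_comm_of_mul_comm (trace_axis _) (trace_commutator _ _) h2 ha hw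
        ((axis_mul_comm_iff h2).2 nl)
    · obtain ⟨dl, ol⟩ := hort l hl nl
      obtain ⟨c, hc⟩ := M2.exists_smul_of_commute (trace_axis _) (trace_commutator _ _) h2 ha hw
      have e : (v l * (v i * v j - v j * v i)).trace = 0 := by
        rw [hc, mul_smul_comm, trace_smul, trace_mul_comm, ol, smul_zero]
      have := M2.gram (hv l hl) (hv i hi) (hv j hj)
      rw [e, M2.trace_mul_self (hv i hi), M2.trace_mul_self (hv j hj), M2.trace_mul_self (hv l hl),
        di, dj, dl] at this
      have h' : (v l * v i).trace * (v i * v j).trace * (v l * v j).trace = 0 := by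
        have : 4 * ((v l * v i).trace * (v i * v j).trace * (v l * v j).trace) = 0 := by
          linear_combination this
        exact (mul_eq_zero.1 this).resolve_left (by
          rw [show (4 : K) = 2 * 2 by norm_num]; exact mul_ne_zero h2 h2)
      rcases mul_eq_zero.1 h' with h' | h'
      · rcases mul_eq_zero.1 h' with h' | h'
        · exact hne l i hl hi hil.symm
            (M2.commute_of_det_eq_zero (hv l hl) (hv i hi) dl di h')
        · exact hne i j hi hj hij (M2.commute_of_det_eq_zero (hv i hi) (hv j hj) di dj h')
      · exact hne l j hl hj hjl.symm (M2.commute_of_det_eq_zero (hv l hl) (hv j hj) dl dj h')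
  obtain ⟨i, j, l, hi, hj, hl, hij, hil, hjl⟩ := exists_fin_four k
  by_cases ni : (g k).1 * v i = v i * (g k).1
  · exact main j l i hj hl hi hjl hij.symm hil.symm (hcom i j hi hj hij ni) (hcom i l hi hl hil ni)
  by_cases nj : (g k).1 * v j = v j * (g k).1
  · exact main i l j hi hl hj hil hij hjl.symm ni (hcom j l hj hl hjl nj)
  exact main i j l hi hj hl hij hil hjl ni nj

theorem SL2.ne_zero (g : SL2 K) : g.1 ≠ 0 := by
  intro h
  have := g.2
  rw [h] at this
  simp at this

theorem no_three_lines_of_trace_eq_zero (h2 : (2 : K) ≠ 0) {g : Fin 4 → SL2 K} {v : Fin 4 → M2 K}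
    (k : Fin 4) (hg : ∀ i, (g i).1.trace = 0)
    (hv0 : ∀ i ≠ k, v i ≠ 0) (hv : ∀ i ≠ k, (v i).trace = 0)
    (h : ∀ i ≠ k, ∀ j, g j ∈ fixer (v i) ↔ j ≠ i) : False := by
  have hne : ∀ i j, i ≠ k → j ≠ k → i ≠ j → v i * v j ≠ v j * v i := fun i j hi hj hij e =>
    (h i hi i).1 (mem_fixer_congr h2 (hv j hj) (hv i hi) (hv0 j hj) e.symm
      ((h j hj i).2 hij)) rfl
  have hor : ∀ i ≠ k, ∀ j ≠ i, (g j).1 * v i = v i * (g j).1 ∨ (g j * v i : M2 K).trace = 0 :=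
    fun i hi j hj => (fixer_of_trace_eq_zero (hg j) (hv i hi)).1 ((h i hi j).2 hj)
  have hnc : ∀ i ≠ k, (g i).1 * v i ≠ v i * (g i).1 := fun i hi e =>
    (h i hi i).1 (mem_fixer_of_commute e) rfl
  have hno : ∀ i ≠ k, (g i * v i : M2 K).trace ≠ 0 := fun i hi e =>
    (h i hi i).1 (mem_fixer_of_orthogonal (hv i hi) (hg i) e) rfl
  have gcom : ∀ i j, (g i).1 * (g j).1 = (g j).1 * (g i).1 → ∃ c : K, (g j).1 = c • (g i).1 :=
    fun i j e => M2.exists_smul_of_commute (hg i) (hg j) h2 (SL2.ne_zero _) e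
  have vcom : ∀ i ≠ k, ∀ j, (g j).1 * v i = v i * (g j).1 → ∃ c : K, v i = c • (g j).1 :=
    fun i hi j e => M2.exists_smul_of_commute (hg j) (hv i hi) h2 (SL2.ne_zero _) e
  have gne : ∀ i ≠ k, ∀ j ≠ i, (g i).1 * (g j).1 ≠ (g j).1 * (g i).1 := by
    intro i hi j hj e
    obtain ⟨c, hc⟩ := gcom j i e.symm
    rcases hor i hi j hj with h' | h'
    · exact hnc i hi (by rw [hc, smul_mul_assoc, mul_smul_comm, h'])
    · exact hno i hi (by rw [hc, smul_mul_assoc, trace_smul, h', smul_zero])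
  have once : ∀ i j l, i ≠ k → j ≠ k → i ≠ j → (g l).1 * v i = v i * (g l).1 →
      (g l).1 * v j ≠ v j * (g l).1 := fun i j l hi hj hij e e' =>
    hne i j hi hj hij (M2.mul_comm_of_mul_comm (hg l) (hv i hi) h2 (SL2.ne_zero _) e e')
  have two : ∀ i j l m, i ≠ k → j ≠ k → i ≠ j → l ≠ m → (l ≠ k ∨ m ≠ k) →
      (g l * v i : M2 K).trace = 0 → (g l * v j : M2 K).trace = 0 →
      (g m * v i : M2 K).trace = 0 → (g m * v j : M2 K).trace = 0 → False := by
    intro i j l m hi hj hij hlm hor' e1 e2 e3 e4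
    have := commute_of_orthogonal h2 (hv i hi) (hv j hj) (hg l) (hg m) (hne i j hi hj hij)
      e1 e2 e3 e4
    rcases hor' with h' | h'
    · exact gne l h' m hlm.symm this
    · exact gne m h' l hlm this.symm
  have A : ∀ i j l, i ≠ k → j ≠ k → l ≠ k → i ≠ j → i ≠ l → j ≠ l →
      (g k).1 * v i = v i * (g k).1 → False := by
    intro i j l hi hj hl hij hil hjl e
    obtain ⟨c, hc⟩ := vcom i hi k e
    have hc0 : c ≠ 0 := by rintro rfl; exact hv0 i hi (by simpa using hc)
    have oj := (hor j hj k hj.symm).resolve_left (once i j k hi hj hij e)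
    have ol := (hor l hl k hl.symm).resolve_left (once i l k hi hl hil e)
    have aux : ∀ m, m ≠ k → m ≠ i → (g k * v m : M2 K).trace = 0 →
        (g i * v m : M2 K).trace = 0 := by
      intro m hm hmi om
      refine (hor m hm i hmi.symm).resolve_left fun e' => ?_
      obtain ⟨d, hd⟩ := vcom m hm i e'
      have hd0 : d ≠ 0 := by rintro rfl; exact hv0 m hm (by simpa using hd)
      rw [hd, mul_smul_comm, trace_smul, smul_eq_mul] at om
      have := (mul_eq_zero.1 om).resolve_left hd0
      exact hno i hi (by rw [hc, mul_smul_comm, trace_smul, trace_mul_comm, this, smul_zero])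
    exact two j l k i hj hl hjl hi.symm (.inr hi) oj ol (aux j hj hij.symm oj)
      (aux l hl hil.symm ol)
  have B : ∀ i ≠ k, (g k * v i : M2 K).trace = 0 := by
    intro i hi
    obtain ⟨j, l, hj, hl, hij, hil, hjl⟩ := exists_fin_four' hi
    exact (hor i hi k hi.symm).resolve_left (A i j l hi hj hl hij hil hjl)
  have C : ∀ i j l, i ≠ k → j ≠ k → l ≠ k → i ≠ j → i ≠ l → j ≠ l →
      (g i).1 * v j = v j * (g i).1 ∨ (g i).1 * v l = v l * (g i).1 := by
    intro i j l hi hj hl hij hil hjl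
    by_contra! hcon
    exact two j l k i hj hl hjl hi.symm (.inr hi) (B j hj) (B l hl)
      ((hor j hj i hij).resolve_left hcon.1) ((hor l hl i hil).resolve_left hcon.2)
  have D : ∀ i j l, i ≠ k → j ≠ k → l ≠ k → i ≠ j → i ≠ l → j ≠ l →
      (g i).1 * v j = v j * (g i).1 → False := by
    intro i j l hi hj hl hij hil hjl e
    -- `v j ∼ g i`, hence `v i ∼ g l` and `v l ∼ g j`
    have inj : (g l).1 * v j ≠ v j * (g l).1 := fun e' =>
      gne i hi l hil.symm (M2.mul_comm_of_mul_comm (hv j hj) (hg i) h2 (hv0 j hj) e.symm e'.symm)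
    have e1 := (C l i j hl hi hj hil.symm hjl.symm hij).resolve_right inj
    have inj2 : (g j).1 * v i ≠ v i * (g j).1 := fun e' =>
      gne j hj l hjl.symm (M2.mul_comm_of_mul_comm (hv i hi) (hg j) h2 (hv0 i hi) e'.symm e1.symm)
    have e2 := (C j i l hj hi hl hij.symm hjl hil).resolve_left inj2
    obtain ⟨c, hc⟩ := vcom i hi l e1
    obtain ⟨d, hd⟩ := vcom j hj i e
    have hd0 : d ≠ 0 := by rintro rfl; exact hv0 j hj (by simpa using hd)
    have o := (hor j hj l hjl.symm).resolve_left inj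
    rw [hd, mul_smul_comm, trace_smul, smul_eq_mul] at o
    have := (mul_eq_zero.1 o).resolve_left hd0
    exact hno i hi (by rw [hc, mul_smul_comm, trace_smul, trace_mul_comm, this, smul_zero])
  obtain ⟨i, j, l, hi, hj, hl, hij, hil, hjl⟩ := exists_fin_four k
  rcases C i j l hi hj hl hij hil hjl with e | e
  · exact D i j l hi hj hl hij hil hjl e
  · exact D i l j hi hl hj hil hij hjl.symm e

end Reducible

section Poles

open MulAction

theorem pole_arith {n a b c x y z : ℕ} (hx : 2 ≤ x) (hxy : x ≤ y) (hyz : y ≤ z)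
    (h1 : a * x = n) (h2 : b * y = n) (h3 : c * z = n) (h : a + b + c = n + 2) (hc : 3 ≤ c) :
    n = 12 ∧ x = 2 ∧ y = 3 ∧ z = 3 ∨ n = 24 ∧ x = 2 ∧ y = 3 ∧ z = 4 ∨
      n = 60 ∧ x = 2 ∧ y = 3 ∧ z = 5 := by
  have hx2 : x = 2 := by
    by_contra hne
    have : 3 ≤ x := by omega
    have := Nat.mul_le_mul_left a this
    have := Nat.mul_le_mul_left b (show 3 ≤ y by omega)
    have := Nat.mul_le_mul_left c (show 3 ≤ z by omega)
    omega
  subst hx2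
  have hy3 : y = 3 := by
    by_contra hne
    rcases (show y = 2 ∨ 4 ≤ y by omega) with rfl | hy
    · omega
    have := Nat.mul_le_mul_left b hy
    have := Nat.mul_le_mul_left c (show 4 ≤ z by omega)
    omega
  subst hy3
  have hz : z < 6 := by
    by_contra! hz
    have := Nat.mul_le_mul_left c hz
    omega
  interval_cases z <;> omega

theorem pole_arith' {n : ℕ} {o e : Fin 3 → ℕ} (he : ∀ i, 2 ≤ e i) (hoe : ∀ i, o i * e i = n)
    (ho : ∀ i, 3 ≤ o i) (h : o 0 + o 1 + o 2 = n + 2) :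
    n = 12 ∧ (∀ i, e i = 2 ∨ e i = 3) ∨ n = 24 ∧ (∀ i, e i = 2 ∨ e i = 3 ∨ e i = 4) ∨
      n = 60 ∧ (∀ i, e i = 2 ∨ e i = 3 ∨ e i = 5) := by
  have p0 := he 0
  have p1 := he 1
  have p2 := he 2
  have q0 := hoe 0
  have q1 := hoe 1
  have q2 := hoe 2
  have r0 := ho 0
  have r1 := ho 1
  have r2 := ho 2
  simp only [Fin.forall_fin_succ, IsEmpty.forall_iff, and_true, Fin.succ_zero_eq_one,
    Fin.succ_one_eq_two]
  clear he hoe ho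
  generalize e 0 = e0 at *
  generalize e 1 = e1 at *
  generalize e 2 = e2 at *
  generalize o 0 = o0 at *
  generalize o 1 = o1 at *
  generalize o 2 = o2 at *
  rcases le_total e0 e1 with h01 | h01 <;> rcases le_total e1 e2 with h12 | h12 <;>
    rcases le_total e0 e2 with h02 | h02
  · have := pole_arith p0 h01 h12 q0 q1 q2 (by omega) r2; omega
  · have := pole_arith p0 h01 h12 q0 q1 q2 (by omega) r2; omega
  · have := pole_arith p0 h02 h12 q0 q2 q1 (by omega) r1; omega
  · have := pole_arith p2 h02 h01 q2 q0 q1 (by omega) r1; omega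
  · have := pole_arith p1 h01 h02 q1 q0 q2 (by omega) r2; omega
  · have := pole_arith p1 h12 h02 q1 q2 q0 (by omega) r0; omega
  · have := pole_arith p2 h12 h01 q2 q1 q0 (by omega) r0; omega
  · have := pole_arith p2 h12 h01 q2 q1 q0 (by omega) r0; omega

variable {G X : Type*} [Group G] [MulAction G X]

theorem exists_pair_of_card_orbit_le_two {x : X} [Finite (orbit G x)]
    (h : Nat.card (orbit G x) ≤ 2) :
    (∃ x : X, ∀ g : G, g • x = x) ∨
      ∃ x y : X, x ≠ y ∧ ∀ g : G, g • x = x ∧ g • y = y ∨ g • x = y ∧ g • y = x := by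
  by_cases hx : ∀ g : G, g • x = x
  · exact .inl ⟨x, hx⟩
  push Not at hx
  obtain ⟨k, hk⟩ := hx
  right
  refine ⟨x, k • x, hk.symm, fun g => ?_⟩
  have hxy : orbit G x = {x, k • x} := by
    refine (Set.eq_of_subset_of_ncard_le ?_ ?_ (Set.toFinite _)).symm
    · rintro _ (rfl | rfl)
      · exact mem_orbit_self _
      · exact mem_orbit _ _
    · rw [Set.ncard_pair hk.symm]; exact h
  have e1 : g • x ∈ ({x, k • x} : Set X) := hxy ▸ mem_orbit x g
  have e2 : g • k • x ∈ ({x, k • x} : Set X) := by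
    rw [← hxy, smul_smul]; exact mem_orbit x _
  rcases e1 with e1 | e1 <;> rcases e2 with e2 | e2
  · exact absurd (smul_left_cancel g (e2.trans e1.symm)) hk
  · exact .inl ⟨e1, e2⟩
  · exact .inr ⟨e1, e2⟩
  · exact absurd (smul_left_cancel g (e2.trans e1.symm)) hk

theorem poles [Finite G] [Finite X] {z : G} (hz1 : z ≠ 1) (hzz : z * z = 1)
    (hz : ∀ x : X, z • x = x) (h2 : ∀ g : G, g ≠ 1 → g ≠ z → Nat.card (fixedBy X g) = 2)
    (hs : ∀ x : X, ∃ g : G, g ≠ 1 ∧ g ≠ z ∧ g • x = x) :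
    Nat.card G = 2 ∨ (∃ x : X, ∀ g : G, g • x = x) ∨
      (∃ x y : X, x ≠ y ∧ ∀ g : G, g • x = x ∧ g • y = y ∨ g • x = y ∧ g • y = x) ∨
      Nat.card G = 24 ∧ (∀ x : X, Nat.card (stabilizer G x) = 2 * 2 ∨
        Nat.card (stabilizer G x) = 2 * 3) ∨
      Nat.card G = 48 ∧ (∀ x : X, Nat.card (stabilizer G x) = 2 * 2 ∨
        Nat.card (stabilizer G x) = 2 * 3 ∨ Nat.card (stabilizer G x) = 2 * 4) ∨
      Nat.card G = 120 ∧ (∀ x : X, Nat.card (stabilizer G x) = 2 * 2 ∨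
        Nat.card (stabilizer G x) = 2 * 3 ∨ Nat.card (stabilizer G x) = 2 * 5) := by
  classical
  have := Fintype.ofFinite G
  have := Fintype.ofFinite X
  have hz' : orderOf z = 2 := by
    rw [orderOf_eq_prime_iff]; exact ⟨by rw [pow_two, hzz], hz1⟩
  -- the stabilizers
  have stab : ∀ x : X, ∃ e, 2 ≤ e ∧ Nat.card (stabilizer G x) = 2 * e := by
    intro x
    obtain ⟨g, hg1, hgz, hg⟩ := hs x
    have h1 : 2 ∣ Nat.card (stabilizer G x) := by
      rw [← hz']
      have : (Subgroup.zpowers z) ≤ stabilizer G x := by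
        rw [Subgroup.zpowers_le]; exact hz x
      rw [← Nat.card_zpowers]
      exact Subgroup.card_dvd_of_le this
    obtain ⟨e, he⟩ := h1
    refine ⟨e, ?_, he⟩
    by_contra! hlt
    have : ({1, z, g} : Set G) ⊆ stabilizer G x := by
      rintro _ (rfl | rfl | rfl)
      · exact one_mem _
      · exact hz x
      · exact hg
    have := Set.ncard_le_ncard this (Set.toFinite _)
    rw [Set.ncard_eq_three.2 ⟨1, z, g, hz1.symm, hg1.symm, hgz.symm, rfl⟩] at this
    have h3 : (stabilizer G x : Set G).ncard = 2 * e := he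
    omega
  have os : ∀ x : X, Nat.card (orbit G x) * Nat.card (stabilizer G x) = Nat.card G := by
    intro x
    simp only [Nat.card_eq_fintype_card]
    exact card_orbit_mul_card_stabilizer_eq_card_group G x
  choose e he hse using stab
  have hcard : 2 ∣ Nat.card G := by
    rw [← hz']; exact orderOf_dvd_natCard z
  obtain ⟨n, hn⟩ := hcard
  have os' : ∀ x : X, Nat.card (orbit G x) * e x = n := by
    intro x
    have := os x
    rw [hse, hn] at this
    have : 2 * (Nat.card (orbit G x) * e x) = 2 * n := by rw [← this]; ring
    omega
  have opos : ∀ x : X, 0 < Nat.card (orbit G x) := fun x =>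
    Nat.card_pos_iff.2 ⟨⟨⟨x, mem_orbit_self x⟩⟩, inferInstance⟩
  by_cases small : ∃ x : X, Nat.card (orbit G x) ≤ 2
  · obtain ⟨x, hx⟩ := small
    rcases exists_pair_of_card_orbit_le_two hx with h | h
    · exact .inr (.inl h)
    · exact .inr (.inr (.inl h))
  push Not at small
  have burnside := sum_card_fixedBy_eq_card_orbits_mul_card_group G X
  have hsum : ∑ g : G, Fintype.card (fixedBy X g) = 2 * Nat.card X + 2 * (Nat.card G - 2) := by
    have hu : (Finset.univ : Finset G) = insert 1 (insert z (Finset.univ \ {1, z})) := by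
      ext g; simp; tauto
    have hmem : ∀ g ∈ (Finset.univ \ {1, z} : Finset G), Fintype.card (fixedBy X g) = 2 := by
      intro g hg
      simp at hg
      rw [← Nat.card_eq_fintype_card]
      exact h2 g hg.1 hg.2
    rw [hu, Finset.sum_insert (by simp [hz1.symm]), Finset.sum_insert (by simp),
      Finset.sum_congr rfl hmem]
    have e1 : Fintype.card (fixedBy X (1 : G)) = Nat.card X := by
      rw [← Nat.card_eq_fintype_card, show fixedBy X (1 : G) = Set.univ by ext; simp]
      simp
    have e2 : Fintype.card (fixedBy X z) = Nat.card X := by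
      rw [← Nat.card_eq_fintype_card, show fixedBy X z = Set.univ by ext; simp [hz]]
      simp
    rw [e1, e2, Finset.sum_const, Finset.card_sdiff_of_subset (by simp), Finset.card_univ,
      Finset.card_pair hz1.symm, Nat.card_eq_fintype_card (α := G), smul_eq_mul]
    ring
  have hX : Nat.card X = ∑ w : Quotient (orbitRel G X), Nat.card (orbit G w.out) := by
    rw [Nat.card_congr (selfEquivSigmaOrbits G X), Nat.card_sigma]
  rw [hsum, ← Nat.card_eq_fintype_card (α := G)] at burnside
  set r := Fintype.card (Quotient (orbitRel G X)) with hr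
  have hb : 2 * Nat.card X ≤ r * n := by
    have : ∑ w : Quotient (orbitRel G X), 2 * Nat.card (orbit G w.out) ≤
        ∑ w : Quotient (orbitRel G X), n := by
      refine Finset.sum_le_sum fun w _ => ?_
      have := Nat.mul_le_mul_left (Nat.card (orbit G w.out)) (he w.out)
      rw [os'] at this
      omega
    rw [← Finset.mul_sum, ← hX, Finset.sum_const, Finset.card_univ, ← hr] at this
    simpa using this
  have hn0 : 0 < n := by
    have : 0 < Nat.card G := Nat.card_pos
    omega
  rw [hn] at burnside
  have hr3 : r ≤ 3 := by
    by_contra! h4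
    have h5 : 2 * Nat.card X + 2 * (2 * n - 2) = 2 * (r * n) := by rw [burnside]; ring
    have : 4 * n ≤ r * n := Nat.mul_le_mul_right n h4
    omega
  by_cases hr3' : r = 3
  · have equiv := Fintype.equivFinOfCardEq (hr.symm.trans hr3')
    have hsum3 : Nat.card X = Nat.card (orbit G (equiv.symm 0).out)
        + Nat.card (orbit G (equiv.symm 1).out) + Nat.card (orbit G (equiv.symm 2).out) := by
      rw [hX, ← equiv.symm.sum_comp, Fin.sum_univ_three]
    have key := pole_arith' (n := n) (o := fun i => Nat.card (orbit G (equiv.symm i).out))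
      (e := fun i => e (equiv.symm i).out) (fun i => he _) (fun i => os' _) (fun i => small _) (by
        rw [← hsum3]
        rw [hr3'] at burnside
        omega)
    have ex : ∀ x : X, ∃ i, e x = e (equiv.symm i).out := by
      intro x
      refine ⟨equiv (Quotient.mk'' x), ?_⟩
      rw [Equiv.symm_apply_apply]
      have hmem : orbit G (Quotient.mk'' x : Quotient (orbitRel G X)).out = orbit G x :=
        orbit_eq_iff.2 (orbitRel_apply.1 (Quotient.mk_out x))
      have h1 := os' x
      have h2 := os' (Quotient.mk'' x : Quotient (orbitRel G X)).out
      rw [hmem] at h2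
      exact Nat.eq_of_mul_eq_mul_left (opos x) (h1.trans h2.symm)
    right; right; right
    rcases key with ⟨h, h'⟩ | ⟨h, h'⟩ | ⟨h, h'⟩
    · refine .inl ⟨by omega, fun x => ?_⟩
      obtain ⟨i, hi⟩ := ex x
      have := h' i
      rw [hse x]
      omega
    · refine .inr (.inl ⟨by omega, fun x => ?_⟩)
      obtain ⟨i, hi⟩ := ex x
      have := h' i
      rw [hse x]
      omega
    · refine .inr (.inr ⟨by omega, fun x => ?_⟩)
      obtain ⟨i, hi⟩ := ex x
      have := h' i
      rw [hse x]
      omega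
  · left
    have hsmall : r * 3 ≤ Nat.card X := by
      have : ∑ w : Quotient (orbitRel G X), 3 ≤
          ∑ w : Quotient (orbitRel G X), Nat.card (orbit G w.out) :=
        Finset.sum_le_sum fun w _ => small w.out
      rw [← hX, Finset.sum_const, Finset.card_univ, ← hr] at this
      simpa using this
    have : r ≤ 2 := by omega
    interval_cases r <;> omega

end Poles

section Dickson

open Matrix MulAction
open scoped LinearAlgebra.Projectivization

variable {K : Type*} [Field K]

/-- The determinant of a pair of vectors in the plane. -/
def cross (a b : Fin 2 → K) : K := a 0 * b 1 - a 1 * b 0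

theorem cross_mulVec (h : SL2 K) (a b : Fin 2 → K) : cross (h.1 *ᵥ a) (h.1 *ᵥ b) = cross a b := by
  have hd := h.2
  rw [det_fin_two] at hd
  simp only [cross, mulVec, dotProduct, Fin.sum_univ_two]
  linear_combination (a 0 * b 1 - a 1 * b 0) * hd

theorem mk_eq_mk_of_cross {a b : Fin 2 → K} (ha : a ≠ 0) (hb : b ≠ 0) (h : cross a b = 0) :
    Projectivization.mk K a ha = Projectivization.mk K b hb := by
  rw [Projectivization.mk_eq_mk_iff']
  have h' : a 0 * b 1 = a 1 * b 0 := by simpa [cross, sub_eq_zero] using h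
  by_cases h0 : b 0 = 0
  · have h1 : b 1 ≠ 0 := fun h1 => hb (by ext i; fin_cases i <;> simp [h0, h1])
    have a0 : a 0 = 0 := by simpa [h0, h1] using h'
    exact ⟨a 1 / b 1, by ext i; fin_cases i <;> simp [h0, h1, a0]⟩
  · refine ⟨a 0 / b 0, ?_⟩
    ext i
    fin_cases i
    · simp [h0]
    · simp; field_simp; linear_combination h'

theorem smul_mk_eq_iff {h : SL2 K} {a b : Fin 2 → K} (ha : a ≠ 0) (hb : b ≠ 0) :
    h • Projectivization.mk K a ha = Projectivization.mk K b hb ↔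
      ∃ c : K, h.1 *ᵥ a = c • b := by
  rw [Projectivization.smul_mk, Projectivization.mk_eq_mk_iff']
  exact exists_congr fun c => eq_comm

theorem exists_two_fixed_points [IsAlgClosed K] {h : SL2 K}
    (h1 : h.1.trace ≠ 2) (h1' : h.1.trace ≠ -2) :
    ∃ x y : ℙ K (Fin 2 → K), x ≠ y ∧ ∀ w, h • w = w ↔ w = x ∨ w = y := by
  have hd := h.2
  rw [det_fin_two] at hd
  obtain ⟨l, hl⟩ : ∃ l : K, l * l - h.1.trace * l + 1 = 0 := by
    obtain ⟨l, hl⟩ := IsAlgClosed.exists_eval₂_eq_zero (RingHom.id K)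
      (Polynomial.X ^ 2 - Polynomial.C h.1.trace * Polynomial.X + 1) (by
        have : (Polynomial.X ^ 2 - Polynomial.C h.1.trace * Polynomial.X + 1 :
          Polynomial K).degree = 2 := by compute_degree!
        rw [this]; norm_num)
    refine ⟨l, ?_⟩
    simpa [pow_two] using hl
  have hl0 : l ≠ 0 := by rintro rfl; simp at hl
  have hl1 : l * l ≠ 1 := by
    intro e
    rcases mul_self_eq_one_iff.1 e with rfl | rfl
    · exact h1 (by linear_combination -hl)
    · exact h1' (by linear_combination hl)
  have ev : ∀ m : K, m * m - h.1.trace * m + 1 = 0 → ∃ a : Fin 2 → K, a ≠ 0 ∧ h.1 *ᵥ a = m • a := by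
    intro m hm
    obtain ⟨a, ha0, ha⟩ := Matrix.exists_mulVec_eq_zero_iff.2
      (show (h.1 - m • (1 : M2 K)).det = 0 by
        rw [trace_fin_two] at hm
        simp [det_fin_two]
        linear_combination hm + hd)
    refine ⟨a, ha0, ?_⟩
    rw [sub_mulVec, smul_mulVec, one_mulVec, sub_eq_zero] at ha
    exact ha
  obtain ⟨a, ha0, ha⟩ := ev l hl
  obtain ⟨b, hb0, hb⟩ := ev l⁻¹ (by field_simp; linear_combination hl)
  have same : ∀ (m : K) (u v : Fin 2 → K), m * m ≠ 1 → h.1 *ᵥ u = m • u → h.1 *ᵥ v = m • v →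
      cross u v = 0 := by
    intro m u v hm hu hv
    have := cross_mulVec h u v
    rw [hu, hv] at this
    have : (m * m - 1) * cross u v = 0 := by
      simp only [cross, Pi.smul_apply, smul_eq_mul] at this ⊢
      linear_combination this
    exact (mul_eq_zero.1 this).resolve_left (sub_ne_zero.2 hm)
  refine ⟨.mk K a ha0, .mk K b hb0, ?_, ?_⟩
  · rw [Ne, Projectivization.mk_eq_mk_iff']
    rintro ⟨c, rfl⟩
    rw [mulVec_smul, hb, smul_smul, smul_smul] at ha
    have hc : c ≠ 0 := by rintro rfl; simp at ha0
    have := smul_left_injective K hb0 ha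
    apply hl1
    rw [mul_comm] at this
    have := mul_right_cancel₀ hc this
    field_simp at this
    linear_combination -this
  · intro w
    induction w using Projectivization.ind with
    | h w hw0 =>
    rw [smul_mk_eq_iff]
    constructor
    · rintro ⟨c, hc⟩
      have hc' : (c - l) * (c - l⁻¹) = 0 := by
        have e := congrArg (fun x : M2 K => x *ᵥ w) (M2.cayley h.1)
        simp only [h.2, one_smul, sub_mulVec, smul_mulVec, one_mulVec, ← mulVec_mulVec, hc,
          mulVec_smul] at e
        have e' : (c * c - h.1.trace * c + 1) • w = 0 := by
          linear_combination (norm := module) e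
        have := (smul_eq_zero.1 e').resolve_right hw0
        field_simp
        linear_combination l * this - c * hl
      rcases mul_eq_zero.1 hc' with e | e
      · rw [sub_eq_zero] at e
        subst e
        exact .inl (mk_eq_mk_of_cross _ _ (same c w a hl1 hc ha))
      · rw [sub_eq_zero] at e
        subst e
        refine .inr (mk_eq_mk_of_cross _ _ (same _ w b ?_ hc hb))
        intro e
        apply hl1
        field_simp at e
        linear_combination -e
    · rintro (h' | h') <;> rw [Projectivization.mk_eq_mk_iff'] at h' <;> obtain ⟨c, rfl⟩ := h'
      · exact ⟨l, by rw [mulVec_smul, ha, smul_comm]⟩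
      · exact ⟨l⁻¹, by rw [mulVec_smul, hb, smul_comm]⟩

/-- The traceless matrix with kernel directions `a` and `b`. -/
def pairMatrix (a b : Fin 2 → K) : M2 K :=
  !![-(b 0 * a 1 + a 0 * b 1), 2 * (a 0 * b 0); -(2 * (a 1 * b 1)), b 0 * a 1 + a 0 * b 1]

theorem pairMatrix_comm (a b : Fin 2 → K) : pairMatrix a b = pairMatrix b a := by
  simp only [pairMatrix]; ring_nf

theorem pairMatrix_smul (c d : K) (a b : Fin 2 → K) :
    pairMatrix (c • a) (d • b) = (c * d) • pairMatrix a b := by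
  ext i j
  fin_cases i <;> fin_cases j <;> simp [pairMatrix] <;> ring

theorem trace_pairMatrix (a b : Fin 2 → K) : (pairMatrix a b).trace = 0 := by
  simp [pairMatrix, trace_fin_two]

theorem pairMatrix_ne_zero (h2 : (2 : K) ≠ 0) {a b : Fin 2 → K} (ha : a ≠ 0) (hb : b ≠ 0) :
    pairMatrix a b ≠ 0 := by
  intro h
  have e1 := congrFun (congrFun h 0) 1
  have e2 := congrFun (congrFun h 1) 0
  have e3 := congrFun (congrFun h 1) 1
  simp [pairMatrix, h2] at e1 e2 e3
  have aux : ∀ c : Fin 2 → K, c 0 = 0 → c 1 = 0 → c = 0 := fun c h0 h1 => by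
    ext i; fin_cases i <;> simp [h0, h1]
  rcases e1 with e1 | e1 <;> rcases e2 with e2 | e2
  · exact ha (aux _ e1 e2)
  · simp [e1, e2] at e3
    rcases e3 with e3 | e3
    · exact hb (aux _ e3 e2)
    · exact ha (aux _ e1 e3)
  · simp [e1, e2] at e3
    rcases e3 with e3 | e3
    · exact ha (aux _ e3 e2)
    · exact hb (aux _ e1 e3)
  · exact hb (aux _ e1 e2)

theorem mul_pairMatrix (h : SL2 K) (a b : Fin 2 → K) :
    h.1 * pairMatrix a b = pairMatrix (h.1 *ᵥ a) (h.1 *ᵥ b) * h.1 := by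
  have hd := h.2
  rw [det_fin_two] at hd
  ext i j
  fin_cases i <;> fin_cases j <;>
    simp only [pairMatrix, mul_apply, mulVec, dotProduct, Fin.sum_univ_two, of_apply, cons_val',
      cons_val_zero, cons_val_one, cons_val_fin_one, Fin.zero_eta, Fin.mk_one]
  · linear_combination -(h.1 0 0 * (-(b 0 * a 1 + a 0 * b 1)) + h.1 0 1 * (-(2 * (a 1 * b 1)))) * hd
  · linear_combination -(h.1 0 0 * (2 * (a 0 * b 0)) + h.1 0 1 * (b 0 * a 1 + a 0 * b 1)) * hd
  · linear_combination -(h.1 1 0 * (-(b 0 * a 1 + a 0 * b 1)) + h.1 1 1 * (-(2 * (a 1 * b 1)))) * hd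
  · linear_combination -(h.1 1 0 * (2 * (a 0 * b 0)) + h.1 1 1 * (b 0 * a 1 + a 0 * b 1)) * hd

theorem mem_fixer_pairMatrix {h : SL2 K} (h2 : (2 : K) ≠ 0) {a b : Fin 2 → K} (ha : a ≠ 0)
    (hb : b ≠ 0) (hab : h • Projectivization.mk K a ha = .mk K a ha ∧
      h • Projectivization.mk K b hb = .mk K b hb ∨
      h • Projectivization.mk K a ha = .mk K b hb ∧
      h • Projectivization.mk K b hb = .mk K a ha) : h ∈ fixer (pairMatrix a b) := by
  simp only [smul_mk_eq_iff] at hab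
  have key : ∃ l : K, h.1 * pairMatrix a b = l • (pairMatrix a b * h.1) := by
    rcases hab with ⟨⟨c, hc⟩, ⟨d, hd⟩⟩ | ⟨⟨c, hc⟩, ⟨d, hd⟩⟩
    · exact ⟨c * d, by rw [mul_pairMatrix, hc, hd, pairMatrix_smul, smul_mul_assoc]⟩
    · exact ⟨c * d, by rw [mul_pairMatrix, hc, hd, pairMatrix_smul, smul_mul_assoc,
        pairMatrix_comm]⟩
  obtain ⟨l, hl⟩ := key
  refine ⟨l, ?_, hl⟩
  rintro rfl
  rw [zero_smul] at hl
  apply pairMatrix_ne_zero h2 ha hb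
  calc pairMatrix a b = (h⁻¹).1 * (h.1 * pairMatrix a b) := by
        rw [← mul_assoc, SL2.inv_mul_val, one_mul]
    _ = 0 := by rw [hl, mul_zero]

theorem SL2.eq_of_smul_eq {h : SL2 K} (h2 : (2 : K) ≠ 0) {c d : K} (hc : c ≠ 0)
    (e : c • h.1 = d • (1 : M2 K)) : h = 1 ∨ h = -1 := by
  rw [← axis_eq_zero_iff h2]
  have : h.1 = (c⁻¹ * d) • (1 : M2 K) := by
    rw [mul_smul, ← e, smul_smul, inv_mul_cancel₀ hc, one_smul]
  rw [this, axis]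
  ext i j
  fin_cases i <;> fin_cases j <;> simp <;> ring

theorem SL2.eq_of_sq_eq_one {h : SL2 K} (h2 : (2 : K) ≠ 0) (e : h ^ 2 = 1) : h = 1 ∨ h = -1 := by
  have e' : h.1 * h.1 = 1 := by
    rw [← Matrix.SpecialLinearGroup.coe_mul, ← pow_two, e]; simp
  rw [M2.cayley, h.2, one_smul, sub_eq_iff_eq_add] at e'
  refine SL2.eq_of_smul_eq h2 (c := h.1.trace) (d := 2) ?_ (by rw [e', two_smul])
  intro h0
  rw [h0, zero_smul] at e'
  have := congrFun (congrFun e' 0) 0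
  simp at this
  apply h2
  linear_combination -this

theorem SL2.pow_cases {h : SL2 K} (h2 : (2 : K) ≠ 0) (h1 : h ≠ 1) (h1' : h ≠ -1) (n : ℕ) (u v : K)
    (hn : (h ^ n).1 = u • h.1 + v • (1 : M2 K)) (e : h ^ (2 * n) = 1) : u = 0 := by
  by_contra hu
  rw [mul_comm, pow_mul] at e
  rcases SL2.eq_of_sq_eq_one h2 e with e | e
  · have : u • h.1 = (1 - v) • (1 : M2 K) := by
      rw [sub_smul, one_smul, eq_sub_iff_add_eq, ← hn, e]; simp
    rcases SL2.eq_of_smul_eq h2 hu this with h | h <;> contradiction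
  · have : u • h.1 = (-1 - v) • (1 : M2 K) := by
      rw [sub_smul, eq_sub_iff_add_eq, ← hn, e]; simp
    rcases SL2.eq_of_smul_eq h2 hu this with h | h <;> contradiction

theorem SL2.val_sq (h : SL2 K) : (h ^ 2).1 = h.1.trace • h.1 + (-1 : K) • (1 : M2 K) := by
  rw [pow_two, Matrix.SpecialLinearGroup.coe_mul, M2.cayley, h.2, one_smul, neg_smul, one_smul,
    sub_eq_add_neg]

theorem SL2.val_pow_succ {h : SL2 K} {n : ℕ} {u v : K}
    (hn : (h ^ n).1 = u • h.1 + v • (1 : M2 K)) :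
    (h ^ (n + 1)).1 = (u * h.1.trace + v) • h.1 + (-u) • (1 : M2 K) := by
  rw [pow_succ, Matrix.SpecialLinearGroup.coe_mul, hn, add_mul, smul_mul_assoc, M2.cayley, h.2,
    smul_mul_assoc, one_mul]
  module

/-- The possible traces of noncentral elements in a group of each exceptional order. -/
def ExcTrace : ℕ → K → Prop
  | 24, t => t = 0 ∨ t ^ 2 = 1
  | 48, t => t = 0 ∨ t ^ 2 = 1 ∨ t ^ 2 = 2
  | 120, t => t = 0 ∨ t ^ 2 = 1 ∨ t ^ 4 - 3 * t ^ 2 + 1 = 0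
  | _, _ => False

/-- The binary polyhedral groups: irreducible semisimple groups with restricted orders and
traces. -/
structure Exc (H : Subgroup (SL2 K)) : Prop where
  irred : ¬ Red H
  semisimple : Semisimple H
  neg_one_mem : -1 ∈ H
  card : Nat.card H = 24 ∨ Nat.card H = 48 ∨ Nat.card H = 120
  trace : ∀ h ∈ H, h ≠ 1 → h ≠ -1 → ExcTrace (Nat.card H) h.1.trace

theorem SL2.trace_of_pow_four {h : SL2 K} (h2 : (2 : K) ≠ 0) (h1 : h ≠ 1) (h1' : h ≠ -1)
    (e : h ^ (2 * 2) = 1) : h.1.trace = 0 :=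
  SL2.pow_cases h2 h1 h1' 2 _ _ (SL2.val_sq h) e

theorem SL2.trace_of_pow_six {h : SL2 K} (h2 : (2 : K) ≠ 0) (h1 : h ≠ 1) (h1' : h ≠ -1)
    (e : h ^ (2 * 3) = 1) : h.1.trace ^ 2 = 1 := by
  have := SL2.pow_cases h2 h1 h1' 3 _ _ (SL2.val_pow_succ (SL2.val_sq h)) e
  linear_combination this

theorem SL2.trace_of_pow_eight {h : SL2 K} (h2 : (2 : K) ≠ 0) (h1 : h ≠ 1) (h1' : h ≠ -1)
    (e : h ^ (2 * 4) = 1) : h.1.trace = 0 ∨ h.1.trace ^ 2 = 2 := by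
  have := SL2.pow_cases h2 h1 h1' 4 _ _ (SL2.val_pow_succ (SL2.val_pow_succ (SL2.val_sq h))) e
  have : h.1.trace * (h.1.trace ^ 2 - 2) = 0 := by linear_combination this
  rcases mul_eq_zero.1 this with h | h
  · exact .inl h
  · exact .inr (sub_eq_zero.1 h)

theorem SL2.trace_of_pow_ten {h : SL2 K} (h2 : (2 : K) ≠ 0) (h1 : h ≠ 1) (h1' : h ≠ -1)
    (e : h ^ (2 * 5) = 1) : h.1.trace ^ 4 - 3 * h.1.trace ^ 2 + 1 = 0 := by
  have := SL2.pow_cases h2 h1 h1' 5 _ _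
    (SL2.val_pow_succ (SL2.val_pow_succ (SL2.val_pow_succ (SL2.val_sq h)))) e
  linear_combination this

theorem SL2.neg_one_ne_one (h2 : (2 : K) ≠ 0) : (-1 : SL2 K) ≠ 1 := by
  intro h
  have := congrArg (fun g : SL2 K => g.1 0 0) h
  simp at this
  exact h2 (by linear_combination -this)

theorem SL2.trace_ne {H : Subgroup (SL2 K)} (hs : Semisimple H) {h : SL2 K} (hh : h ∈ H)
    (h1 : h ≠ 1) (h1' : h ≠ -1) : h.1.trace ≠ 2 ∧ h.1.trace ≠ -2 := by
  constructor <;> intro e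
  · rcases hs h hh (.inl e) with h | h <;> contradiction
  · rcases hs h hh (.inr e) with h | h <;> contradiction

theorem dickson [IsAlgClosed K] (h2 : (2 : K) ≠ 0) (H : Subgroup (SL2 K)) [Finite H]
    (hm : -1 ∈ H) (hs : Semisimple H) : Red H ∨ Exc H := by
  classical
  let X : SubMulAction H (ℙ K (Fin 2 → K)) :=
    { carrier := {x | ∃ h ∈ H, h ≠ 1 ∧ h ≠ -1 ∧ h • x = x}
      smul_mem' := by
        rintro ⟨g, hg⟩ x ⟨h, hh, h1, h1', hx⟩
        refine ⟨g * h * g⁻¹, H.mul_mem (H.mul_mem hg hh) (H.inv_mem hg), ?_, ?_, ?_⟩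
        · rwa [Ne, conj_eq_one_iff]
        · intro e
          apply h1'
          have : h = g⁻¹ * (-1) * g := by rw [← e]; group
          simpa using this
        · change (g * h * g⁻¹) • g • x = g • x
          rw [mul_smul, inv_smul_smul, mul_smul, hx] }
  have fin : Finite X := by
    have : (X : Set (ℙ K (Fin 2 → K))) ⊆ ⋃ h : {h : H // (h : SL2 K) ≠ 1 ∧ (h : SL2 K) ≠ -1},
        {x | (h : SL2 K) • x = x} := by
      rintro x ⟨h, hh, h1, h1', hx⟩
      exact Set.mem_iUnion.2 ⟨⟨⟨h, hh⟩, h1, h1'⟩, hx⟩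
    refine Set.Finite.subset (Set.finite_iUnion fun h => ?_) this
    obtain ⟨x, y, -, hxy⟩ := exists_two_fixed_points (SL2.trace_ne hs h.1.2 h.2.1 h.2.2).1
      (SL2.trace_ne hs h.1.2 h.2.1 h.2.2).2
    refine Set.Finite.subset (Set.toFinite {x, y}) fun w hw => ?_
    exact (hxy w).1 hw
  have hfix : ∀ g : H, g ≠ 1 → g ≠ ⟨-1, hm⟩ → Nat.card (fixedBy X g) = 2 := by
    rintro ⟨g, hg⟩ h1 h1'
    have h1 : g ≠ 1 := fun e => h1 (Subtype.ext e)
    have h1' : g ≠ -1 := fun e => h1' (Subtype.ext e)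
    obtain ⟨x, y, hne, hxy⟩ := exists_two_fixed_points (SL2.trace_ne hs hg h1 h1').1
      (SL2.trace_ne hs hg h1 h1').2
    have hx : x ∈ X := ⟨g, hg, h1, h1', (hxy x).2 (.inl rfl)⟩
    have hy : y ∈ X := ⟨g, hg, h1, h1', (hxy y).2 (.inr rfl)⟩
    have : fixedBy X (⟨g, hg⟩ : H) = {⟨x, hx⟩, ⟨y, hy⟩} := by
      ext ⟨w, hw⟩
      simp only [mem_fixedBy, Set.mem_insert_iff, Set.mem_singleton_iff, Subtype.mk.injEq]
      rw [← hxy, Subtype.ext_iff]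
      rfl
    rw [this]
    exact Set.ncard_pair (fun e => hne (congrArg Subtype.val e))
  have hz : ∀ x : X, (⟨-1, hm⟩ : H) • x = x := by
    rintro ⟨x, hx⟩
    rw [Subtype.ext_iff]
    change (-1 : SL2 K) • x = x
    induction x using Projectivization.ind with
    | h w hw0 => rw [smul_mk_eq_iff]; exact ⟨-1, by simp [neg_mulVec]⟩
  have hst : ∀ x : X, ∃ g : H, g ≠ 1 ∧ g ≠ ⟨-1, hm⟩ ∧ g • x = x := by
    rintro ⟨x, h, hh, h1, h1', hx⟩
    exact ⟨⟨h, hh⟩, fun e => h1 (congrArg Subtype.val e), fun e => h1' (congrArg Subtype.val e),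
      Subtype.ext hx⟩
  have hpow : ∀ h ∈ H, h ≠ 1 → h ≠ -1 → ∃ x : X, h ^ Nat.card (stabilizer H x) = 1 := by
    intro h hh h1 h1'
    obtain ⟨x, y, hne, hxy⟩ := exists_two_fixed_points (SL2.trace_ne hs hh h1 h1').1
      (SL2.trace_ne hs hh h1 h1').2
    have hx : h • x = x := (hxy x).2 (.inl rfl)
    refine ⟨⟨x, h, hh, h1, h1', hx⟩, ?_⟩
    have hmem : (⟨h, hh⟩ : H) ∈ stabilizer H (⟨x, h, hh, h1, h1', hx⟩ : X) := Subtype.ext hx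
    have := congrArg Subtype.val (pow_card_eq_one' (x := (⟨_, hmem⟩ : stabilizer H _)))
    exact congrArg Subtype.val this
  have hred : ∀ x y : X, (∀ g : H, g • x = x ∧ g • y = y ∨ g • x = y ∧ g • y = x) → Red H := by
    rintro ⟨x, hx⟩ ⟨y, hy⟩ h
    induction x using Projectivization.ind with
    | h a ha => ?_
    induction y using Projectivization.ind with
    | h b hb => ?_
    refine ⟨pairMatrix a b, pairMatrix_ne_zero h2 ha hb, trace_pairMatrix a b, fun g hg => ?_⟩
    apply mem_fixer_pairMatrix h2 ha hb
    have := h ⟨g, hg⟩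
    simp only [Subtype.ext_iff] at this
    exact this
  by_cases hR : Red H
  · exact .inl hR
  right
  rcases poles (G := H) (X := X) (z := ⟨-1, hm⟩)
    (fun e => SL2.neg_one_ne_one h2 (congrArg Subtype.val e)) (Subtype.ext (by simp))
    hz hfix hst with
    h | ⟨x, hx⟩ | ⟨x, y, -, h⟩ | ⟨hc, h⟩ | ⟨hc, h⟩ | ⟨hc, h⟩
  · refine absurd ⟨!![0, 1; 0, 0], fun e => ?_, by simp [trace_fin_two], fun g hg => ?_⟩ hR
    · simpa using congrFun (congrFun e 0) 1
    have : ({1, -1} : Set (SL2 K)) = H := by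
      refine Set.eq_of_subset_of_ncard_le ?_ ?_ (Set.toFinite _)
      · rintro _ (rfl | rfl)
        · exact one_mem _
        · exact hm
      · rw [Set.ncard_pair (SL2.neg_one_ne_one h2).symm]
        exact h.le
    have hg' : g ∈ (H : Set (SL2 K)) := hg
    rw [← this] at hg'
    rcases hg' with rfl | rfl
    · exact one_mem _
    · exact neg_one_mem_fixer _
  · exact absurd (hred x x fun g => .inl ⟨hx g, hx g⟩) hR
  · exact absurd (hred x y h) hR
  · refine ⟨hR, hs, hm, .inl hc, fun g hg h1 h1' => ?_⟩
    rw [hc]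
    obtain ⟨x, hx⟩ := hpow g hg h1 h1'
    rcases h x with h | h <;> rw [h] at hx
    · exact .inl (SL2.trace_of_pow_four h2 h1 h1' hx)
    · exact .inr (SL2.trace_of_pow_six h2 h1 h1' hx)
  · refine ⟨hR, hs, hm, .inr (.inl hc), fun g hg h1 h1' => ?_⟩
    rw [hc]
    obtain ⟨x, hx⟩ := hpow g hg h1 h1'
    rcases h x with h | h | h <;> rw [h] at hx
    · exact .inl (SL2.trace_of_pow_four h2 h1 h1' hx)
    · exact .inr (.inl (SL2.trace_of_pow_six h2 h1 h1' hx))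
    · exact (SL2.trace_of_pow_eight h2 h1 h1' hx).imp id .inr
  · refine ⟨hR, hs, hm, .inr (.inr hc), fun g hg h1 h1' => ?_⟩
    rw [hc]
    obtain ⟨x, hx⟩ := hpow g hg h1 h1'
    rcases h x with h | h | h <;> rw [h] at hx
    · exact .inl (SL2.trace_of_pow_four h2 h1 h1' hx)
    · exact .inr (.inl (SL2.trace_of_pow_six h2 h1 h1' hx))
    · exact .inr (.inr (SL2.trace_of_pow_ten h2 h1 h1' hx))

end Dickson

section Proper

open Matrix

theorem SL2.transvection_pow {F : Type*} [Field F] {i j : Fin 2} (h : i ≠ j) (s : F) (n : ℕ) :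
    Matrix.SpecialLinearGroup.transvection h s ^ n =
      Matrix.SpecialLinearGroup.transvection h (n * s) := by
  induction n with
  | zero => simp
  | succ n ih =>
    rw [pow_succ, ih, ← Matrix.SpecialLinearGroup.transvection_add]
    congr 1
    push_cast
    ring

theorem SL2.eq_transvection_of_mulVec {F : Type*} [Field F] {g : SL2 F}
    (h : g.1 *ᵥ ![1, 0] = ![1, 0]) :
    g = Matrix.SpecialLinearGroup.transvection (zero_ne_one : (0 : Fin 2) ≠ 1) (g.1 0 1) := by
  have h0 := congrFun h 0
  have h1 := congrFun h 1
  have hd := g.2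
  simp [Matrix.mulVec, dotProduct] at h0 h1
  rw [det_fin_two, h0, h1] at hd
  ext i j
  fin_cases i <;> fin_cases j <;>
    simp [Matrix.SpecialLinearGroup.transvection_coe, h0, h1]
  linear_combination hd

theorem SL2.eq_transvection_of_mulVec' {F : Type*} [Field F] {g : SL2 F}
    (h : g.1 *ᵥ ![0, 1] = ![0, 1]) :
    g = Matrix.SpecialLinearGroup.transvection (one_ne_zero : (1 : Fin 2) ≠ 0) (g.1 1 0) := by
  have h0 := congrFun h 0
  have h1 := congrFun h 1
  have hd := g.2
  simp [Matrix.mulVec, dotProduct] at h0 h1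
  rw [det_fin_two, h0, h1] at hd
  ext i j
  fin_cases i <;> fin_cases j <;>
    simp [Matrix.SpecialLinearGroup.transvection_coe, h0, h1]
  linear_combination hd

variable {p : ℕ} [Fact p.Prime]

theorem transvection_mem {H : Subgroup (SL2 (ZMod p))} {P : SL2 (ZMod p)} {i j : Fin 2} (h : i ≠ j)
    {s : ZMod p} (hs : s ≠ 0) (hH : P * Matrix.SpecialLinearGroup.transvection h s * P⁻¹ ∈ H)
    (t : ZMod p) : P * Matrix.SpecialLinearGroup.transvection h t * P⁻¹ ∈ H := by
  have e : Matrix.SpecialLinearGroup.transvection h t =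
      Matrix.SpecialLinearGroup.transvection h s ^ (t / s).val := by
    rw [SL2.transvection_pow, ZMod.natCast_zmod_val, div_mul_cancel₀ _ hs]
  rw [e, ← conj_pow]
  exact H.pow_mem hH _

theorem exists_common_eigenvector {H : Subgroup (SL2 (ZMod p))} (hH : H ≠ ⊤) {u : SL2 (ZMod p)}
    (hu : u ∈ H) (hu1 : u ≠ 1) (htr : u.1.trace = 2) :
    ∃ a : Fin 2 → ZMod p, a ≠ 0 ∧ ∀ h ∈ H, cross a (h.1 *ᵥ a) = 0 := by
  have hdet : (u.1 - 1).det = 0 := by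
    have := u.2
    rw [det_fin_two] at this ⊢
    rw [trace_fin_two] at htr
    simp
    linear_combination this - htr
  obtain ⟨a, ha0, ha⟩ := Matrix.exists_mulVec_eq_zero_iff.mpr hdet
  have ha : u.1 *ᵥ a = a := by
    rwa [sub_mulVec, one_mulVec, sub_eq_zero] at ha
  refine ⟨a, ha0, fun h hh => ?_⟩
  by_contra hc
  apply hH
  set b := h.1 *ᵥ a with hb
  set c := cross a b with hcdef
  have hub : (h * u * h⁻¹).1 *ᵥ b = b := by
    rw [Matrix.SpecialLinearGroup.coe_mul, Matrix.SpecialLinearGroup.coe_mul, hb, mulVec_mulVec,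
      mul_assoc, SL2.inv_mul_val, mul_one, ← mulVec_mulVec, ha]
  let P : SL2 (ZMod p) := ⟨!![a 0, c⁻¹ * b 0; a 1, c⁻¹ * b 1], by
    rw [det_fin_two_of]
    have : c⁻¹ * c = 1 := inv_mul_cancel₀ hc
    nth_rw 2 [hcdef] at this
    rw [cross] at this
    linear_combination this⟩
  have hPa : P.1 *ᵥ ![1, 0] = a := by
    ext i; fin_cases i <;> simp [P, mulVec, dotProduct]
  have hPb : P.1 *ᵥ ![0, 1] = c⁻¹ • b := by
    ext i; fin_cases i <;> simp [P, mulVec, dotProduct]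
  have key : ∀ (g : SL2 (ZMod p)) (e : Fin 2 → ZMod p), g.1 *ᵥ (P.1 *ᵥ e) = P.1 *ᵥ e →
      (P⁻¹ * g * P).1 *ᵥ e = e := by
    intro g e he
    rw [Matrix.SpecialLinearGroup.coe_mul, Matrix.SpecialLinearGroup.coe_mul, ← mulVec_mulVec,
      ← mulVec_mulVec, he, mulVec_mulVec, SL2.inv_mul_val, one_mulVec]
  have k1 := SL2.eq_transvection_of_mulVec (key u ![1, 0] (by rw [hPa, ha]))
  have k2 := SL2.eq_transvection_of_mulVec' (key (h * u * h⁻¹) ![0, 1]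
    (by rw [hPb, mulVec_smul, hub]))
  have back : ∀ g : SL2 (ZMod p), P * (P⁻¹ * g * P) * P⁻¹ = g := fun g => by group
  have ne : ∀ g : SL2 (ZMod p), g ≠ 1 → P⁻¹ * g * P ≠ 1 := fun g hg h1 => hg (by
    rw [← back g, h1]; simp)
  have hu' : h * u * h⁻¹ ∈ H := H.mul_mem (H.mul_mem hh hu) (H.inv_mem hh)
  have hu1' : h * u * h⁻¹ ≠ 1 := by simpa using hu1
  have s1 : (P⁻¹ * u * P).1 0 1 ≠ 0 := fun hs => ne u hu1 (by rw [k1, hs]; simp)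
  have s2 : (P⁻¹ * (h * u * h⁻¹) * P).1 1 0 ≠ 0 := fun hs => ne _ hu1' (by rw [k2, hs]; simp)
  have m1 := fun t => transvection_mem (H := H) (P := P) zero_ne_one s1 (by
    rw [← k1, back]; exact hu) t
  have m2 := fun t => transvection_mem (H := H) (P := P) one_ne_zero s2 (by
    rw [← k2, back]; exact hu') t
  have all : ∀ g : SL2 (ZMod p), P * g * P⁻¹ ∈ H := by
    intro g
    induction g using Matrix.SL2.transvection_induction with
    | htransvec i j hij t =>
      fin_cases i <;> fin_cases j
      · exact absurd rfl hij
      · exact m1 t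
      · exact m2 t
      · exact absurd rfl hij
    | hmul x y hx hy =>
      rw [show P * (x * y) * P⁻¹ = (P * x * P⁻¹) * (P * y * P⁻¹) by group]
      exact H.mul_mem hx hy
  rw [Subgroup.eq_top_iff']
  intro g
  rw [show g = P * (P⁻¹ * g * P) * P⁻¹ by group]
  exact all _

/-- The embedding of `SL(2, p)` into `SL(2)` over the algebraic closure. -/
noncomputable def toClosure (p : ℕ) [Fact p.Prime] :
    SL2 (ZMod p) →* SL2 (AlgebraicClosure (ZMod p)) :=
  Matrix.SpecialLinearGroup.map (algebraMap (ZMod p) (AlgebraicClosure (ZMod p)))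

theorem toClosure_val (g : SL2 (ZMod p)) :
    (toClosure p g).1 = g.1.map (algebraMap (ZMod p) (AlgebraicClosure (ZMod p))) := rfl

theorem toClosure_injective : Function.Injective (toClosure p) := by
  intro g h e
  have := congrArg Subtype.val e
  rw [toClosure_val, toClosure_val] at this
  exact Subtype.ext (Matrix.map_injective (algebraMap _ _).injective this)

theorem toClosure_neg (g : SL2 (ZMod p)) : toClosure p (-g) = -toClosure p g := by
  apply Subtype.ext
  ext i j
  simp [toClosure_val]

theorem trace_toClosure (g : SL2 (ZMod p)) :
    (toClosure p g).1.trace = algebraMap (ZMod p) (AlgebraicClosure (ZMod p)) g.1.trace := by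
  simp [toClosure_val, trace_fin_two]

theorem mem_fixer_map {g : SL2 (ZMod p)} {v : M2 (ZMod p)} (h : g ∈ fixer v) :
    toClosure p g ∈ fixer (v.map (algebraMap (ZMod p) (AlgebraicClosure (ZMod p)))) := by
  obtain ⟨l, hl, h⟩ := h
  refine ⟨algebraMap _ _ l, by simpa using hl, ?_⟩
  rw [toClosure_val, ← Matrix.map_mul, h, ← Matrix.map_mul]
  ext i j
  simp only [map_apply, Matrix.smul_apply, smul_eq_mul, map_mul]

theorem red_map_of_eigenvector (h2 : (2 : ZMod p) ≠ 0) {H : Subgroup (SL2 (ZMod p))}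
    {a : Fin 2 → ZMod p} (ha : a ≠ 0) (h : ∀ h ∈ H, cross a (h.1 *ᵥ a) = 0) :
    Red (H.map (toClosure p)) := by
  refine ⟨(pairMatrix a a).map (algebraMap _ _), ?_, ?_, ?_⟩
  · intro e
    apply pairMatrix_ne_zero h2 ha ha
    apply Matrix.map_injective (algebraMap (ZMod p) (AlgebraicClosure (ZMod p))).injective
    exact e.trans (Matrix.map_zero _ (map_zero _)).symm
  · have := trace_pairMatrix a a
    rw [trace_fin_two] at this ⊢
    simp only [map_apply]
    rw [← map_add, this, map_zero]
  · rintro _ ⟨g, hg, rfl⟩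
    apply mem_fixer_map
    have h0 : g.1 *ᵥ a ≠ 0 := by
      intro e
      apply ha
      rw [← one_mulVec a, ← SL2.inv_mul_val g, ← mulVec_mulVec, e, mulVec_zero]
    have hfix : g • Projectivization.mk (ZMod p) a ha = Projectivization.mk (ZMod p) a ha := by
      rw [Projectivization.smul_mk]
      exact (mk_eq_mk_of_cross ha h0 (h g hg)).symm
    exact mem_fixer_pairMatrix h2 ha ha (Or.inl ⟨hfix, hfix⟩)

theorem red_or_exc (h2 : (2 : ZMod p) ≠ 0) {H : Subgroup (SL2 (ZMod p))} (hm : -1 ∈ H)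
    (hH : H ≠ ⊤) :
    Red (H.map (toClosure p)) ∨ Exc (H.map (toClosure p)) := by
  have h2' : (2 : AlgebraicClosure (ZMod p)) ≠ 0 := by
    have := (map_ne_zero (algebraMap (ZMod p) (AlgebraicClosure (ZMod p)))).mpr h2
    rwa [map_ofNat] at this
  have hinj := (algebraMap (ZMod p) (AlgebraicClosure (ZMod p))).injective
  by_cases hs : ∃ u ∈ H, u ≠ 1 ∧ u.1.trace = 2
  · obtain ⟨u, hu, hu1, ht⟩ := hs
    obtain ⟨a, ha, h⟩ := exists_common_eigenvector hH hu hu1 ht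
    exact Or.inl (red_map_of_eigenvector h2 ha h)
  · push Not at hs
    have : Finite (H.map (toClosure p)) := (Set.toFinite (H : Set (SL2 (ZMod p)))).image _
    refine dickson h2' _ ⟨-1, hm, by rw [toClosure_neg, map_one]⟩ ?_
    rintro _ ⟨g, hg, rfl⟩ ht
    by_contra! hne
    rw [trace_toClosure] at ht
    rcases ht with ht | ht
    · refine hs g hg ?_ (hinj (by rw [ht, map_ofNat]))
      rintro rfl
      exact hne.1 (map_one _)
    · refine hs (-g) (by simpa using H.mul_mem hm hg) ?_ (hinj ?_)
      · intro e
        rw [neg_eq_iff_eq_neg] at e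
        subst e
        exact hne.2 (by rw [toClosure_neg, map_one])
      · simp [ht, map_ofNat (algebraMap (ZMod p) (AlgebraicClosure (ZMod p))) 2]

end Proper

/-! ### Quaternion frames in `SL(2, K)` -/

section Frames

open Matrix

variable {K : Type*} [Field K]

/-- Values of the golden ratio and of `√2` in a field whose characteristic avoids some primes. -/
structure IsGold (f r : K) : Prop where
  golden : f ^ 2 = f + 1
  sqrt : r ^ 2 = 2
  char : ((2 * 3 * 5 * 7 * 11 * 19 * 31 : ℕ) : K) ≠ 0

theorem IsGold.natCast_ne_zero {f r : K} (h : IsGold f r) {n m : ℕ}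
    (e : n * m = 2 * 3 * 5 * 7 * 11 * 19 * 31) : (n : K) ≠ 0 := by
  intro h0
  apply h.char
  rw [← e, Nat.cast_mul, h0, zero_mul]

theorem IsGold.two_ne_zero {f r : K} (h : IsGold f r) : (2 : K) ≠ 0 := by
  exact_mod_cast h.natCast_ne_zero (n := 2) (m := 3 * 5 * 7 * 11 * 19 * 31) (by norm_num)

theorem IsGold.three_ne_zero {f r : K} (h : IsGold f r) : (3 : K) ≠ 0 := by
  exact_mod_cast h.natCast_ne_zero (n := 3) (m := 2 * 5 * 7 * 11 * 19 * 31) (by norm_num)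

theorem IsGold.five_ne_zero {f r : K} (h : IsGold f r) : (5 : K) ≠ 0 := by
  exact_mod_cast h.natCast_ne_zero (n := 5) (m := 2 * 3 * 7 * 11 * 19 * 31) (by norm_num)

theorem IsGold.seven_ne_zero {f r : K} (h : IsGold f r) : (7 : K) ≠ 0 := by
  exact_mod_cast h.natCast_ne_zero (n := 7) (m := 2 * 3 * 5 * 11 * 19 * 31) (by norm_num)

theorem IsGold.not_smooth {f r : K} (h : IsGold f r) {x : GoldInt} (hx : x.ev f r = 0) :
    x.smooth = false := by
  by_contra hs
  exact GoldInt.ev_ne_zero h.golden h.sqrt h.char (by simpa using hs) hx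

/-- `I`, `J` and `I * J` are the units of a quaternion algebra. -/
structure Frame (f r : K) (I J : SL2 K) : Prop extends IsGold f r where
  sq_left : I * I = -1
  sq_right : J * J = -1
  anti : I * J = -(J * I)

/-- Evaluation of quaternions over `ℤ[φ, √2]`. -/
def GoldQuat.ev (f r : K) (I J : SL2 K) (t : GoldQuat) : M2 K :=
  t.w.ev f r • (1 : M2 K) + t.x.ev f r • I.1 + t.y.ev f r • J.1 + t.z.ev f r • (I.1 * J.1)

theorem SL2.val_inv (g : SL2 K) : (g⁻¹).1 = g.1.trace • (1 : M2 K) - g.1 := by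
  rw [Matrix.SpecialLinearGroup.coe_inv, adjugate_fin_two]
  ext i j
  fin_cases i <;> fin_cases j <;> simp [trace_fin_two]

theorem SL2.trace_inv (g : SL2 K) : (g⁻¹).1.trace = g.1.trace := by
  rw [SL2.val_inv, trace_sub, trace_smul, trace_one]
  simp
  ring

namespace Frame

variable {f r : K} {I J : SL2 K}

theorem val_sq_left (hF : Frame f r I J) : I.1 * I.1 = -1 := by
  simpa using congrArg Subtype.val hF.sq_left

theorem val_sq_right (hF : Frame f r I J) : J.1 * J.1 = -1 := by
  simpa using congrArg Subtype.val hF.sq_right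

theorem val_anti (hF : Frame f r I J) : J.1 * I.1 = -(I.1 * J.1) := by
  have := congrArg Subtype.val hF.anti
  rw [Matrix.SpecialLinearGroup.coe_neg, Matrix.SpecialLinearGroup.coe_mul,
    Matrix.SpecialLinearGroup.coe_mul] at this
  rw [this, neg_neg]

theorem ev_mul (hF : Frame f r I J) (s t : GoldQuat) :
    (s.mul t).ev f r I J = s.ev f r I J * t.ev f r I J := by
  have hi := hF.val_sq_left
  have hj := hF.val_sq_right
  have hji := hF.val_anti
  have h1 : I.1 * (I.1 * J.1) = -J.1 := by rw [← mul_assoc, hi, neg_one_mul]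
  have h2 : I.1 * J.1 * J.1 = -I.1 := by rw [mul_assoc, hj, mul_neg_one]
  have h3 : J.1 * (I.1 * J.1) = I.1 := by rw [← mul_assoc, hji, neg_mul, h2, neg_neg]
  have h4 : I.1 * J.1 * I.1 = J.1 := by rw [mul_assoc, hji, mul_neg, h1, neg_neg]
  have h5 : I.1 * J.1 * (I.1 * J.1) = -1 := by rw [← mul_assoc, h4, hj]
  simp only [GoldQuat.ev, GoldQuat.mul, GoldInt.ev_add, GoldInt.ev_sub,
    GoldInt.ev_mul hF.golden hF.sqrt]
  generalize hij : I.1 * J.1 = k at *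
  simp only [add_mul, mul_add, smul_mul_assoc, mul_smul_comm, one_mul, mul_one, hi, hj, hij, hji,
    h1, h2, h3, h4, h5]
  module

theorem trace_left (hF : Frame f r I J) : I.1.trace = 0 := by
  have h : I.1 = J.1 * I.1 * J.1 := by
    rw [hF.val_anti, neg_mul, mul_assoc, hF.val_sq_right, mul_neg_one, neg_neg]
  have h' := congrArg trace h
  rw [trace_mul_comm, ← mul_assoc, hF.val_sq_right, neg_one_mul, trace_neg] at h'
  exact (mul_eq_zero.mp (by linear_combination h' : (2 : K) * I.1.trace = 0)).resolve_left
    hF.two_ne_zero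

theorem trace_right (hF : Frame f r I J) : J.1.trace = 0 := by
  have h : J.1 = I.1 * J.1 * I.1 := by
    rw [mul_assoc, hF.val_anti, mul_neg, ← mul_assoc, hF.val_sq_left, neg_one_mul, neg_neg]
  have h' := congrArg trace h
  rw [trace_mul_comm, ← mul_assoc, hF.val_sq_left, neg_one_mul, trace_neg] at h'
  exact (mul_eq_zero.mp (by linear_combination h' : (2 : K) * J.1.trace = 0)).resolve_left
    hF.two_ne_zero

theorem trace_prod (hF : Frame f r I J) : (I.1 * J.1).trace = 0 := by
  have h' := congrArg trace hF.val_anti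
  rw [trace_neg, trace_mul_comm] at h'
  exact (mul_eq_zero.mp (by linear_combination h' : (2 : K) * (I.1 * J.1).trace = 0)).resolve_left
    hF.two_ne_zero

theorem trace_ev (hF : Frame f r I J) (t : GoldQuat) : (t.ev f r I J).trace = 2 * t.w.ev f r := by
  simp only [GoldQuat.ev, trace_add, trace_smul, hF.trace_left, hF.trace_right, hF.trace_prod,
    trace_one]
  simp
  ring

theorem expand (hF : Frame f r I J) (g : SL2 K) :
    (2 : K) • g.1 = g.1.trace • (1 : M2 K) + (g * I⁻¹).1.trace • I.1 +
      (g * J⁻¹).1.trace • J.1 + (g * (I * J)⁻¹).1.trace • (I.1 * J.1) := by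
  have hI := hF.trace_left
  have hJ := hF.trace_right
  have hk := hF.trace_prod
  have invI : (I⁻¹).1 = -I.1 := by rw [SL2.val_inv, hI]; simp
  have invJ : (J⁻¹).1 = -J.1 := by rw [SL2.val_inv, hJ]; simp
  have invK : ((I * J)⁻¹).1 = -(I.1 * J.1) := by
    rw [SL2.val_inv, Matrix.SpecialLinearGroup.coe_mul, hk]; simp
  rw [Matrix.SpecialLinearGroup.coe_mul, Matrix.SpecialLinearGroup.coe_mul,
    Matrix.SpecialLinearGroup.coe_mul, invI, invJ, invK, mul_neg, mul_neg, mul_neg, trace_neg,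
    trace_neg, trace_neg]
  set a := (g.1 * I.1).trace
  set b := (g.1 * J.1).trace
  set c := (g.1 * (I.1 * J.1)).trace
  set w := (2 : K) • g.1 - g.1.trace • (1 : M2 K) + a • I.1 + b • J.1 + c • (I.1 * J.1) with hw
  have hw0 : w.trace = 0 := by
    simp only [hw, trace_add, trace_sub, trace_smul, hI, hJ, hk, trace_one]
    simp
    ring
  have hi := hF.val_sq_left
  have hj := hF.val_sq_right
  have hji := hF.val_anti
  have h2 : I.1 * J.1 * J.1 = -I.1 := by rw [mul_assoc, hj, mul_neg_one]
  have h4 : I.1 * J.1 * I.1 = J.1 := by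
    rw [mul_assoc, hji, mul_neg, ← mul_assoc, hi, neg_one_mul, neg_neg]
  have e1 : (w * I.1).trace = 0 := by
    simp only [hw, add_mul, sub_mul, smul_mul_assoc, one_mul, trace_add, trace_sub, trace_smul, hi,
      hji, h4, trace_neg, trace_one, hI, hJ, hk]
    simp [a]
    ring
  have e2 : (w * J.1).trace = 0 := by
    simp only [hw, add_mul, sub_mul, smul_mul_assoc, one_mul, trace_add, trace_sub, trace_smul, hj,
      h2, trace_neg, trace_one, hI, hJ, hk]
    simp [b]
    ring
  have e3 : (w * (I.1 * J.1)).trace = 0 := by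
    have h5 : I.1 * J.1 * (I.1 * J.1) = -1 := by rw [← mul_assoc, h4, hj]
    have h1 : I.1 * (I.1 * J.1) = -J.1 := by rw [← mul_assoc, hi, neg_one_mul]
    have h3 : J.1 * (I.1 * J.1) = I.1 := by rw [← mul_assoc, hji, neg_mul, h2, neg_neg]
    simp only [hw, add_mul, sub_mul, smul_mul_assoc, one_mul, trace_add, trace_sub, trace_smul, h1,
      h3, h5, trace_neg, trace_one, hI, hJ, hk]
    simp [c]
    ring
  have a1 := M2.anticomm hw0 hI
  have a2 := M2.anticomm hw0 hJ
  have a3 := M2.anticomm hw0 hk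
  rw [e1, zero_smul] at a1
  rw [e2, zero_smul] at a2
  rw [e3, zero_smul] at a3
  have key : (2 : K) • (w * (I.1 * J.1)) = 0 := by
    have : w * (I.1 * J.1) = I.1 * J.1 * w := by
      rw [← mul_assoc, eq_neg_of_add_eq_zero_left a1, neg_mul, mul_assoc,
        eq_neg_of_add_eq_zero_left a2, mul_neg, neg_neg, mul_assoc]
    rw [two_smul]
    nth_rw 2 [this]
    exact a3
  have key2 : w * (I.1 * J.1) = 0 := (smul_eq_zero.mp key).resolve_left hF.two_ne_zero
  have hwz : w = 0 := by
    have := congrArg (· * (J.1 * I.1)) key2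
    simpa [mul_assoc, ← mul_assoc J.1 J.1, hi, hj] using this
  rw [hw] at hwz
  rw [← sub_eq_zero, ← hwz]
  module

end Frame

end Frames

section Coordinates

open Matrix GoldInt

variable {K : Type*} [Field K] {f r : K} {I J : SL2 K}

namespace Frame

/-- `t` gives the coordinates of `2 ^ n` times `g`. -/
def Coord (_ : Frame f r I J) (n : ℕ) (g : SL2 K) (t : GoldQuat) : Prop :=
  (2 : K) ^ n • g.1 = t.ev f r I J

variable {hF : Frame f r I J} {n m : ℕ} {g h : SL2 K} {s t : GoldQuat}

namespace Coord

theorem mul (hs : hF.Coord n g s) (ht : hF.Coord m h t) : hF.Coord (n + m) (g * h) (s.mul t) := by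
  unfold Coord at *
  rw [hF.ev_mul, ← hs, ← ht, Matrix.SpecialLinearGroup.coe_mul, smul_mul_smul_comm, pow_add]

theorem trace (hs : hF.Coord n g s) : 2 ^ n * g.1.trace = 2 * s.w.ev f r := by
  rw [← hF.trace_ev, ← hs, trace_smul, smul_eq_mul]

theorem trace_one (hs : hF.Coord 1 g s) : g.1.trace = s.w.ev f r := by
  have := hs.trace
  rw [pow_one] at this
  exact mul_left_cancel₀ hF.two_ne_zero this

theorem unique (hs : hF.Coord n g s) (ht : hF.Coord n h s) : g = h := by
  unfold Coord at *
  exact Subtype.ext (smul_right_injective _ (pow_ne_zero n hF.two_ne_zero) (hs.trans ht.symm))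

theorem ev_smul (k : ℤ) (s : GoldQuat) : (s.smul k).ev f r I J = (k : K) • s.ev f r I J := by
  simp only [GoldQuat.ev, GoldQuat.smul, ev_scale]
  module

theorem neg (hs : hF.Coord n g s) : hF.Coord n (-g) (s.smul (-1)) := by
  unfold Coord at *
  rw [ev_smul, ← hs, Matrix.SpecialLinearGroup.coe_neg]
  simp

theorem of_smul_two (hs : hF.Coord (n + 1) g (s.smul 2)) : hF.Coord n g s := by
  unfold Coord at *
  rw [ev_smul, pow_succ', Int.cast_ofNat, mul_smul] at hs
  exact smul_right_injective _ hF.two_ne_zero hs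

theorem inv (hs : hF.Coord 1 g s) : hF.Coord 1 g⁻¹ s.conj := by
  have ht := hs.trace_one
  unfold Coord at *
  rw [SL2.val_inv, ht, smul_sub, hs]
  simp only [GoldQuat.ev, GoldQuat.conj, ev_neg]
  module

theorem normSq (hs : hF.Coord 1 g s) : (sub s.normSq (const 4)).ev f r = 0 := by
  have h1 := (hs.mul hs.inv).trace
  rw [mul_inv_cancel, Matrix.SpecialLinearGroup.coe_one, Matrix.trace_one] at h1
  simp only [GoldQuat.mul, GoldQuat.conj, GoldQuat.normSq, ev_add, ev_sub, ev_neg, ev_const,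
    GoldInt.ev_mul hF.golden hF.sqrt] at h1 ⊢
  apply mul_left_cancel₀ hF.two_ne_zero
  push_cast [Fintype.card_fin] at h1 ⊢
  linear_combination -h1

end Coord

theorem coord_one (hF : Frame f r I J) : hF.Coord 1 1 ⟨const 2, const 0, const 0, const 0⟩ := by
  simp [Coord, GoldQuat.ev, ev_const]

theorem coord_left (hF : Frame f r I J) : hF.Coord 1 I ⟨const 0, const 2, const 0, const 0⟩ := by
  simp [Coord, GoldQuat.ev, ev_const]

theorem coord_right (hF : Frame f r I J) : hF.Coord 1 J ⟨const 0, const 0, const 2, const 0⟩ := by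
  simp [Coord, GoldQuat.ev, ev_const]

theorem coord_prod (hF : Frame f r I J) :
    hF.Coord 1 (I * J) ⟨const 0, const 0, const 0, const 2⟩ := by
  simp [Coord, GoldQuat.ev, ev_const]

theorem coord_of_traces (hF : Frame f r I J) {a b c d : GoldInt} (ha : a.ev f r = g.1.trace)
    (hb : b.ev f r = (g * I⁻¹).1.trace) (hc : c.ev f r = (g * J⁻¹).1.trace)
    (hd : d.ev f r = (g * (I * J)⁻¹).1.trace) : hF.Coord 1 g ⟨a, b, c, d⟩ := by
  rw [Coord, pow_one, hF.expand, GoldQuat.ev, ha, hb, hc, hd]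

theorem conj (hF : Frame f r I J) (h : SL2 K) : Frame f r (h⁻¹ * I * h) (h⁻¹ * J * h) where
  toIsGold := hF.toIsGold
  sq_left := by
    rw [show h⁻¹ * I * h * (h⁻¹ * I * h) = h⁻¹ * (I * I) * h by group, hF.sq_left]
    simp
  sq_right := by
    rw [show h⁻¹ * J * h * (h⁻¹ * J * h) = h⁻¹ * (J * J) * h by group, hF.sq_right]
    simp
  anti := by
    rw [show h⁻¹ * I * h * (h⁻¹ * J * h) = h⁻¹ * (I * J) * h by group,
      show h⁻¹ * J * h * (h⁻¹ * I * h) = h⁻¹ * (J * I) * h by group, hF.anti]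
    simp

theorem Coord.conj (hs : hF.Coord n g s) (h : SL2 K) : (hF.conj h).Coord n (h⁻¹ * g * h) s := by
  unfold Coord at *
  have e : s.ev f r (h⁻¹ * I * h) (h⁻¹ * J * h) = (h⁻¹).1 * s.ev f r I J * h.1 := by
    have e1 : (h⁻¹ * I * h).1 * (h⁻¹ * J * h).1 = (h⁻¹).1 * (I.1 * J.1) * h.1 := by
      rw [← Matrix.SpecialLinearGroup.coe_mul, ← Matrix.SpecialLinearGroup.coe_mul I,
        ← Matrix.SpecialLinearGroup.coe_mul, ← Matrix.SpecialLinearGroup.coe_mul]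
      exact congrArg Subtype.val (show h⁻¹ * I * h * (h⁻¹ * J * h) = h⁻¹ * (I * J) * h by group)
    simp only [GoldQuat.ev, e1]
    simp only [Matrix.SpecialLinearGroup.coe_mul, mul_add, add_mul, mul_smul_comm, smul_mul_assoc,
      mul_one, SL2.inv_mul_val]
  rw [e, ← hs]
  simp only [Matrix.SpecialLinearGroup.coe_mul, mul_smul_comm, smul_mul_assoc]

/-- The frame spans, with an element of trace one, a binary tetrahedral subgroup of `D`. -/
structure InGroup (hF : Frame f r I J) (D : Subgroup (SL2 K)) : Prop where
  neg_one : -1 ∈ D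
  left : I ∈ D
  right : J ∈ D
  omega : ∃ x ∈ D, hF.Coord 1 x ⟨const 1, const 1, const 1, const 1⟩

theorem InGroup.conj {D : Subgroup (SL2 K)} (hD : hF.InGroup D) (hh : h ∈ D) :
    (hF.conj h).InGroup D := by
  obtain ⟨x, hx, hc⟩ := hD.omega
  have key : ∀ g ∈ D, h⁻¹ * g * h ∈ D := fun g hg => D.mul_mem (D.mul_mem (D.inv_mem hh) hg) hh
  exact ⟨hD.neg_one, key _ hD.left, key _ hD.right, _, key _ hx, hc.conj h⟩

theorem eqb_iff {s t : GoldQuat} (h : GoldQuat.eqb s t = true) : s = t := by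
  cases s; cases t
  simp only [GoldQuat.eqb, Bool.and_eq_true] at h
  obtain ⟨⟨⟨h1, h2⟩, h3⟩, h4⟩ := h
  rw [eq_of_eqb h1, eq_of_eqb h2, eq_of_eqb h3, eq_of_eqb h4]

theorem neg_mem_of {D : Subgroup (SL2 K)} (hm : -1 ∈ D) (hg : g ∈ D) : -g ∈ D := by
  simpa using D.mul_mem hm hg

theorem hurwitz_check : (GoldQuat.hurwitz.all fun h => GoldQuat.basis.any fun b =>
    [⟨const 2, const 0, const 0, const 0⟩, ⟨const 1, const 1, const 1, const 1⟩,
      ⟨const 1, const (-1), const (-1), const (-1)⟩].any fun c =>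
        GoldQuat.eqb (b.mul c) (h.smul 2) ||
          GoldQuat.eqb ((b.mul c).smul (-1)) (h.smul 2)) = true := by
  decide +kernel

theorem InGroup.basis {D : Subgroup (SL2 K)} (hD : hF.InGroup D) {b : GoldQuat}
    (hb : b ∈ GoldQuat.basis) : ∃ d ∈ D, hF.Coord 1 d b := by
  simp only [GoldQuat.basis, List.mem_cons, List.not_mem_nil, or_false] at hb
  rcases hb with rfl | rfl | rfl | rfl
  · exact ⟨1, D.one_mem, hF.coord_one⟩
  · exact ⟨I, hD.left, hF.coord_left⟩
  · exact ⟨J, hD.right, hF.coord_right⟩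
  · exact ⟨I * J, D.mul_mem hD.left hD.right, hF.coord_prod⟩

theorem InGroup.hurwitz {D : Subgroup (SL2 K)} (hD : hF.InGroup D) {t : GoldQuat}
    (ht : t ∈ GoldQuat.hurwitz) : ∃ d ∈ D, hF.Coord 1 d t := by
  have := List.all_eq_true.mp hurwitz_check t ht
  obtain ⟨b, hb, hc⟩ := List.any_eq_true.mp this
  obtain ⟨c, hc, he⟩ := List.any_eq_true.mp hc
  obtain ⟨x, hx, hxc⟩ := hD.omega
  obtain ⟨d, hd, hdc⟩ := hD.basis hb
  have : ∃ y ∈ D, hF.Coord 1 y c := by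
    simp only [List.mem_cons, List.not_mem_nil, or_false] at hc
    rcases hc with rfl | rfl | rfl
    · exact ⟨1, D.one_mem, hF.coord_one⟩
    · exact ⟨x, hx, hxc⟩
    · exact ⟨x⁻¹, D.inv_mem hx, hxc.inv⟩
  obtain ⟨y, hy, hyc⟩ := this
  rw [Bool.or_eq_true] at he
  rcases he with he | he
  · exact ⟨d * y, D.mul_mem hd hy, Coord.of_smul_two (eqb_iff he ▸ hdc.mul hyc)⟩
  · exact ⟨-(d * y), neg_mem_of hD.neg_one (D.mul_mem hd hy),
      Coord.of_smul_two (eqb_iff he ▸ (hdc.mul hyc).neg)⟩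

end Frame

theorem mul_eq_zero_of_small (hG : IsGold f r) {a b : K} (ha : a = 0 ∨ a ^ 2 = 1 ∨ a ^ 2 = 2)
    (hb : b = 0 ∨ b ^ 2 = 1 ∨ b ^ 2 = 2) (hc : (a + b) ^ 2 = 1 ∨ (a + b) ^ 2 = 2) :
    a = 0 ∨ b = 0 := by
  have h2 := hG.two_ne_zero
  have h3 := hG.three_ne_zero
  have h7 := hG.seven_ne_zero
  rcases ha with ha | ha
  · exact Or.inl ha
  rcases hb with hb | hb
  · exact Or.inr hb
  exfalso
  have e : 4 * (a ^ 2 * b ^ 2) = ((a + b) ^ 2 - a ^ 2 - b ^ 2) ^ 2 := by ring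
  rcases ha with ha | ha <;> rcases hb with hb | hb <;> rcases hc with hc | hc <;>
    rw [ha, hb, hc] at e <;> ring_nf at e
  · exact h3 (by linear_combination e)
  · exact pow_ne_zero 2 h2 (by linear_combination e)
  · exact pow_ne_zero 2 h2 (by linear_combination e)
  · exact h7 (by linear_combination e)
  · exact pow_ne_zero 2 h2 (by linear_combination e)
  · exact h7 (by linear_combination e)
  · exact h7 (by linear_combination e)
  · exact mul_ne_zero (pow_ne_zero 2 h2) h3 (by linear_combination e)

theorem SL2.trace_mul_add (g h : SL2 K) :
    (g * h).1.trace + (g * h⁻¹).1.trace = g.1.trace * h.1.trace := by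
  simp only [Matrix.SpecialLinearGroup.coe_mul, SL2.val_inv, mul_sub, mul_smul_comm, mul_one,
    trace_sub, trace_smul, smul_eq_mul]
  ring

theorem SL2.mul_self_of_trace {g : SL2 K} (h : g.1.trace = 0) : g * g = -1 := by
  apply Subtype.ext
  have := M2.cayley g.1
  rw [h, g.2] at this
  rw [Matrix.SpecialLinearGroup.coe_mul, this, Matrix.SpecialLinearGroup.coe_neg]
  simp

theorem exists_involution (hG : IsGold f r) {H : Subgroup (SL2 K)} (hm : -1 ∈ H) (hH : ¬Red H)
    (htr : ∀ g ∈ H, g ≠ 1 → g ≠ -1 → g.1.trace = 0 ∨ g.1.trace ^ 2 = 1 ∨ g.1.trace ^ 2 = 2)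
    {x : SL2 K} (hx : x ∈ H) (hx1 : x.1.trace = 1) :
    ∃ i ∈ H, i.1.trace = 0 ∧ (x * i).1.trace = -1 := by
  have h2 := hG.two_ne_zero
  have hax : axis x.1 ≠ 0 := axis_ne_zero_of_trace h2
    (by rw [hx1]; intro h; exact one_ne_zero (by linear_combination -h : (1 : K) = 0))
    (by rw [hx1]; intro h; exact hG.three_ne_zero (by linear_combination h))
  have hxa := mem_fixer_axis x
  obtain ⟨y, hy, hyf⟩ : ∃ y ∈ H, y ∉ fixer (axis x.1) := by
    by_contra! h
    exact hH ⟨_, hax, trace_axis _, h⟩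
  -- an element of trace zero that does not preserve the axis
  obtain ⟨z, hz, hzf, hz0⟩ : ∃ z ∈ H, z ∉ fixer (axis x.1) ∧ z.1.trace = 0 := by
    have hne : ∀ z ∉ fixer (axis x.1), z ≠ 1 ∧ z ≠ -1 := by
      refine fun z hz => ⟨?_, ?_⟩
      · rintro rfl; exact hz (Subgroup.one_mem _)
      · rintro rfl; exact hz (neg_one_mem_fixer _)
    have n1 : x * y ∉ fixer (axis x.1) := fun h => hyf (by
      simpa using (fixer _).mul_mem ((fixer _).inv_mem hxa) h)
    have n2 : x * y⁻¹ ∉ fixer (axis x.1) := fun h => hyf (by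
      simpa using (fixer _).mul_mem ((fixer _).inv_mem h) hxa)
    rcases htr y hy (hne y hyf).1 (hne y hyf).2 with h0 | h0
    · exact ⟨y, hy, hyf, h0⟩
    have m1 := H.mul_mem hx hy
    have m2 := H.mul_mem hx (H.inv_mem hy)
    rcases mul_eq_zero_of_small hG (htr _ m1 (hne _ n1).1 (hne _ n1).2)
      (htr _ m2 (hne _ n2).1 (hne _ n2).2)
      (by rwa [SL2.trace_mul_add, hx1, one_mul]) with h | h
    · exact ⟨_, m1, n1, h⟩
    · exact ⟨_, m2, n2, h⟩
  have hxz : x * z ≠ 1 ∧ x * z ≠ -1 := by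
    refine ⟨fun h => hzf ?_, fun h => hzf ?_⟩
    · rw [eq_inv_of_mul_eq_one_right h]
      exact (fixer _).inv_mem hxa
    · rw [eq_inv_mul_of_mul_eq h]
      exact (fixer _).mul_mem ((fixer _).inv_mem hxa) (neg_one_mem_fixer _)
  have mxz := H.mul_mem hx hz
  have fin : ∀ i ∈ H, i.1.trace = 0 → (x * i).1.trace ^ 2 = 1 →
      ∃ i ∈ H, i.1.trace = 0 ∧ (x * i).1.trace = -1 := by
    intro i hi h0 h1
    rcases sq_eq_sq_iff_eq_or_eq_neg.mp (h1.trans (one_pow 2).symm) with h1 | h1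
    · exact ⟨-i, Frame.neg_mem_of hm hi, by simp [h0], by rw [mul_neg]; simpa using h1⟩
    · exact ⟨i, hi, h0, h1⟩
  rcases htr _ mxz hxz.1 hxz.2 with h | h | h
  · refine absurd ?_ hzf
    rw [fixer_of_trace_eq_zero hz0 (trace_axis _)]
    right
    rw [axis, mul_sub, mul_smul_comm, mul_smul_comm, mul_one, trace_sub, trace_smul, trace_smul,
      hz0, trace_mul_comm]
    rw [Matrix.SpecialLinearGroup.coe_mul] at h
    rw [h]
    simp
  · exact fin z hz hz0 h
  · refine fin ((x * z) ^ 2) (H.pow_mem mxz 2) ?_ ?_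
    · rw [SL2.val_sq, trace_add, trace_smul, trace_smul, trace_one]
      simp
      linear_combination h
    · have e : (x * (x * z) ^ 2).1.trace = 1 := by
        have e1 : (x * (x * z)).1.trace = (x * z).1.trace := by
          have := M2.cayley x.1
          rw [hx1, x.2] at this
          rw [← mul_assoc, Matrix.SpecialLinearGroup.coe_mul, Matrix.SpecialLinearGroup.coe_mul,
            this, sub_mul, one_smul, one_smul, trace_sub, one_mul, hz0, sub_zero,
            Matrix.SpecialLinearGroup.coe_mul]
        rw [Matrix.SpecialLinearGroup.coe_mul, SL2.val_sq, mul_add, mul_smul_comm, trace_add,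
          trace_smul, ← Matrix.SpecialLinearGroup.coe_mul, e1, mul_smul_comm, trace_smul, mul_one,
          hx1, smul_eq_mul, smul_eq_mul]
        linear_combination h
      rw [e, one_pow]

theorem exists_frame (hG : IsGold f r) {H : Subgroup (SL2 K)} (hm : -1 ∈ H) (hH : ¬Red H)
    (htr : ∀ g ∈ H, g ≠ 1 → g ≠ -1 → g.1.trace = 0 ∨ g.1.trace ^ 2 = 1 ∨ g.1.trace ^ 2 = 2)
    {x : SL2 K} (hx : x ∈ H) (hx1 : x.1.trace = 1) :
    ∃ (I J : SL2 K) (hF : Frame f r I J), I ∈ H ∧ J ∈ H ∧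
      hF.Coord 1 x ⟨const 1, const 1, const 1, const 1⟩ := by
  obtain ⟨i, hi, hi0, hxi⟩ := exists_involution hG hm hH htr hx hx1
  have hii := SL2.mul_self_of_trace hi0
  have hiinv : i⁻¹ = -i := by
    rw [inv_eq_iff_mul_eq_one, mul_neg, hii, neg_neg]
  set j := x * i * x⁻¹ with hj
  have hj0 : j.1.trace = 0 := by rw [hj, SL2.trace_conj, hi0]
  have hjj := SL2.mul_self_of_trace hj0
  have hjinv : j⁻¹ = -j := by
    rw [inv_eq_iff_mul_eq_one, mul_neg, hjj, neg_neg]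
  have hcayley : x.1 * x.1 = x.1 - 1 := by
    have := M2.cayley x.1
    rwa [hx1, x.2, one_smul, one_smul] at this
  have hix : (i * x).1.trace = -1 := by
    rw [Matrix.SpecialLinearGroup.coe_mul, trace_mul_comm, ← Matrix.SpecialLinearGroup.coe_mul, hxi]
  have hij0 : (i * j).1.trace = 0 := by
    have e : (i * j).1 = (i * x * i).1 - ((i * x) * (i * x)).1 := by
      rw [hj, show i * (x * i * x⁻¹) = (i * x * i) * x⁻¹ by group,
        Matrix.SpecialLinearGroup.coe_mul, SL2.val_inv, hx1, one_smul, mul_sub, mul_one,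
        ← Matrix.SpecialLinearGroup.coe_mul, mul_assoc (i * x) i x]
    have e1 : (i * x * i).1.trace = -1 := by
      rw [Matrix.SpecialLinearGroup.coe_mul, trace_mul_comm, ← Matrix.SpecialLinearGroup.coe_mul,
        ← mul_assoc, hii, neg_one_mul, Matrix.SpecialLinearGroup.coe_neg, trace_neg, hx1]
    rw [e, trace_sub, e1, ← sq, SL2.val_sq, trace_add, trace_smul, hix, trace_smul, trace_one]
    simp
    norm_num
  have anti : i * j = -(j * i) := by
    have := SL2.mul_self_of_trace hij0
    have e : (i * j)⁻¹ = -(i * j) := by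
      rw [inv_eq_iff_mul_eq_one, mul_neg, this, neg_neg]
    rw [_root_.mul_inv_rev, hiinv, hjinv, neg_mul_neg] at e
    rw [e, neg_neg]
  let hF : Frame f r i j := ⟨hG, hii, hjj, anti⟩
  refine ⟨i, j, hF, hi, H.mul_mem (H.mul_mem hx hi) (H.inv_mem hx), hF.coord_of_traces ?_ ?_ ?_ ?_⟩
  · rw [ev_const, hx1, Int.cast_one]
  · rw [ev_const, hiinv, mul_neg, Matrix.SpecialLinearGroup.coe_neg, trace_neg, hxi]
    simp
  · rw [ev_const, hjinv, mul_neg, Matrix.SpecialLinearGroup.coe_neg, trace_neg, hj,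
      show x * (x * i * x⁻¹) = x * (x * i) * x⁻¹ by group, SL2.trace_conj, hxi]
    simp
  · rw [ev_const, _root_.mul_inv_rev, hiinv, hjinv, neg_mul_neg, hj]
    have e : (x * (x * i * x⁻¹ * i)).1 = (j * i).1 - (i * x⁻¹ * i).1 := by
      rw [show x * (x * i * x⁻¹ * i) = (x * x) * (i * x⁻¹ * i) by group,
        Matrix.SpecialLinearGroup.coe_mul, Matrix.SpecialLinearGroup.coe_mul, hcayley, sub_mul,
        one_mul, ← Matrix.SpecialLinearGroup.coe_mul, hj,
        show x * (i * x⁻¹ * i) = x * i * x⁻¹ * i by group]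
    have e1 : (j * i).1.trace = 0 := by
      rw [Matrix.SpecialLinearGroup.coe_mul, trace_mul_comm, ← Matrix.SpecialLinearGroup.coe_mul,
        hij0]
    have e2 : (i * x⁻¹ * i).1.trace = -1 := by
      rw [Matrix.SpecialLinearGroup.coe_mul, trace_mul_comm, ← Matrix.SpecialLinearGroup.coe_mul,
        ← mul_assoc, hii, neg_one_mul, Matrix.SpecialLinearGroup.coe_neg, trace_neg, SL2.trace_inv,
        hx1]
    rw [e, trace_sub, e1, e2]
    simp

end Coordinates

section TetrahedralOverlap

open Matrix GoldInt

variable {K : Type*} [Field K] {f r : K} {I J : SL2 K}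

/-- The traces of noncentral elements of `H` are values of members of `l`. -/
def Labelled (f r : K) (l : List GoldInt) (H : Subgroup (SL2 K)) : Prop :=
  ∀ h ∈ H, h ≠ 1 → h ≠ -1 → ∃ x ∈ l, x.ev f r = h.1.trace

theorem labelled_four (hG : IsGold f r) {t : K} (h : t = 0 ∨ t ^ 2 = 1 ∨ t ^ 2 = 2) :
    ∃ x ∈ labels4, x.ev f r = t := by
  rcases h with rfl | h | h
  · exact ⟨⟨0, 0, 0, 0⟩, by simp [labels4], by simp [ev]⟩
  · rcases sq_eq_sq_iff_eq_or_eq_neg.mp (h.trans (one_pow 2).symm) with rfl | rfl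
    · exact ⟨⟨1, 0, 0, 0⟩, by simp [labels4], by simp [ev]⟩
    · exact ⟨⟨-1, 0, 0, 0⟩, by simp [labels4], by simp [ev]⟩
  · rcases sq_eq_sq_iff_eq_or_eq_neg.mp (h.trans hG.sqrt.symm) with rfl | rfl
    · exact ⟨⟨0, 0, 1, 0⟩, by simp [labels4], by simp [ev]⟩
    · exact ⟨⟨0, 0, -1, 0⟩, by simp [labels4], by simp [ev]⟩

theorem labelled_five (hG : IsGold f r) {t : K}
    (h : t = 0 ∨ t ^ 2 = 1 ∨ t ^ 4 - 3 * t ^ 2 + 1 = 0) : ∃ x ∈ labels5, x.ev f r = t := by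
  rcases h with rfl | h | h
  · exact ⟨⟨0, 0, 0, 0⟩, by simp [labels5], by simp [ev]⟩
  · rcases sq_eq_sq_iff_eq_or_eq_neg.mp (h.trans (one_pow 2).symm) with rfl | rfl
    · exact ⟨⟨1, 0, 0, 0⟩, by simp [labels5], by simp [ev]⟩
    · exact ⟨⟨-1, 0, 0, 0⟩, by simp [labels5], by simp [ev]⟩
  · have e : (t - f) * ((t - (1 - f)) * ((t + f) * (t + (1 - f)))) = 0 := by
      linear_combination h + (f ^ 2 - f + 1 - 2 * t ^ 2) * hG.golden
    simp only [mul_eq_zero, sub_eq_zero, add_eq_zero_iff_eq_neg] at e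
    rcases e with rfl | rfl | rfl | rfl
    · exact ⟨⟨0, 1, 0, 0⟩, by simp [labels5], by simp [ev]⟩
    · exact ⟨⟨1, -1, 0, 0⟩, by simp [labels5], by simp [ev]; ring⟩
    · exact ⟨⟨0, -1, 0, 0⟩, by simp [labels5], by simp [ev]⟩
    · exact ⟨⟨-1, 1, 0, 0⟩, by simp [labels5], by simp [ev]; ring⟩

theorem Exc.labelled_four (hG : IsGold f r) {H : Subgroup (SL2 K)} (hH : Exc H)
    (h : Nat.card H = 24 ∨ Nat.card H = 48) : Labelled f r labels4 H := by
  intro g hg h1 h1'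
  have := hH.trace g hg h1 h1'
  apply _root_.labelled_four hG
  rcases h with h | h <;> rw [h] at this
  · exact this.imp_right Or.inl
  · exact this

theorem Exc.labelled_five (hG : IsGold f r) {H : Subgroup (SL2 K)} (hH : Exc H)
    (h : Nat.card H = 120) : Labelled f r labels5 H := by
  intro g hg h1 h1'
  have := hH.trace g hg h1 h1'
  rw [h] at this
  exact _root_.labelled_five hG this

theorem Exc.labelled (hG : IsGold f r) {Q : Subgroup (SL2 K)} (hQ : Exc Q) :
    Labelled f r labels4 Q ∨ Labelled f r labels5 Q := by
  rcases hQ.card with h | h | h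
  · exact Or.inl (hQ.labelled_four hG (Or.inl h))
  · exact Or.inl (hQ.labelled_four hG (Or.inr h))
  · exact Or.inr (hQ.labelled_five hG h)

theorem mayMem_of_ev_eq (hG : IsGold f r) {l : List GoldInt} {x z : GoldInt} (hx : x ∈ l)
    (e : x.ev f r = z.ev f r) : mayMem l z = true := by
  rw [mayMem, force_eq, List.any_eq_true]
  exact ⟨x, hx, by simp [hG.not_smooth (x := sub z x) (by rw [ev_sub, e, sub_self])]⟩

theorem ne_of_noLabel (hG : IsGold f r) {l : List GoldInt} {n : ℤ} {x z : GoldInt}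
    (h : GoldQuat.noLabel l n z = true) (hx : x ∈ l) : n * x.ev f r ≠ z.ev f r := by
  intro e
  rw [GoldQuat.noLabel, mayMem_of_ev_eq hG (x := scale n x) (List.mem_map_of_mem hx)
    (by rw [ev_scale, e])] at h
  exact absurd h (by decide)

theorem exists_of_hit {l : List GoldInt} {n : ℤ} {s : GoldQuat} (h : GoldQuat.hit l n s = true) :
    ∃ x ∈ l, n * x.ev f r = s.w.ev f r := by
  rw [GoldQuat.hit, force_eq, List.any_eq_true] at h
  obtain ⟨x, hx, e⟩ := h
  exact ⟨x, hx, by rw [← ev_scale, eq_of_eqb e]⟩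

theorem mem_of_memb {l : List GoldQuat} {t : GoldQuat} (h : GoldQuat.memb l t = true) : t ∈ l := by
  rw [GoldQuat.memb, List.any_eq_true] at h
  obtain ⟨s, hs, e⟩ := h
  exact Frame.eqb_iff e ▸ hs

theorem of_enum {l : List GoldInt} {p : GoldQuat → Bool} (h : GoldQuat.enum l p = true)
    {a b c d : GoldInt} (ha : a ∈ l) (hb : b ∈ l) (hc : c ∈ l) (hd : d ∈ l) :
    p ⟨a, b, c, d⟩ = true := by
  simp only [GoldQuat.enum, List.all_eq_true] at h
  exact h a ha b hb c hc d hd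

namespace Frame

variable {hF : Frame f r I J} {D : Subgroup (SL2 K)}

theorem Coord.of_mul {g d : SL2 K} {s t : GoldQuat} (h : hF.Coord 2 (g * d) (s.mul t))
    (hd : hF.Coord 1 d t) : hF.Coord 1 g s := by
  unfold Coord at *
  rw [hF.ev_mul, ← hd, pow_one, mul_smul_comm, Matrix.SpecialLinearGroup.coe_mul, sq, mul_smul] at h
  have h' := smul_right_injective _ hF.two_ne_zero h
  have h'' := congrArg (· * (d⁻¹).1) h'
  rw [smul_mul_assoc, mul_assoc, SL2.mul_inv_val, mul_one, mul_assoc, SL2.mul_inv_val,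
    mul_one] at h''
  rw [pow_one, h'']

theorem Coord.of_smul_neg {n : ℕ} {g : SL2 K} {s : GoldQuat} (h : hF.Coord n g (s.smul (-1))) :
    hF.Coord n (-g) s := by
  unfold Coord at *
  rw [Matrix.SpecialLinearGroup.coe_neg, smul_neg, h, Coord.ev_smul]
  simp

theorem InGroup.noncentral (hD : hF.InGroup D) {z d : SL2 K} (hz : z ∉ D) (hd : d ∈ D) :
    z * d⁻¹ ≠ 1 ∧ z * d⁻¹ ≠ -1 := by
  refine ⟨fun h => hz ?_, fun h => hz ?_⟩
  · rw [mul_inv_eq_one.mp h]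
    exact hd
  · rw [mul_inv_eq_iff_eq_mul.mp h]
    exact D.mul_mem hD.neg_one hd

theorem InGroup.exists_coord (hD : hF.InGroup D) {l : List GoldInt} {M : Subgroup (SL2 K)}
    (hDM : D ≤ M) (hM : Labelled f r l M) {z : SL2 K} (hz : z ∈ M) (hzD : z ∉ D) :
    ∃ a ∈ l, ∃ b ∈ l, ∃ c ∈ l, ∃ d ∈ l, hF.Coord 1 z ⟨a, b, c, d⟩ ∧
      GoldQuat.possible l ⟨a, b, c, d⟩ = true := by
  have key : ∀ d ∈ D, ∃ x ∈ l, x.ev f r = (z * d⁻¹).1.trace := fun d hd =>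
    hM _ (M.mul_mem hz (M.inv_mem (hDM hd))) (hD.noncentral hzD hd).1 (hD.noncentral hzD hd).2
  obtain ⟨a, ha, ea⟩ := key 1 D.one_mem
  obtain ⟨b, hb, eb⟩ := key I hD.left
  obtain ⟨c, hc, ec⟩ := key J hD.right
  obtain ⟨d, hd, ed⟩ := key (I * J) (D.mul_mem hD.left hD.right)
  rw [inv_one, mul_one] at ea
  have hcz := hF.coord_of_traces ea eb ec ed
  refine ⟨a, ha, b, hb, c, hc, d, hd, hcz, ?_⟩
  rw [GoldQuat.possible, hF.not_smooth hcz.normSq]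
  simp only [Bool.not_false, Bool.true_and, List.all_eq_true]
  intro i hi j hj k hk
  have hh : (⟨const 1, const i, const j, const k⟩ : GoldQuat) ∈ GoldQuat.hurwitz := by
    simp only [GoldQuat.hurwitz, List.mem_append, List.mem_flatMap, List.mem_map]
    exact Or.inr ⟨1, by simp [GoldQuat.signs], i, hi, j, hj, k, hk, rfl⟩
  obtain ⟨e, he, hec⟩ := hD.hurwitz hh
  obtain ⟨x, hx, ex⟩ := key e he
  refine mayMem_of_ev_eq hF.toIsGold (x := scale 2 x) (List.mem_map_of_mem hx) ?_
  have := (hcz.mul hec.inv).trace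
  rw [← ex] at this
  simp only [GoldQuat.mul, GoldQuat.conj, ev_add, ev_sub, ev_neg, ev_const,
    GoldInt.ev_mul hF.golden hF.sqrt, ev_scale] at this ⊢
  apply mul_left_cancel₀ hF.two_ne_zero
  push_cast at this ⊢
  linear_combination this

theorem coord_hurwitz (hF : Frame f r I J) (hI : I ∈ D) (hJ : J ∈ D) (hD : Exc D)
    (hcard : Nat.card D = 24) {d : SL2 K} (hd : d ∈ D) :
    ∃ t ∈ GoldQuat.hurwitz, hF.Coord 1 d t := by
  have key : ∀ g ∈ D, ∃ x ∈ GoldQuat.labels3, x.ev f r = g.1.trace := by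
    intro g hg
    by_cases h1 : g = 1
    · exact ⟨⟨2, 0, 0, 0⟩, by simp [GoldQuat.labels3], by simp [ev, h1]⟩
    by_cases h1' : g = -1
    · exact ⟨⟨-2, 0, 0, 0⟩, by simp [GoldQuat.labels3], by simp [ev, h1']⟩
    have := hD.trace g hg h1 h1'
    rw [hcard] at this
    rcases this with h | h
    · exact ⟨⟨0, 0, 0, 0⟩, by simp [GoldQuat.labels3], by simp [ev, h]⟩
    rcases sq_eq_sq_iff_eq_or_eq_neg.mp (h.trans (one_pow 2).symm) with h | h
    · exact ⟨⟨1, 0, 0, 0⟩, by simp [GoldQuat.labels3], by simp [ev, h]⟩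
    · exact ⟨⟨-1, 0, 0, 0⟩, by simp [GoldQuat.labels3], by simp [ev, h]⟩
  obtain ⟨a, ha, ea⟩ := key d hd
  obtain ⟨b, hb, eb⟩ := key _ (D.mul_mem hd (D.inv_mem hI))
  obtain ⟨c, hc, ec⟩ := key _ (D.mul_mem hd (D.inv_mem hJ))
  obtain ⟨e, he, ee⟩ := key _ (D.mul_mem hd (D.inv_mem (D.mul_mem hI hJ)))
  have hcd := hF.coord_of_traces ea eb ec ee
  have := of_enum GoldQuat.enum_labels3 ha hb hc he
  rw [hF.not_smooth hcd.normSq, Bool.false_or] at this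
  exact ⟨_, mem_of_memb this, hcd⟩

theorem InGroup.coord_octa (hD : hF.InGroup D) {M : Subgroup (SL2 K)} (hDM : D ≤ M)
    (hM : Labelled f r labels4 M) {z : SL2 K} (hz : z ∈ M) (hzD : z ∉ D) :
    ∃ t ∈ GoldQuat.octa, hF.Coord 1 z t := by
  obtain ⟨a, ha, b, hb, c, hc, d, hd, h, hp⟩ := hD.exists_coord hDM hM hz hzD
  have := of_enum GoldQuat.enum_labels4 ha hb hc hd
  rw [hp, Bool.not_true, Bool.false_or] at this
  exact ⟨_, mem_of_memb this, h⟩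

theorem InGroup.coord_icosa (hD : hF.InGroup D) {M : Subgroup (SL2 K)} (hDM : D ≤ M)
    (hM : Labelled f r labels5 M) {z : SL2 K} (hz : z ∈ M) (hzD : z ∉ D) :
    ∃ t ∈ GoldQuat.icosa ++ GoldQuat.icosa', hF.Coord 1 z t := by
  obtain ⟨a, ha, b, hb, c, hc, d, hd, h, hp⟩ := hD.exists_coord hDM hM hz hzD
  have := of_enum GoldQuat.enum_labels5 ha hb hc hd
  rw [hp, Bool.not_true, Bool.false_or, Bool.or_eq_true] at this
  exact ⟨_, List.mem_append.mpr (this.imp mem_of_memb mem_of_memb), h⟩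

theorem InGroup.exists_conj (hD : hF.InGroup D) {L R : List GoldQuat}
    (hL : L.all (GoldQuat.conjTo R) = true) {z : SL2 K} {t : GoldQuat} (ht : t ∈ L)
    (hz : hF.Coord 1 z t) :
    ∃ d ∈ D, ∃ s ∈ R, hF.Coord 1 (d * z * d⁻¹) s ∨ hF.Coord 1 (-(d * z * d⁻¹)) s := by
  have := List.all_eq_true.mp hL t ht
  rw [GoldQuat.conjTo, GoldQuat.force_eq, List.any_eq_true] at this
  obtain ⟨s, hs, h⟩ := this
  rw [Bool.and_eq_true, List.any_eq_true] at h
  obtain ⟨-, u, hu, h⟩ := h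
  rw [GoldQuat.force_eq, GoldQuat.force_eq, Bool.or_eq_true] at h
  obtain ⟨d, hd, hdc⟩ := hD.hurwitz hu
  have hm := hdc.mul hz
  refine ⟨d, hd, s, hs, h.imp (fun h => ?_) fun h => ?_⟩
  · rw [eqb_iff h] at hm
    exact Coord.of_mul (by rwa [inv_mul_cancel_right]) hdc
  · rw [eqb_iff h] at hm
    exact Coord.of_mul (by rw [neg_mul, inv_mul_cancel_right]; exact hm.of_smul_neg) hdc

/-- Membership of `c` and of `x` in a group above `D` are equivalent. -/
def Linked (D : Subgroup (SL2 K)) (c x : SL2 K) : Prop :=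
  ∀ A : Subgroup (SL2 K), D ≤ A → (c ∈ A ↔ x ∈ A)

/-- Either `c` and `x` lie in the same groups above `D`, or no exceptional group contains both
together with a noncentral element of `D`. -/
def Apart (D : Subgroup (SL2 K)) (c x : SL2 K) : Prop :=
  Linked D c x ∨ ((c * x⁻¹).1.trace ≠ 0 ∧ ∀ Q : Subgroup (SL2 K), Exc Q → c ∈ Q → x ∈ Q →
    ∀ e ∈ D, e ∈ Q → e ≠ 1 → e ≠ -1 → False)

theorem Linked.symm {c x : SL2 K} (h : Linked D c x) : Linked D x c := fun A hA => (h A hA).symm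

theorem linked_of_mul_mem {c x y : SL2 K} (h : c * y ∈ D) (hy : Linked D y x) : Linked D c x := by
  intro A hA
  rw [← hy A hA]
  have := hA h
  exact ⟨fun hc => (A.mul_mem_cancel_left hc).mp this,
    fun hc => (A.mul_mem_cancel_right hc).mp this⟩

theorem Linked.refl (x : SL2 K) : Linked D x x := fun _ _ => Iff.rfl

theorem linked_inv (x : SL2 K) : Linked D x⁻¹ x := fun A _ => A.inv_mem_iff

theorem linked_mul_left {d : SL2 K} (hd : d ∈ D) (x : SL2 K) : Linked D (d * x) x :=
  fun A hA => A.mul_mem_cancel_left (hA hd)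

theorem linked_mul_right {d : SL2 K} (hd : d ∈ D) (x : SL2 K) : Linked D (x * d) x :=
  fun A hA => A.mul_mem_cancel_right (hA hd)

theorem linked_neg (hD : -1 ∈ D) (x : SL2 K) : Linked D (-x) x := by
  simpa using linked_mul_left hD x

theorem Linked.trans {c x y : SL2 K} (h : Linked D c x) (h' : Linked D x y) : Linked D c y :=
  fun A hA => (h A hA).trans (h' A hA)

theorem Apart.symm {c x : SL2 K} (h : Apart D c x) : Apart D x c := by
  refine h.imp Linked.symm fun ⟨h1, h2⟩ => ⟨?_, fun Q hQ hx hc => h2 Q hQ hc hx⟩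
  rwa [← SL2.trace_inv, _root_.mul_inv_rev, inv_inv]

theorem Apart.of_neg (hD : -1 ∈ D) {c x : SL2 K} (h : Apart D (-c) x) : Apart D c x := by
  refine h.imp (linked_neg hD c).symm.trans fun ⟨h1, h2⟩ => ⟨?_, fun Q hQ hc hx =>
    h2 Q hQ (neg_mem_of hQ.neg_one_mem hc) hx⟩
  simpa using h1

theorem InGroup.exists_double_coset (hD : hF.InGroup D) {R : List GoldQuat} {ρ : GoldQuat}
    (hR : R.all (GoldQuat.inDoubleCoset ρ) = true)
    (hρ : GoldQuat.eqb (ρ.mul ρ.conj) ⟨const 4, const 0, const 0, const 0⟩ = true) {z : SL2 K}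
    {t : GoldQuat} (ht : t ∈ R) (hz : hF.Coord 1 z t) :
    ∃ y, hF.Coord 1 y ρ ∧ Linked D z y := by
  have := List.all_eq_true.mp hR t ht
  rw [GoldQuat.inDoubleCoset, List.any_eq_true] at this
  obtain ⟨b, hb, h⟩ := this
  rw [GoldQuat.force_eq, List.any_eq_true] at h
  obtain ⟨u, hu, h⟩ := h
  obtain ⟨d, hd, hdc⟩ := hD.basis hb
  obtain ⟨e, he, hec⟩ := hD.hurwitz hu
  refine ⟨d * z * e⁻¹, Coord.of_mul ?_ hec,
    ((linked_mul_right (D.inv_mem he) _).trans (linked_mul_left hd _)).symm⟩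
  rw [inv_mul_cancel_right]
  have h1 := hdc.mul hz
  unfold Coord at h1 ⊢
  rw [h1]
  have h2 := congrArg (fun s => ρ.ev f r I J * s.ev f r I J) (eqb_iff h)
  have h4 := congrArg (GoldQuat.ev f r I J) (eqb_iff hρ)
  simp only [Coord.ev_smul, hF.ev_mul, mul_smul_comm, ← mul_assoc] at h2
  rw [← hF.ev_mul ρ ρ.conj, h4] at h2
  simp only [GoldQuat.ev, ev_const, Int.cast_zero, zero_smul, add_zero, smul_mul_assoc,
    one_mul] at h2
  have h44 : ((4 : ℤ) : K) ≠ 0 := by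
    rw [show ((4 : ℤ) : K) = 2 ^ 2 by norm_num]
    exact pow_ne_zero 2 hF.two_ne_zero
  rw [hF.ev_mul, hF.ev_mul]
  exact (smul_right_injective _ h44 h2).symm

theorem InGroup.exists_class (hD : hF.InGroup D) {L R : List GoldQuat} {ρ : GoldQuat}
    (hL : L.all (GoldQuat.conjTo R) = true) (hR : R.all (GoldQuat.inDoubleCoset ρ) = true)
    (hρ : GoldQuat.eqb (ρ.mul ρ.conj) ⟨const 4, const 0, const 0, const 0⟩ = true) {z : SL2 K}
    {t : GoldQuat} (ht : t ∈ L) (hz : hF.Coord 1 z t) :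
    ∃ y, hF.Coord 1 y ρ ∧ Linked D z y := by
  obtain ⟨d, hd, s, hs, h⟩ := hD.exists_conj hL ht hz
  have hl : Linked D z (d * z * d⁻¹) :=
    ((linked_mul_right (D.inv_mem hd) _).trans (linked_mul_left hd _)).symm
  rcases h with h | h
  · obtain ⟨y, hy, hl'⟩ := hD.exists_double_coset hR hρ hs h
    exact ⟨y, hy, hl.trans hl'⟩
  · obtain ⟨y, hy, hl'⟩ := hD.exists_double_coset hR hρ hs h
    exact ⟨y, hy, hl.trans ((linked_neg hD.neg_one _).symm.trans hl')⟩

theorem Coord.linked {c x y y' : SL2 K} {ρ : GoldQuat} (hy : hF.Coord 1 y ρ) (hc : Linked D c y)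
    (hy' : hF.Coord 1 y' ρ) (hx : Linked D x y') : Linked D c x :=
  hc.trans (hy.unique hy' ▸ hx.symm)

theorem InGroup.exists_conj_frame (hD : hF.InGroup D) {L R : List GoldQuat}
    (hL : L.all (GoldQuat.conjTo R) = true) {z : SL2 K} {t : GoldQuat} (ht : t ∈ L)
    (hz : hF.Coord 1 z t) : ∃ (I' J' : SL2 K) (hF' : Frame f r I' J'), hF'.InGroup D ∧
      ∃ s ∈ R, hF'.Coord 1 z s ∨ hF'.Coord 1 (-z) s := by
  obtain ⟨d, hd, s, hs, h⟩ := hD.exists_conj hL ht hz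
  refine ⟨_, _, hF.conj d, hD.conj hd, s, hs, h.imp (fun h => ?_) fun h => ?_⟩
  · simpa only [show d⁻¹ * (d * z * d⁻¹) * d = z by group] using h.conj d
  · simpa only [mul_neg, neg_mul, show d⁻¹ * (d * z * d⁻¹) * d = z by group] using h.conj d

theorem eq_one_or_eq_neg_one_of_noLabel (hG : IsGold f r) {l : List GoldInt}
    {Q : Subgroup (SL2 K)} (hQ : Labelled f r l Q) {y : SL2 K} (hy : y ∈ Q) {k : GoldInt}
    (hk : GoldQuat.noLabel l 2 k = true) (h : 2 * y.1.trace = k.ev f r) : y = 1 ∨ y = -1 := by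
  by_contra! hne
  obtain ⟨x, hx, e⟩ := hQ y hy hne.1 hne.2
  exact ne_of_noLabel hG hk hx (by rw [e, ← h, Int.cast_ofNat])

theorem Coord.two_mul_trace {y : SL2 K} {s : GoldQuat} (h : hF.Coord 2 y s) :
    2 * y.1.trace = s.w.ev f r := by
  have := h.trace
  apply mul_left_cancel₀ hF.two_ne_zero
  linear_combination this

theorem Coord.four_mul_trace {y : SL2 K} {s : GoldQuat} (h : hF.Coord 3 y s) :
    4 * y.1.trace = s.w.ev f r := by
  have := h.trace
  apply mul_left_cancel₀ hF.two_ne_zero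
  linear_combination this

theorem mem_of_eq_one_or (hD : -1 ∈ D) {y : SL2 K} (h : y = 1 ∨ y = -1) : y ∈ D := by
  rcases h with rfl | rfl
  exacts [D.one_mem, hD]

theorem InGroup.apart_octa_icosa (hD : hF.InGroup D) {A B : Subgroup (SL2 K)} (hA : D ≤ A)
    (hB : D ≤ B) (hlA : Labelled f r labels4 A) (hlB : Labelled f r labels5 B) {c x : SL2 K}
    (hc : c ∈ A) (hcD : c ∉ D) (hx : x ∈ B) (hxD : x ∉ D) : Apart D c x := by
  have hG := hF.toIsGold
  obtain ⟨t, ht, hct⟩ := hD.coord_octa hA hlA hc hcD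
  obtain ⟨I', J', hF', hD', s, hs, hcs⟩ := hD.exists_conj_frame GoldQuat.octa_conj ht hct
  obtain ⟨t, ht, hxt⟩ := hD'.coord_icosa hB hlB hx hxD
  have key : ∀ c, hF'.Coord 1 c s → Apart D c x := by
    intro c hcs
    by_cases hl : Linked D c x
    · exact Or.inl hl
    have := List.all_eq_true.mp (List.all_eq_true.mp GoldQuat.octa_icosa_check s hs) t ht
    rw [GoldInt.force_eq, Bool.and_eq_true, Bool.and_eq_true] at this
    obtain ⟨⟨h1, h2⟩, h3⟩ := this
    have htr := (hcs.mul hxt.inv).two_mul_trace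
    refine Or.inr ⟨fun h0 => ?_, fun Q hQ hcQ hxQ _ _ _ _ _ => hl ?_⟩
    · exact ev_ne_zero hG.golden hG.sqrt hG.char h1 (by rw [← htr, h0, mul_zero])
    have hy : c * x⁻¹ ∈ Q := Q.mul_mem hcQ (Q.inv_mem hxQ)
    refine linked_of_mul_mem (mem_of_eq_one_or hD.neg_one ?_) (linked_inv x)
    rcases Exc.labelled hG hQ with hQl | hQl
    · exact eq_one_or_eq_neg_one_of_noLabel hG hQl hy h2 htr
    · exact eq_one_or_eq_neg_one_of_noLabel hG hQl hy h3 htr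
  exact hcs.elim (key c) fun h => (key _ h).of_neg hD.neg_one

theorem InGroup.linked_of_crossCheck (hD : hF.InGroup D) (hDe : Exc D) (hcard : Nat.card D = 24)
    {l nl : List GoldInt} (hnl : nl.all (GoldQuat.noLabel l 2) = true)
    (hl : GoldQuat.crossCheck l nl = true) {c x e : SL2 K} {s t : GoldQuat}
    (hs : s ∈ GoldQuat.icosaReps) (ht : t ∈ GoldQuat.icosa') (hc : hF.Coord 1 c s)
    (hx : hF.Coord 1 x t) (hcD : c ∉ D) (hxD : x ∉ D) {Q : Subgroup (SL2 K)}
    (hQ : Labelled f r l Q) (hcQ : c ∈ Q) (hxQ : x ∈ Q) (he : e ∈ D) (heQ : e ∈ Q) (he1 : e ≠ 1)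
    (he1' : e ≠ -1) : Linked D c x := by
  have hG := hF.toIsGold
  obtain ⟨u, hu, hec⟩ := hF.coord_hurwitz hD.left hD.right hDe hcard he
  have two : ∀ {y : SL2 K} {v : GoldQuat}, y ∈ Q → hF.Coord 2 y v → GoldQuat.hit nl 1 v = true →
      y ∈ D := by
    intro y v hy hv h
    obtain ⟨k, hk, e⟩ := exists_of_hit (f := f) (r := r) h
    exact mem_of_eq_one_or hD.neg_one (eq_one_or_eq_neg_one_of_noLabel hG hQ hy
      (List.all_eq_true.mp hnl k hk) (by rw [hv.two_mul_trace, ← e, Int.cast_one, one_mul]))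
  have three : ∀ {y : SL2 K} {v : GoldQuat}, y ∈ Q → hF.Coord 3 y v →
      GoldQuat.hit nl 2 v = true → y ∈ D := by
    intro y v hy hv h
    obtain ⟨k, hk, e⟩ := exists_of_hit (f := f) (r := r) h
    refine mem_of_eq_one_or hD.neg_one (eq_one_or_eq_neg_one_of_noLabel hG hQ hy
      (List.all_eq_true.mp hnl k hk) ?_)
    apply mul_left_cancel₀ hF.two_ne_zero
    rw [← Int.cast_ofNat, e, ← hv.four_mul_trace, Int.cast_ofNat]
    ring
  have one : ∀ {y : SL2 K} {v : GoldQuat}, y ∈ Q → y ∉ D → hF.Coord 1 y v →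
      GoldQuat.noLabel l 1 v.w = true → False := by
    intro y v hy hyD hv h
    obtain ⟨k, hk, e⟩ := hQ y hy (fun h => hyD (h ▸ D.one_mem)) fun h => hyD (h ▸ hD.neg_one)
    exact ne_of_noLabel hG h hk (by rw [Int.cast_one, one_mul, e, hv.trace_one])
  rw [GoldQuat.crossCheck, GoldQuat.forceList_eq] at hl
  have := List.all_eq_true.mp (List.all_eq_true.mp hl s hs) t ht
  rw [GoldQuat.force_eq] at this
  simp only [Bool.or_eq_true] at this
  rcases this with (((h | h) | h) | h) | h
  · exact linked_of_mul_mem (two (Q.mul_mem hcQ (Q.inv_mem hxQ)) (hc.mul hx.inv) h) (linked_inv x)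
  · exact linked_of_mul_mem (two (Q.mul_mem hcQ hxQ) (hc.mul hx) h) (Linked.refl x)
  · exact (one hcQ hcD hc h).elim
  · exact (one hxQ hxD hx h).elim
  have := List.all_eq_true.mp h u hu
  simp only [Bool.or_eq_true] at this
  rcases this with (h | h) | h
  · exfalso
    have := mem_of_memb h
    simp only [GoldQuat.basis, List.take_succ_cons, List.take_zero, List.map_cons, List.map_nil,
      List.mem_append, List.mem_cons, List.not_mem_nil, or_false] at this
    rcases this with rfl | rfl
    · exact he1 (hec.unique hF.coord_one)
    · exact he1' (hec.unique hF.coord_one.neg)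
  · exact linked_of_mul_mem (three (Q.mul_mem hcQ (Q.mul_mem heQ hxQ)) (hc.mul (hec.mul hx)) h)
      (linked_mul_left he x)
  · exact linked_of_mul_mem (three (Q.mul_mem hcQ (Q.mul_mem hxQ heQ)) (hc.mul (hx.mul hec)) h)
      (linked_mul_right he x)

theorem InGroup.apart_icosa (hD : hF.InGroup D) (hDe : Exc D) (hcard : Nat.card D = 24)
    {B : Subgroup (SL2 K)} (hB : D ≤ B) (hlB : Labelled f r labels5 B) {c x : SL2 K}
    {t : GoldQuat} (ht : t ∈ GoldQuat.icosa) (hct : hF.Coord 1 c t) (hcD : c ∉ D) (hx : x ∈ B)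
    (hxD : x ∉ D) : Apart D c x := by
  have hG := hF.toIsGold
  obtain ⟨I', J', hF', hD', s, hs, hcs⟩ := hD.exists_conj_frame GoldQuat.icosa_conj ht hct
  obtain ⟨t, ht, hxt⟩ := hD'.coord_icosa hB hlB hx hxD
  have key : ∀ c, c ∉ D → hF'.Coord 1 c s → Apart D c x := by
    intro c hcD hcs
    rcases List.mem_append.mp ht with ht | ht
    · obtain ⟨y, hy, hl⟩ := hD'.exists_double_coset GoldQuat.icosa_coset (by decide +kernel) hs hcs
      obtain ⟨y', hy', hl'⟩ := hD'.exists_class GoldQuat.icosa_conj GoldQuat.icosa_coset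
        (by decide +kernel) ht hxt
      exact Or.inl (hy.linked hl hy' hl')
    by_cases hl : Linked D c x
    · exact Or.inl hl
    have := List.all_eq_true.mp (List.all_eq_true.mp GoldQuat.icosa_icosa'_check s hs) t ht
    have htr := (hcs.mul hxt.inv).two_mul_trace
    refine Or.inr ⟨fun h0 => ?_, fun Q hQ hcQ hxQ e he heQ he1 he1' => hl ?_⟩
    · exact ev_ne_zero hG.golden hG.sqrt hG.char this (by rw [← htr, h0, mul_zero])
    rcases Exc.labelled hG hQ with hQl | hQl
    · exact hD'.linked_of_crossCheck hDe hcard GoldQuat.nonLabels4_check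
        GoldQuat.crossCheck_labels4 hs ht hcs hxt hcD hxD hQl hcQ hxQ he heQ he1 he1'
    · exact hD'.linked_of_crossCheck hDe hcard GoldQuat.nonLabels5_check
        GoldQuat.crossCheck_labels5 hs ht hcs hxt hcD hxD hQl hcQ hxQ he heQ he1 he1'
  refine hcs.elim (key c hcD) fun h => (key _ (fun h' => hcD ?_) h).of_neg hD.neg_one
  simpa using neg_mem_of hD.neg_one h'

theorem InGroup.apart (hD : hF.InGroup D) (hDe : Exc D) (hcard : Nat.card D = 24)
    {A B : Subgroup (SL2 K)} (hA : D ≤ A) (hB : D ≤ B) (heA : Exc A) (heB : Exc B) {c x : SL2 K}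
    (hc : c ∈ A) (hcD : c ∉ D) (hx : x ∈ B) (hxD : x ∉ D) : Apart D c x := by
  have hG := hF.toIsGold
  rcases Exc.labelled hG heA with hlA | hlA <;> rcases Exc.labelled hG heB with hlB | hlB
  · obtain ⟨s, hs, hcs⟩ := hD.coord_octa hA hlA hc hcD
    obtain ⟨t, ht, hxt⟩ := hD.coord_octa hB hlB hx hxD
    obtain ⟨y, hy, hl⟩ := hD.exists_class GoldQuat.octa_conj GoldQuat.octa_coset
      (by decide +kernel) hs hcs
    obtain ⟨y', hy', hl'⟩ := hD.exists_class GoldQuat.octa_conj GoldQuat.octa_coset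
      (by decide +kernel) ht hxt
    exact Or.inl (hy.linked hl hy' hl')
  · exact hD.apart_octa_icosa hA hB hlA hlB hc hcD hx hxD
  · exact (hD.apart_octa_icosa hB hA hlB hlA hx hxD hc hcD).symm
  · obtain ⟨s, hs, hcs⟩ := hD.coord_icosa hA hlA hc hcD
    obtain ⟨t, ht, hxt⟩ := hD.coord_icosa hB hlB hx hxD
    rcases List.mem_append.mp hs with hs | hs
    · exact hD.apart_icosa hDe hcard hB hlB hs hcs hcD hx hxD
    rcases List.mem_append.mp ht with ht | ht
    · exact (hD.apart_icosa hDe hcard hA hlA ht hxt hxD hc hcD).symm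
    obtain ⟨y, hy, hl⟩ := hD.exists_class GoldQuat.icosa'_conj GoldQuat.icosa'_coset
      (by decide +kernel) hs hcs
    obtain ⟨y', hy', hl'⟩ := hD.exists_class GoldQuat.icosa'_conj GoldQuat.icosa'_coset
      (by decide +kernel) ht hxt
    exact Or.inl (hy.linked hl hy' hl')

end Frame

end TetrahedralOverlap

section FourInvolutions

open Matrix GoldInt

variable {K : Type*} [Field K] {f r : K}

theorem SL2.eq_or_eq_neg_of_commute (h2 : (2 : K) ≠ 0) {u w : SL2 K} (hu : u.1.trace = 0)
    (hw : w.1.trace = 0) (h : u.1 * w.1 = w.1 * u.1) : w = u ∨ w = -u := by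
  obtain ⟨c, hc⟩ := M2.exists_smul_of_commute hu hw h2 u.ne_zero h
  have hd := w.2
  rw [hc, det_smul, u.2, Fintype.card_fin, mul_one] at hd
  refine (sq_eq_sq_iff_eq_or_eq_neg.mp (hd.trans (one_pow 2).symm)).imp (fun h => ?_) fun h => ?_
  · exact Subtype.ext (by rw [hc, h, one_smul])
  · exact Subtype.ext (by rw [hc, h, neg_smul, one_smul, Matrix.SpecialLinearGroup.coe_neg])

/-- Two involutions preserving two different lines have orthogonal axes. -/
theorem trace_mul_eq_zero_of_two_lines (h2 : (2 : K) ≠ 0) {u w : SL2 K} (hu : u.1.trace = 0)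
    (hw : w.1.trace = 0) (h : u.1 * w.1 ≠ w.1 * u.1) {v v' : M2 K} (hv : v.trace = 0)
    (hv' : v'.trace = 0) (hv0 : v ≠ 0) (hv0' : v' ≠ 0) (hvv : v * v' ≠ v' * v)
    (huv : u ∈ fixer v) (hwv : w ∈ fixer v) (huv' : u ∈ fixer v') (hwv' : w ∈ fixer v') :
    (u * w).1.trace = 0 := by
  by_contra h0
  have key : ∀ z : M2 K, z.trace = 0 → z ≠ 0 → u ∈ fixer z → w ∈ fixer z →
      (z * u.1).trace = 0 ∧ (z * w.1).trace = 0 := by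
    intro z hz hz0 hu' hw'
    rw [fixer_of_trace_eq_zero hu hz] at hu'
    rw [fixer_of_trace_eq_zero hw hz] at hw'
    rcases hu' with hu' | hu' <;> rcases hw' with hw' | hw'
    · exact (h (M2.mul_comm_of_mul_comm hz hu h2 hz0 hu'.symm hw'.symm)).elim
    · obtain ⟨c, hc⟩ := M2.exists_smul_of_commute hz hu h2 hz0 hu'.symm
      refine (h0 ?_).elim
      rw [Matrix.SpecialLinearGroup.coe_mul, hc, smul_mul_assoc, trace_smul, trace_mul_comm, hw',
        smul_zero]
    · obtain ⟨c, hc⟩ := M2.exists_smul_of_commute hz hw h2 hz0 hw'.symm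
      refine (h0 ?_).elim
      rw [Matrix.SpecialLinearGroup.coe_mul, hc, mul_smul_comm, trace_smul, hu', smul_zero]
    · exact ⟨by rw [trace_mul_comm, hu'], by rw [trace_mul_comm, hw']⟩
  obtain ⟨h1, h3⟩ := key v hv hv0 huv hwv
  obtain ⟨h4, h5⟩ := key v' hv' hv0' huv' hwv'
  exact hvv (commute_of_orthogonal h2 hu hw hv hv' h h1 h3 h4 h5)

theorem SL2.sandwich {u w : SL2 K} (hu : u.1.trace = 0) (hw : w.1.trace = 0) :
    (u * w * u).1 = (u * w).1.trace • u.1 + w.1 := by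
  have e := M2.anticomm hu hw
  have hs : u.1 * u.1 = -1 := by
    rw [M2.mul_self hu, u.2, neg_smul, one_smul]
  rw [Matrix.SpecialLinearGroup.coe_mul, Matrix.SpecialLinearGroup.coe_mul]
  have e' : u.1 * w.1 = (u.1 * w.1).trace • (1 : M2 K) - w.1 * u.1 := by rw [← e]; abel
  calc u.1 * w.1 * u.1 = ((u.1 * w.1).trace • (1 : M2 K) - w.1 * u.1) * u.1 := by rw [← e']
    _ = (u.1 * w.1).trace • u.1 - w.1 * (u.1 * u.1) := by
      rw [sub_mul, smul_mul_assoc, one_mul, mul_assoc]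
    _ = _ := by rw [hs, mul_neg, mul_one, sub_neg_eq_add]

theorem SL2.trace_triple_commutator {u v w : M2 K} (hu : u.trace = 0) (hv : v.trace = 0)
    (hw : w.trace = 0) : (u * (v * w - w * v)).trace = 2 * (u * v * w).trace := by
  have e := M2.anticomm hv hw
  have e' : w * v = (v * w).trace • (1 : M2 K) - v * w := by rw [← e]; abel
  rw [e', mul_sub, mul_sub, mul_smul_comm, mul_one, trace_sub, trace_sub, trace_smul, hu, mul_assoc]
  simp
  ring

theorem SL2.trace_triple_sq (h2 : (2 : K) ≠ 0) {u v w : SL2 K} (hu : u.1.trace = 0)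
    (hv : v.1.trace = 0) (hw : w.1.trace = 0) :
    (u * v * w).1.trace ^ 2 = 4 - (u * v).1.trace ^ 2 - (u * w).1.trace ^ 2 - (v * w).1.trace ^ 2
      - (u * v).1.trace * ((u * w).1.trace * (v * w).1.trace) := by
  have e := M2.gram hu hv hw
  rw [SL2.trace_triple_commutator hu hv hw, M2.trace_mul_self hu, M2.trace_mul_self hv,
    M2.trace_mul_self hw, u.2, v.2, w.2] at e
  simp only [Matrix.SpecialLinearGroup.coe_mul]
  apply mul_left_cancel₀ (pow_ne_zero 2 h2)
  linear_combination e

/-- Three involutions preserving a common line, orthogonal to their axes. -/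
theorem trace_triple_eq_zero (h2 : (2 : K) ≠ 0) {u v w : SL2 K} (hu : u.1.trace = 0)
    (hv : v.1.trace = 0) (hw : w.1.trace = 0) {z : M2 K} (hz : z.trace = 0) (hz0 : z ≠ 0)
    (h1 : (u.1 * z).trace = 0) (h3 : (v.1 * z).trace = 0) (h4 : (w.1 * z).trace = 0) :
    (u * v * w).1.trace = 0 := by
  have e := SL2.trace_triple_commutator hu hv hw
  apply mul_left_cancel₀ h2
  rw [Matrix.SpecialLinearGroup.coe_mul, Matrix.SpecialLinearGroup.coe_mul, ← e, mul_zero]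
  obtain ⟨c, hc⟩ := M2.exists_smul_of_commute hz (trace_commutator v.1 w.1) h2 hz0
    (commute_commutator_of_orthogonal hv hw hz (by rw [trace_mul_comm, h3])
      (by rw [trace_mul_comm, h4]))
  rw [hc, mul_smul_comm, trace_smul, h1, smul_zero]

theorem det_gram_eq_zero (u : Fin 4 → M2 K) (hu : ∀ i, (u i).trace = 0) :
    (Matrix.of fun i j => (u i * u j).trace).det = 0 := by
  have e : (Matrix.of fun i j => (u i * u j).trace) =
      (Matrix.of fun i => ![u i 0 0, u i 0 1, u i 1 0, 0]) *
        !![2, 0, 0, 0; 0, 0, 1, 0; 0, 1, 0, 0; 0, 0, 0, 0] *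
        (Matrix.of fun i => ![u i 0 0, u i 0 1, u i 1 0, 0])ᵀ := by
    ext i j
    have hi := hu i
    have hj := hu j
    rw [trace_fin_two] at hi hj
    simp [Matrix.mul_apply, Fin.sum_univ_four, trace_fin_two, Fin.sum_univ_two]
    rw [eq_neg_of_add_eq_zero_right hi, eq_neg_of_add_eq_zero_right hj]
    ring
  rw [e, det_mul, det_mul, det_eq_zero_of_column_eq_zero 3, zero_mul, zero_mul]
  intro i
  rfl

theorem gram_ev (hG : IsGold f r) {u1 u2 u3 u4 : SL2 K} (h1 : u1.1.trace = 0)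
    (h2 : u2.1.trace = 0) (h3 : u3.1.trace = 0) (h4 : u4.1.trace = 0) {a q e d k g : GoldInt}
    (ha : a.ev f r = (u1 * u2).1.trace) (hq : q.ev f r = (u1 * u3).1.trace)
    (he : e.ev f r = (u1 * u4).1.trace) (hd : d.ev f r = (u2 * u3).1.trace)
    (hk : k.ev f r = (u2 * u4).1.trace) (hg : g.ev f r = (u3 * u4).1.trace) :
    (GoldInt.gram a q e d k g).ev f r = 0 := by
  have h := det_gram_eq_zero ![u1.1, u2.1, u3.1, u4.1]
    (by intro i; fin_cases i <;> simpa)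
  have hs : ∀ u : SL2 K, u.1.trace = 0 → (u.1 * u.1).trace = -2 := fun u hu => by
    rw [M2.trace_mul_self hu, u.2, mul_one]
  simp only [Matrix.SpecialLinearGroup.coe_mul] at *
  rw [det_succ_row_zero] at h
  simp [Fin.sum_univ_succ, det_fin_three, Fin.succAbove, hs, h1, h2, h3, h4, ← ha, ← hq, ← he,
    ← hd, ← hk, ← hg, trace_mul_comm u2.1 u1.1, trace_mul_comm u3.1 u1.1, trace_mul_comm u4.1 u1.1,
    trace_mul_comm u3.1 u2.1, trace_mul_comm u4.1 u2.1, trace_mul_comm u4.1 u3.1] at h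
  have e16 : ev f r ⟨16, 0, 0, 0⟩ = 16 := by simp [ev]
  have e4 : ev f r ⟨4, 0, 0, 0⟩ = 4 := by simp [ev]
  have e2 : ev f r ⟨2, 0, 0, 0⟩ = 2 := by simp [ev]
  simp only [GoldInt.gram, ev_add, ev_sub, GoldInt.ev_mul hG.golden hG.sqrt, e16, e4, e2]
  linear_combination h

namespace GoldInt

theorem labels_distinct : (labels.all fun a => labels.all fun b => eqb a b || smooth (sub a b)) =
    true := by
  decide +kernel

theorem triple_check : (labels.all fun a => labels.all fun b => labels.all fun d =>
    smooth (triple a b d) || isZero (triple a b d) ||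
      !(excOk labels4 a b d || excOk labels5 a b d)) = true := by
  decide +kernel

end GoldInt

end FourInvolutions

section FourInvolutionsArgument

open Matrix GoldInt

variable {K : Type*} [Field K] {f r : K}

theorem SL2.trace_mul_comm (g h : SL2 K) : (g * h).1.trace = (h * g).1.trace := by
  rw [Matrix.SpecialLinearGroup.coe_mul, Matrix.SpecialLinearGroup.coe_mul, Matrix.trace_mul_comm]

theorem SL2.trace_sandwich_mul {u w : SL2 K} (z : SL2 K) (hu : u.1.trace = 0)
    (hw : w.1.trace = 0) :
    (u * w * u * z).1.trace = (u * w).1.trace * (u * z).1.trace + (w * z).1.trace := by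
  rw [Matrix.SpecialLinearGroup.coe_mul, SL2.sandwich hu hw, add_mul, smul_mul_assoc, trace_add,
    trace_smul, smul_eq_mul, Matrix.SpecialLinearGroup.coe_mul u z,
    Matrix.SpecialLinearGroup.coe_mul w z]

theorem eq_of_ev_eq (hG : IsGold f r) {a b : GoldInt} (ha : a ∈ labels) (hb : b ∈ labels)
    (h : a.ev f r = b.ev f r) : a = b := by
  have := List.all_eq_true.mp (List.all_eq_true.mp labels_distinct a ha) b hb
  rw [hG.not_smooth (by rw [ev_sub, h, sub_self]), Bool.or_false] at this
  exact eq_of_eqb this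

theorem isZero_of_ev_eq_zero (hG : IsGold f r) {a : GoldInt} (ha : a ∈ labels)
    (h : a.ev f r = 0) : isZero a = true := by
  rw [eq_of_ev_eq hG ha (b := ⟨0, 0, 0, 0⟩) (by simp [labels, labels4]) (by rw [h]; simp [ev])]
  rfl

theorem ev_eq_zero_of_isZero {a : GoldInt} (h : isZero a = true) : a.ev f r = 0 := by
  rw [eq_of_eqb h]
  simp [ev]

/-- Involutions `u i` and groups `M i`, each containing precisely the other three involutions. -/
structure Quad (u : Fin 4 → SL2 K) (M : Fin 4 → Subgroup (SL2 K)) : Prop where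
  trace : ∀ i, (u i).1.trace = 0
  mem : ∀ i j, i ≠ j → u j ∈ M i
  not_mem : ∀ i, u i ∉ M i
  neg_one : ∀ i, -1 ∈ M i
  red_or_exc : ∀ i, Red (M i) ∨ Exc (M i)
  irred : ∀ i, Exc (M i) → ∀ v : M2 K, v ≠ 0 → v.trace = 0 → (∀ j ≠ i, u j ∈ fixer v) → False

namespace Quad

variable {u : Fin 4 → SL2 K} {M : Fin 4 → Subgroup (SL2 K)}

theorem of_sign (h : Quad u M) {w : Fin 4 → SL2 K} (hw : ∀ i, w i = u i ∨ w i = -u i) :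
    Quad w M where
  trace i := by
    rcases hw i with e | e <;> rw [e]
    · exact h.trace i
    · simp [h.trace i]
  mem i j hij := by
    rcases hw j with e | e <;> rw [e]
    · exact h.mem i j hij
    · exact Frame.neg_mem_of (h.neg_one i) (h.mem i j hij)
  not_mem i hi := by
    rcases hw i with e | e <;> rw [e] at hi
    · exact h.not_mem i hi
    · exact h.not_mem i (by simpa using Frame.neg_mem_of (h.neg_one i) hi)
  neg_one := h.neg_one
  red_or_exc := h.red_or_exc
  irred i hi v hv0 hv hf := by
    refine h.irred i hi v hv0 hv fun j hj => ?_
    have := hf j hj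
    rcases hw j with e | e <;> rw [e] at this
    · exact this
    · simpa using Frame.neg_mem_of (neg_one_mem_fixer v) this

theorem reindex (h : Quad u M) (σ : Equiv.Perm (Fin 4)) : Quad (u ∘ σ) (M ∘ σ) where
  trace i := h.trace _
  mem i j hij := h.mem _ _ (σ.injective.ne hij)
  not_mem i := h.not_mem _
  neg_one i := h.neg_one _
  red_or_exc i := h.red_or_exc _
  irred i hi v hv0 hv hf := h.irred _ hi v hv0 hv fun j hj => by
    have := hf (σ.symm j) (by rintro rfl; simp at hj)
    simpa using this

theorem not_commute (hG : IsGold f r) (h : Quad u M) {i j : Fin 4} (hij : i ≠ j) :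
    (u i).1 * (u j).1 ≠ (u j).1 * (u i).1 := by
  intro e
  rcases SL2.eq_or_eq_neg_of_commute hG.two_ne_zero (h.trace i) (h.trace j) e with e | e
  · exact h.not_mem j (e ▸ h.mem j i hij.symm)
  · exact h.not_mem j (e ▸ Frame.neg_mem_of (h.neg_one j) (h.mem j i hij.symm))

theorem mul_ne (h : Quad u M) {i j : Fin 4} (hij : i ≠ j) :
    u i * u j ≠ 1 ∧ u i * u j ≠ -1 := by
  have key : u i * u j ∉ M j := fun h' =>
    h.not_mem j (((M j).mul_mem_cancel_left (h.mem j i hij.symm)).mp h')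
  exact ⟨fun e => key (e ▸ (M j).one_mem), fun e => key (e ▸ h.neg_one j)⟩

theorem exists_label (hG : IsGold f r) (h : Quad u M) {m : Fin 4} (hm : Exc (M m)) {i j : Fin 4}
    (hij : i ≠ j) : ∃ x ∈ labels, x.ev f r = (u i * u j).1.trace := by
  obtain ⟨k, l, hki, hkj, hli, hlj, hkl, hm'⟩ : ∃ k l : Fin 4, k ≠ i ∧ k ≠ j ∧ l ≠ i ∧ l ≠ j ∧
      k ≠ l ∧ ∀ s, s = i ∨ s = j ∨ s = k ∨ s = l := by
    clear hm h; revert i j; decide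
  have exc : ∀ k, k ≠ i → k ≠ j → Exc (M k) → ∃ x ∈ labels, x.ev f r = (u i * u j).1.trace := by
    intro k hki hkj hk
    have hmem := (M k).mul_mem (h.mem k i hki) (h.mem k j hkj)
    rcases hk.labelled hG with hl | hl <;>
      obtain ⟨x, hx, e⟩ := hl _ hmem (h.mul_ne hij).1 (h.mul_ne hij).2
    · exact ⟨x, List.mem_append_left _ hx, e⟩
    · exact ⟨x, (by simp [labels, labels4, labels5] : ∀ y ∈ labels5, y ∈ labels) x hx, e⟩
  rcases h.red_or_exc k with ⟨v, hv0, hv, hk⟩ | hk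
  swap
  · exact exc k hki hkj hk
  rcases h.red_or_exc l with ⟨v', hv0', hv', hl⟩ | hl
  swap
  · exact exc l hli hlj hl
  refine ⟨⟨0, 0, 0, 0⟩, by simp [labels, labels4], ?_⟩
  rw [trace_mul_eq_zero_of_two_lines hG.two_ne_zero (h.trace i) (h.trace j) (h.not_commute hG hij)
    hv hv' hv0 hv0' ?_ (hk (h.mem k i hki)) (hk (h.mem k j hkj)) (hl (h.mem l i hli))
    (hl (h.mem l j hlj))]
  · simp [ev]
  · intro e
    refine h.irred m hm v hv0 hv fun s _ => ?_
    by_cases hs : s = k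
    · subst hs
      exact mem_fixer_congr hG.two_ne_zero hv' hv hv0' e.symm (hl (h.mem l s hkl.symm))
    · exact hk (h.mem k s (Ne.symm hs))

/-- The involutions other than `u m` are `u i`, `u j`, `u k`, with the given pairwise traces. -/
structure Triangle (f r : K) (u : Fin 4 → SL2 K) (m i j k : Fin 4) (a b d : GoldInt) : Prop where
  ne_left : m ≠ i
  ne_mid : m ≠ j
  ne_right : m ≠ k
  left_mid : i ≠ j
  left_right : i ≠ k
  mid_right : j ≠ k
  cases : ∀ l, l ≠ m → l = i ∨ l = j ∨ l = k
  mem_a : a ∈ labels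
  mem_b : b ∈ labels
  mem_d : d ∈ labels
  ev_a : a.ev f r = (u i * u j).1.trace
  ev_b : b.ev f r = (u i * u k).1.trace
  ev_d : d.ev f r = (u j * u k).1.trace

variable {m i j k : Fin 4} {a b d : GoldInt}

theorem ev_triple (hG : IsGold f r) (h : Quad u M) (hT : Triangle f r u m i j k a b d) :
    (triple a b d).ev f r = (u i * u j * u k).1.trace ^ 2 := by
  rw [SL2.trace_triple_sq hG.two_ne_zero (h.trace i) (h.trace j) (h.trace k), ← hT.ev_a, ← hT.ev_b,
    ← hT.ev_d]
  have e4 : ev f r ⟨4, 0, 0, 0⟩ = 4 := by simp [ev]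
  simp only [triple, ev_sub, GoldInt.ev_mul hG.golden hG.sqrt, e4]
  ring

theorem excOk_of_labelled (hG : IsGold f r) (h : Quad u M) (hT : Triangle f r u m i j k a b d)
    {l : List GoldInt} (hl : ∀ x ∈ l, x ∈ labels) (hM : Labelled f r l (M m)) :
    excOk l a b d = true := by
  have hi := h.mem m i hT.ne_left
  have hj := h.mem m j hT.ne_mid
  have hk := h.mem m k hT.ne_right
  have ti := h.trace i
  have tj := h.trace j
  have tk := h.trace k
  have mem : ∀ {x : GoldInt} {s t : Fin 4}, x ∈ labels → s ≠ t → u s ∈ M m → u t ∈ M m →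
      x.ev f r = (u s * u t).1.trace → GoldInt.memb l x = true := by
    intro x s t hx hst hs ht e
    obtain ⟨y, hy, e'⟩ := hM _ ((M m).mul_mem hs ht) (h.mul_ne hst).1 (h.mul_ne hst).2
    rw [eq_of_ev_eq hG hx (hl y hy) (e.trans e'.symm), GoldInt.memb, List.any_eq_true]
    exact ⟨y, hy, by simp [eqb]⟩
  have word : ∀ y ∈ M m, ∃ x ∈ l ++ pm2, x.ev f r = y.1.trace := by
    intro y hy
    by_cases h1 : y = 1
    · exact ⟨⟨2, 0, 0, 0⟩, by simp [pm2], by simp [h1, ev]⟩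
    by_cases h1' : y = -1
    · exact ⟨⟨-2, 0, 0, 0⟩, by simp [pm2], by simp [h1', ev]⟩
    obtain ⟨x, hx, e⟩ := hM y hy h1 h1'
    exact ⟨x, List.mem_append_left _ hx, e⟩
  have ea := hT.ev_a
  have eb := hT.ev_b
  have ed := hT.ev_d
  simp only [excOk, triOk, Bool.and_eq_true]
  refine ⟨⟨⟨mem hT.mem_a hT.left_mid hi hj hT.ev_a, mem hT.mem_b hT.left_right hi hk hT.ev_b⟩,
    mem hT.mem_d hT.mid_right hj hk hT.ev_d⟩, ⟨⟨?_, ?_⟩, ?_⟩, ?_⟩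
  · obtain ⟨x, hx, e⟩ := word _ ((M m).mul_mem ((M m).mul_mem hi hj) hk)
    refine mayMem_of_ev_eq hG (x := mul x x) (List.mem_map_of_mem hx) ?_
    rw [h.ev_triple hG hT, GoldInt.ev_mul hG.golden hG.sqrt, e, sq]
  · obtain ⟨x, hx, e⟩ := word _ ((M m).mul_mem ((M m).mul_mem ((M m).mul_mem hi hj) hi) hk)
    refine mayMem_of_ev_eq hG hx ?_
    rw [e, SL2.trace_sandwich_mul _ ti tj, ev_add, GoldInt.ev_mul hG.golden hG.sqrt, ea, eb, ed]
  · obtain ⟨x, hx, e⟩ := word _ ((M m).mul_mem ((M m).mul_mem ((M m).mul_mem hj hi) hj) hk)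
    refine mayMem_of_ev_eq hG hx ?_
    rw [e, SL2.trace_sandwich_mul _ tj ti, ev_add, GoldInt.ev_mul hG.golden hG.sqrt, ea, eb, ed,
      SL2.trace_mul_comm (u j) (u i)]
  · obtain ⟨x, hx, e⟩ := word _ ((M m).mul_mem ((M m).mul_mem ((M m).mul_mem hk hi) hk) hj)
    refine mayMem_of_ev_eq hG hx ?_
    rw [e, SL2.trace_sandwich_mul _ tk ti, ev_add, GoldInt.ev_mul hG.golden hG.sqrt, ea, eb, ed,
      SL2.trace_mul_comm (u k) (u i), SL2.trace_mul_comm (u k) (u j)]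

theorem excOk (hG : IsGold f r) (h : Quad u M) (hT : Triangle f r u m i j k a b d)
    (hm : Exc (M m)) : (GoldInt.excOk labels4 a b d || GoldInt.excOk labels5 a b d) = true := by
  rw [Bool.or_eq_true]
  exact (hm.labelled hG).imp
    (h.excOk_of_labelled hG hT (by simp [labels, labels4, labels5]))
    (h.excOk_of_labelled hG hT (by simp [labels, labels4, labels5]))

theorem exc (hG : IsGold f r) (h : Quad u M) (hT : Triangle f r u m i j k a b d)
    (hm : Exc (M m)) : GoldInt.exc a b d = true := by
  have irr : ∀ v : M2 K, v ≠ 0 → v.trace = 0 → u i ∈ fixer v → u j ∈ fixer v → u k ∈ fixer v →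
      False := by
    intro v hv0 hv hi hj hk
    refine h.irred m hm v hv0 hv fun l hl => ?_
    rcases hT.cases l hl with rfl | rfl | rfl <;> assumption
  have self : ∀ s, u s ∈ fixer (u s).1 := fun s => mem_fixer_of_commute rfl
  have orth : ∀ {x : GoldInt} {s t : Fin 4}, x.ev f r = (u s * u t).1.trace → isZero x = true →
      u s ∈ fixer (u t).1 := fun e hx =>
    mem_fixer_of_orthogonal (h.trace _) (h.trace _) (by
      rw [← Matrix.SpecialLinearGroup.coe_mul, ← e, ev_eq_zero_of_isZero hx])
  have ea := hT.ev_a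
  have eb := hT.ev_b
  have ed := hT.ev_d
  have ok := h.excOk hG hT hm
  simp only [GoldInt.exc, Bool.and_eq_true, Bool.not_eq_true']
  refine ⟨⟨?_, ?_⟩, ok⟩
  · by_contra hz
    simp only [twoZero, Bool.not_eq_false, Bool.or_eq_true, Bool.and_eq_true] at hz
    rcases hz with (⟨h1, h2⟩ | ⟨h1, h2⟩) | ⟨h1, h2⟩
    · exact irr _ (u i).ne_zero (h.trace i) (self i) (orth (ea.trans (SL2.trace_mul_comm _ _)) h1)
        (orth (eb.trans (SL2.trace_mul_comm _ _)) h2)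
    · exact irr _ (u j).ne_zero (h.trace j) (orth ea h1) (self j)
        (orth (ed.trans (SL2.trace_mul_comm _ _)) h2)
    · exact irr _ (u k).ne_zero (h.trace k) (orth eb h1) (orth ed h2) (self k)
  · have := List.all_eq_true.mp (List.all_eq_true.mp (List.all_eq_true.mp triple_check a hT.mem_a)
      b hT.mem_b) d hT.mem_d
    rw [ok, Bool.not_true, Bool.or_false, Bool.or_eq_true] at this
    refine this.resolve_right fun hz => ?_
    have h0 : (u i * u j * u k).1.trace = 0 := by
      apply pow_eq_zero_iff two_ne_zero |>.mp
      rw [← h.ev_triple hG hT, ev_eq_zero_of_isZero hz]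
    have e := SL2.trace_triple_commutator (h.trace i) (h.trace j) (h.trace k)
    simp only [Matrix.SpecialLinearGroup.coe_mul] at h0
    rw [h0, mul_zero] at e
    exact irr _ (sub_ne_zero.mpr (h.not_commute hG hT.mid_right)) (trace_commutator _ _)
      (mem_fixer_of_orthogonal (trace_commutator _ _) (h.trace i) e)
      (mem_fixer_of_orthogonal (trace_commutator _ _) (h.trace j) trace_mul_commutator)
      (mem_fixer_of_orthogonal (trace_commutator _ _) (h.trace k) trace_mul_commutator')

theorem legal (hG : IsGold f r) (h : Quad u M) (hT : Triangle f r u m i j k a b d) :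
    GoldInt.legal a b d = true := by
  rcases h.red_or_exc m with ⟨v, hv0, hv, hle⟩ | hm
  swap
  · have := h.excOk hG hT hm
    rw [GoldInt.legal, Bool.or_assoc, this, Bool.or_true]
  have hG2 := hG.two_ne_zero
  have fix : ∀ s, m ≠ s → (u s).1 * v = v * (u s).1 ∨ ((u s).1 * v).trace = 0 := fun s hs =>
    (fixer_of_trace_eq_zero (h.trace s) hv).mp (hle (h.mem m s hs))
  have zero : ∀ {s t : Fin 4} {x : GoldInt}, m ≠ t → s ≠ t → (u s).1 * v = v * (u s).1 →
      x ∈ labels → x.ev f r = (u s * u t).1.trace → isZero x = true := by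
    intro s t x hmt hst hs hx e
    refine isZero_of_ev_eq_zero hG hx ?_
    rcases fix t hmt with ht | ht
    · exact (h.not_commute hG hst
        (M2.mul_comm_of_mul_comm hv (h.trace s) hG2 hv0 hs.symm ht.symm)).elim
    · obtain ⟨c, hc⟩ := M2.exists_smul_of_commute hv (h.trace s) hG2 hv0 hs.symm
      rw [e, Matrix.SpecialLinearGroup.coe_mul, hc, smul_mul_assoc, trace_smul,
        Matrix.trace_mul_comm, ht, smul_zero]
  have ea := hT.ev_a
  have eb := hT.ev_b
  have ed := hT.ev_d
  rw [SL2.trace_mul_comm] at ea eb ed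
  rcases fix i hT.ne_left with hi | hi
  · simp [GoldInt.legal, twoZero, zero hT.ne_mid hT.left_mid hi hT.mem_a hT.ev_a,
      zero hT.ne_right hT.left_right hi hT.mem_b hT.ev_b]
  rcases fix j hT.ne_mid with hj | hj
  · simp [GoldInt.legal, twoZero, zero hT.ne_left hT.left_mid.symm hj hT.mem_a ea,
      zero hT.ne_right hT.mid_right hj hT.mem_d hT.ev_d]
  rcases fix k hT.ne_right with hk | hk
  · simp [GoldInt.legal, twoZero, zero hT.ne_left hT.left_right.symm hk hT.mem_b eb,
      zero hT.ne_mid hT.mid_right.symm hk hT.mem_d ed]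
  · have h0 := trace_triple_eq_zero hG2 (h.trace i) (h.trace j) (h.trace k) hv hv0 hi hj hk
    have := hG.not_smooth (x := triple a b d) (by rw [h.ev_triple hG hT, h0]; simp)
    simp [GoldInt.legal, this]

end Quad

theorem mem_of_reach (hG : IsGold f r) {N : Subgroup (SL2 K)} (hN : -1 ∈ N) {u v w : SL2 K}
    (hu : u ∈ N) (hv : v ∈ N) (hw : w ∈ N) (tu : u.1.trace = 0) (tv : v.1.trace = 0)
    (tw : w.1.trace = 0)
    (irr : ∀ z : M2 K, z ≠ 0 → z.trace = 0 → u ∈ fixer z → v ∈ fixer z → w ∈ fixer z → False)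
    {a b d : GoldInt} (ha : a.ev f r = (u * v).1.trace) (hb : b.ev f r = (u * w).1.trace)
    (hd : d.ev f r = (v * w).1.trace) (n : ℕ) :
    ∀ (x : SL2 K) (t : GoldInt × GoldInt × GoldInt), x.1.trace = 0 →
      t.1.ev f r = (u * x).1.trace → t.2.1.ev f r = (v * x).1.trace →
      t.2.2.ev f r = (w * x).1.trace → reach a b d n t = true → x ∈ N := by
  have self : ∀ g : SL2 K, g.1.trace = 0 → (g * g).1.trace = -2 := fun g hg => by
    rw [SL2.mul_self_of_trace hg]
    simp
  have eqn : ∀ x y : SL2 K, x.1.trace = 0 → y.1.trace = 0 → (u * x).1.trace = (u * y).1.trace →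
      (v * x).1.trace = (v * y).1.trace → (w * x).1.trace = (w * y).1.trace → x = y := by
    intro x y tx ty h1 h2 h3
    by_contra hne
    simp only [Matrix.SpecialLinearGroup.coe_mul] at h1 h2 h3
    have tz : (x.1 - y.1).trace = 0 := by rw [trace_sub, tx, ty, sub_zero]
    have hz : x.1 - y.1 ≠ 0 := sub_ne_zero.mpr fun e => hne (Subtype.ext e)
    exact irr _ hz tz (mem_fixer_of_orthogonal tz tu (by rw [mul_sub, trace_sub, h1, sub_self]))
      (mem_fixer_of_orthogonal tz tv (by rw [mul_sub, trace_sub, h2, sub_self]))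
      (mem_fixer_of_orthogonal tz tw (by rw [mul_sub, trace_sub, h3, sub_self]))
  have sign : ∀ (x y : SL2 K) (t s : GoldInt × GoldInt × GoldInt), y ∈ N → x.1.trace = 0 →
      y.1.trace = 0 → t.1.ev f r = (u * x).1.trace → t.2.1.ev f r = (v * x).1.trace →
      t.2.2.ev f r = (w * x).1.trace → s.1.ev f r = (u * y).1.trace →
      s.2.1.ev f r = (v * y).1.trace → s.2.2.ev f r = (w * y).1.trace →
      eqUpToSign t s = true → x ∈ N := by
    intro x y t s hy tx ty h1 h2 h3 h4 h5 h6 h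
    simp only [eqUpToSign, Bool.or_eq_true, Bool.and_eq_true] at h
    rcases h with ⟨⟨e1, e2⟩, e3⟩ | ⟨⟨e1, e2⟩, e3⟩
    · rw [eq_of_eqb e1] at h1
      rw [eq_of_eqb e2] at h2
      rw [eq_of_eqb e3] at h3
      exact eqn x y tx ty (h1.symm.trans h4) (h2.symm.trans h5) (h3.symm.trans h6) ▸ hy
    · rw [eq_of_eqb e1, ev_neg] at h1
      rw [eq_of_eqb e2, ev_neg] at h2
      rw [eq_of_eqb e3, ev_neg] at h3
      have neg : ∀ g : SL2 K, (g * -y).1.trace = -(g * y).1.trace := fun g => by simp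
      rw [eqn x (-y) tx (by simp [ty]) (by rw [neg, ← h4, h1]) (by rw [neg, ← h5, h2])
        (by rw [neg, ← h6, h3])]
      exact Frame.neg_mem_of hN hy
  have base : ∀ (x : SL2 K) (t : GoldInt × GoldInt × GoldInt), x.1.trace = 0 →
      t.1.ev f r = (u * x).1.trace → t.2.1.ev f r = (v * x).1.trace →
      t.2.2.ev f r = (w * x).1.trace → reach a b d 0 t = true → x ∈ N := by
    intro x t tx h1 h2 h3 h
    have em : ev f r ⟨-2, 0, 0, 0⟩ = -2 := by simp [ev]
    simp only [reach, Bool.or_eq_true] at h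
    rcases h with (h | h) | h
    · exact sign x u t _ hu tx tu h1 h2 h3 (by rw [self u tu, em])
        (by rw [ha, SL2.trace_mul_comm]) (by rw [hb, SL2.trace_mul_comm]) h
    · exact sign x v t _ hv tx tv h1 h2 h3 ha (by rw [self v tv, em])
        (by rw [hd, SL2.trace_mul_comm]) h
    · exact sign x w t _ hw tx tw h1 h2 h3 hb hd (by rw [self w tw, em]) h
  have conj : ∀ (g x : SL2 K), g.1.trace = 0 → x.1.trace = 0 → (g * x * g).1.trace = 0 ∧
      (∀ y, (y * (g * x * g)).1.trace = (g * x).1.trace * (y * g).1.trace + (y * x).1.trace) ∧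
      (g ∈ N → g * x * g ∈ N → x ∈ N) := by
    intro g x tg tx
    refine ⟨by rw [SL2.sandwich tg tx, trace_add, trace_smul, tg, tx]; simp, fun y => ?_,
      fun hg h => ?_⟩
    · rw [SL2.trace_mul_comm, SL2.trace_sandwich_mul y tg tx, SL2.trace_mul_comm g y,
        SL2.trace_mul_comm x y]
    · exact (N.mul_mem_cancel_left hg).mp ((N.mul_mem_cancel_right hg).mp h)
  induction n with
  | zero => exact base
  | succ n ih =>
    intro x t tx h1 h2 h3 h
    simp only [reach, Bool.or_eq_true, Bool.and_eq_true] at h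
    have em := GoldInt.ev_mul hG.golden hG.sqrt
    rcases h with ((h | ⟨-, h⟩) | ⟨-, h⟩) | ⟨-, h⟩
    · exact base x t tx h1 h2 h3 (by simpa only [reach, Bool.or_eq_true] using h)
    · obtain ⟨c1, c2, c3⟩ := conj u x tu tx
      refine c3 hu (ih (u * x * u) _ c1 ?_ ?_ ?_ h)
      · rw [c2, self u tu, ev_neg, h1]; ring
      · rw [c2, ev_add, em, h1, ha, h2, SL2.trace_mul_comm v u]
      · rw [c2, ev_add, em, h1, hb, h3, SL2.trace_mul_comm w u]
    · obtain ⟨c1, c2, c3⟩ := conj v x tv tx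
      refine c3 hv (ih (v * x * v) _ c1 ?_ ?_ ?_ h)
      · rw [c2, ev_add, em, h2, ha, h1]
      · rw [c2, self v tv, ev_neg, h2]; ring
      · rw [c2, ev_add, em, h2, hd, h3, SL2.trace_mul_comm w v]
    · obtain ⟨c1, c2, c3⟩ := conj w x tw tx
      refine c3 hw (ih (w * x * w) _ c1 ?_ ?_ ?_ h)
      · rw [c2, ev_add, em, h3, hb, h1]
      · rw [c2, ev_add, em, h3, hd, h2]
      · rw [c2, self w tw, ev_neg, h3]; ring

namespace Quad

variable {u : Fin 4 → SL2 K} {M : Fin 4 → Subgroup (SL2 K)}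

theorem false_of_posLabels (hG : IsGold f r) (h : Quad u M) (h1 : Exc (M 1)) (h3 : Exc (M 3))
    {q d g : GoldInt} (hq : q ∈ posLabels) (hd : d ∈ posLabels) (hg : g ∈ posLabels)
    (eq : q.ev f r = (u 0 * u 2).1.trace) (ed : d.ev f r = (u 2 * u 1).1.trace)
    (eg : g.ev f r = (u 2 * u 3).1.trace) : False := by
  have pos : ∀ x ∈ posLabels, x ∈ labels := by simp [posLabels, labels, labels4, labels5]
  obtain ⟨a, ha, ea⟩ := h.exists_label hG h3 (i := 0) (j := 1) (by decide)
  obtain ⟨e, he, ee⟩ := h.exists_label hG h3 (i := 0) (j := 3) (by decide)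
  obtain ⟨k, hk, ek⟩ := h.exists_label hG h3 (i := 1) (j := 3) (by decide)
  have exc3 : GoldInt.exc q a d = true := h.exc hG (m := 3) (i := 0) (j := 2) (k := 1)
    ⟨by decide, by decide, by decide, by decide, by decide, by decide, by decide,
      pos q hq, ha, pos d hd, eq, ea, ed⟩ h3
  have exc1 : GoldInt.exc q e g = true := h.exc hG (m := 1) (i := 0) (j := 2) (k := 3)
    ⟨by decide, by decide, by decide, by decide, by decide, by decide, by decide,
      pos q hq, he, pos g hg, eq, ee, eg⟩ h1
  have leg2 : GoldInt.legal a e k = true := h.legal hG (m := 2) (i := 0) (j := 1) (k := 3)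
    ⟨by decide, by decide, by decide, by decide, by decide, by decide, by decide,
      ha, he, hk, ea, ee, ek⟩
  have leg0 : GoldInt.legal d g k = true := h.legal hG (m := 0) (i := 2) (j := 1) (k := 3)
    ⟨by decide, by decide, by decide, by decide, by decide, by decide, by decide,
      pos d hd, pos g hg, hk, ed, eg, ek⟩
  have ed' := ed.trans (SL2.trace_mul_comm _ _)
  have eg' := eg.trans (SL2.trace_mul_comm _ _)
  have ek' := ek.trans (SL2.trace_mul_comm _ _)
  have hgram : smooth (gram a q e d k g) = false :=
    hG.not_smooth (gram_ev hG (h.trace 0) (h.trace 1) (h.trace 2) (h.trace 3) ea eq ee ed' ek eg)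
  have irr : ∀ m i j k : Fin 4, (∀ l, l ≠ m → l = i ∨ l = j ∨ l = k) → Exc (M m) →
      ∀ z : M2 K, z ≠ 0 → z.trace = 0 → u i ∈ fixer z → u j ∈ fixer z → u k ∈ fixer z → False := by
    intro m i j k hc hm z hz0 hz hi hj hk
    refine h.irred m hm z hz0 hz fun l hl => ?_
    rcases hc l hl with rfl | rfl | rfl <;> assumption
  have reach3 : ∀ n, reach a q d n (e, k, g) = true → False := fun n hn =>
    h.not_mem 3 (mem_of_reach hG (h.neg_one 3) (h.mem 3 0 (by decide)) (h.mem 3 1 (by decide))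
      (h.mem 3 2 (by decide)) (h.trace 0) (h.trace 1) (h.trace 2)
      (irr 3 0 1 2 (by decide) h3) ea eq ed' n (u 3) (e, k, g) (h.trace 3) ee ek eg hn)
  have reach1 : ∀ n, reach e q g n (a, k, d) = true → False := fun n hn =>
    h.not_mem 1 (mem_of_reach hG (h.neg_one 1) (h.mem 1 0 (by decide)) (h.mem 1 3 (by decide))
      (h.mem 1 2 (by decide)) (h.trace 0) (h.trace 3) (h.trace 2)
      (irr 1 0 3 2 (by decide) h1) ee eq eg' n (u 1) (a, k, d) (h.trace 1) ea ek' ed hn)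
  have c := List.all_eq_true.mp (List.all_eq_true.mp (List.all_eq_true.mp
    four_involutions_check q hq) a ha) d hd
  rw [exc3, Bool.not_true, Bool.false_or] at c
  have c := List.all_eq_true.mp (List.all_eq_true.mp c e he) g hg
  rw [exc1, Bool.not_true, Bool.false_or] at c
  have c := List.all_eq_true.mp c k hk
  rw [leg2, leg0, hgram] at c
  simp only [Bool.not_true, Bool.false_or, Bool.or_eq_true] at c
  obtain ((((((((h | h) | h) | h) | h) | h) | h) | h) | h) | h := c
  all_goals first | exact reach3 _ h | exact reach1 _ h

theorem false_of_exc_one_three (hG : IsGold f r) (h : Quad u M) (h1 : Exc (M 1))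
    (h3 : Exc (M 3)) : False := by
  have sgn : ∀ x ∈ labels, ∃ y ∈ posLabels, x = y ∨ x = neg y := by
    simp [posLabels, labels, labels4, labels5, GoldInt.neg]
  have key : ∀ i, ∃ w y, (w = u i ∨ w = -u i) ∧ (i = 2 → w = u 2) ∧
      (i ≠ 2 → y ∈ posLabels ∧ y.ev f r = (u 2 * w).1.trace) := by
    intro i
    by_cases hi : i = 2
    · exact ⟨u i, ⟨0, 0, 0, 0⟩, Or.inl rfl, fun e => e ▸ rfl, fun e => (e hi).elim⟩
    obtain ⟨x, hx, ex⟩ := h.exists_label hG h3 (Ne.symm hi)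
    obtain ⟨y, hy, e | e⟩ := sgn x hx
    · exact ⟨u i, y, Or.inl rfl, fun e => (hi e).elim, fun _ => ⟨hy, by rw [← ex, e]⟩⟩
    · refine ⟨-u i, y, Or.inr rfl, fun e => (hi e).elim, fun _ => ⟨hy, ?_⟩⟩
      rw [e, ev_neg] at ex
      simp only [Matrix.SpecialLinearGroup.coe_mul, Matrix.SpecialLinearGroup.coe_neg, mul_neg,
        trace_neg] at ex ⊢
      rw [← ex, neg_neg]
  choose w y hw hw2 hy using key
  have e2 := hw2 2 rfl
  refine (h.of_sign hw).false_of_posLabels hG h1 h3 (hy 0 (by decide)).1 (hy 1 (by decide)).1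
    (hy 3 (by decide)).1 ?_ ?_ ?_
  · rw [e2, SL2.trace_mul_comm, (hy 0 (by decide)).2]
  · rw [e2, (hy 1 (by decide)).2]
  · rw [e2, (hy 3 (by decide)).2]

protected theorem false (hG : IsGold f r) (h : Quad u M) {a b : Fin 4} (hab : a ≠ b)
    (ha : Exc (M a)) (hb : Exc (M b)) : False := by
  obtain ⟨σ, rfl, rfl⟩ : ∃ σ : Equiv.Perm (Fin 4), σ 1 = a ∧ σ 3 = b := by
    clear h ha hb
    revert a b
    decide
  exact (h.reindex σ).false_of_exc_one_three hG ha hb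

end Quad

end FourInvolutionsArgument

section FourElements

open Matrix GoldInt

variable {K : Type*} [Field K] {f r : K}

theorem Exc.finite {H : Subgroup (SL2 K)} (hH : Exc H) : Finite H :=
  Nat.finite_of_card_ne_zero (by rcases hH.card with h | h | h <;> omega)

theorem Exc.of_le [IsAlgClosed K] (h2 : (2 : K) ≠ 0) {D H : Subgroup (SL2 K)} (hH : Exc H)
    (hle : D ≤ H) (hm : -1 ∈ D) (hD : ¬Red D) : Exc D := by
  have := hH.finite
  have : Finite D := Finite.of_injective _ (Subgroup.inclusion_injective hle)
  exact (dickson h2 D hm fun h hh => hH.semisimple h (hle hh)).resolve_left hD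

theorem Exc.card_of_lt {D H : Subgroup (SL2 K)} (hD : Exc D) (hH : Exc H) (hlt : D < H) :
    Nat.card D = 24 := by
  have := hH.finite
  have hdvd := Subgroup.card_dvd_of_le hlt.le
  have hne : Nat.card D ≠ Nat.card H := fun e =>
    hlt.ne (Subgroup.eq_of_le_of_card_ge hlt.le e.ge)
  rcases hD.card with h | h | h <;> rcases hH.card with h' | h' | h' <;>
    rw [h, h'] at hdvd hne <;> first | exact h | omega

theorem Exc.exists_trace_eq_one (hG : IsGold f r) {D : Subgroup (SL2 K)} (hD : Exc D) :
    ∃ x ∈ D, x.1.trace = 1 := by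
  have := hD.finite
  have : Fact (Nat.Prime 3) := ⟨Nat.prime_three⟩
  obtain ⟨⟨x, hx⟩, ho⟩ := exists_prime_orderOf_dvd_card' (G := D) 3
    (by rcases hD.card with h | h | h <;> rw [h] <;> decide)
  rw [Subgroup.orderOf_mk] at ho
  have h3 : x ^ 3 = 1 := ho ▸ pow_orderOf_eq_one x
  have h1 : x ≠ 1 := by rintro rfl; simp at ho
  have h1' : x ≠ -1 := by
    rintro rfl
    rw [Odd.neg_one_pow (by decide)] at h3
    exact SL2.neg_one_ne_one hG.two_ne_zero h3
  have := SL2.trace_of_pow_six hG.two_ne_zero h1 h1' (by rw [mul_comm, pow_mul, h3, one_pow])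
  rcases sq_eq_sq_iff_eq_or_eq_neg.mp (this.trans (one_pow 2).symm) with h | h
  · exact ⟨x, hx, h⟩
  · exact ⟨-x, Frame.neg_mem_of hD.neg_one_mem hx, by simp [h]⟩

/-- Elements `g i` and groups `M i`, each containing precisely the other three elements. -/
structure Four (g : Fin 4 → SL2 K) (M : Fin 4 → Subgroup (SL2 K)) : Prop where
  mem : ∀ i j, i ≠ j → g j ∈ M i
  not_mem : ∀ i, g i ∉ M i
  neg_one : ∀ i, -1 ∈ M i
  red_or_exc : ∀ i, Red (M i) ∨ Exc (M i)
  le_fixer : ∀ i v, (∀ j ≠ i, g j ∈ fixer v) → M i ≤ fixer v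
  irred : ∀ v : M2 K, v ≠ 0 → v.trace = 0 → (∀ j, g j ∈ fixer v) → False

namespace Four

variable {g : Fin 4 → SL2 K} {M : Fin 4 → Subgroup (SL2 K)}

theorem ne_one (h : Four g M) (i : Fin 4) : g i ≠ 1 := fun e => h.not_mem i (e ▸ (M i).one_mem)

theorem ne_neg_one (h : Four g M) (i : Fin 4) : g i ≠ -1 := fun e =>
  h.not_mem i (e ▸ h.neg_one i)

theorem exists_line (h : Four g M) {i : Fin 4} (hi : Red (M i)) :
    ∃ v : M2 K, v ≠ 0 ∧ v.trace = 0 ∧ ∀ j, g j ∈ fixer v ↔ j ≠ i := by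
  obtain ⟨v, hv0, hv, hle⟩ := hi
  refine ⟨v, hv0, hv, fun j => ⟨?_, fun hj => hle (h.mem i j hj.symm)⟩⟩
  rintro hj rfl
  refine h.irred v hv0 hv fun k => ?_
  by_cases hk : k = j
  · exact hk ▸ hj
  · exact hle (h.mem j k (Ne.symm hk))

theorem exists_lines (h : Four g M) {k : Fin 4} (hk : ∀ i ≠ k, Red (M i)) :
    ∃ v : Fin 4 → M2 K, (∀ i ≠ k, v i ≠ 0) ∧ (∀ i ≠ k, (v i).trace = 0) ∧
      ∀ i ≠ k, ∀ j, g j ∈ fixer (v i) ↔ j ≠ i := by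
  have : ∀ i, ∃ v : M2 K, i ≠ k → v ≠ 0 ∧ v.trace = 0 ∧ ∀ j, g j ∈ fixer v ↔ j ≠ i := by
    intro i
    by_cases hi : i = k
    · exact ⟨0, fun h => (h hi).elim⟩
    · obtain ⟨v, hv⟩ := h.exists_line (hk i hi)
      exact ⟨v, fun _ => hv⟩
  choose v hv using this
  exact ⟨v, fun i hi => (hv i hi).1, fun i hi => (hv i hi).2.1, fun i hi => (hv i hi).2.2⟩

theorem mem_fixer_axis (hG : IsGold f r) (h : Four g M) {s t i j : Fin 4} (hs : Red (M s))
    (ht : Semisimple (M t)) (his : i ≠ s) (hit : i ≠ t) (hjs : j ≠ s) (hjt : j ≠ t)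
    (hi : (g i).1.trace ≠ 0) : g j ∈ fixer (axis (g i).1) :=
  (hs.mono (inf_le_left : M s ⊓ M t ≤ M s)).mem_fixer_axis hG.two_ne_zero
    (fun x hx => ht x hx.2) ⟨h.mem s i his.symm, h.mem t i hit.symm⟩ hi
    ⟨h.mem s j hjs.symm, h.mem t j hjt.symm⟩

theorem axis_ne_zero (hG : IsGold f r) (h : Four g M) (i : Fin 4) : axis (g i).1 ≠ 0 := by
  rw [Ne, axis_eq_zero_iff hG.two_ne_zero]
  have := h.ne_one i
  have := h.ne_neg_one i
  tauto

theorem red_pair [IsAlgClosed K] (hG : IsGold f r) (h : Four g M) {k l : Fin 4} (hkl : k ≠ l) :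
    Red (Subgroup.closure {-1, g k, g l}) := by
  by_contra hD
  set D := Subgroup.closure {-1, g k, g l} with hDdef
  have h2 := hG.two_ne_zero
  have hD1 : -1 ∈ D := Subgroup.subset_closure (by simp)
  have hDk : g k ∈ D := Subgroup.subset_closure (by simp)
  have hDl : g l ∈ D := Subgroup.subset_closure (by simp)
  obtain ⟨m, n, hmk, hml, hnk, hnl, hmn, hall⟩ : ∃ m n : Fin 4, m ≠ k ∧ m ≠ l ∧ n ≠ k ∧ n ≠ l ∧
      m ≠ n ∧ ∀ s, s = k ∨ s = l ∨ s = m ∨ s = n := by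
    clear_value D
    clear hD hDk hDl hDdef
    revert k l
    decide
  have hle : ∀ s, s ≠ k → s ≠ l → D ≤ M s := fun s hsk hsl => by
    rw [hDdef, Subgroup.closure_le]
    rintro x (rfl | rfl | rfl)
    exacts [h.neg_one s, h.mem s k hsk, h.mem s l hsl]
  have hexc : ∀ s, s ≠ k → s ≠ l → Exc (M s) := fun s hsk hsl =>
    (h.red_or_exc s).resolve_left fun hr => hD (hr.mono (hle s hsk hsl))
  have hDe : Exc D := (hexc m hmk hml).of_le h2 (hle m hmk hml) hD1 hD
  have hmD : g m ∉ D := fun hx => h.not_mem m (hle m hmk hml hx)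
  have hnD : g n ∉ D := fun hx => h.not_mem n (hle n hnk hnl hx)
  have hcard : Nat.card D = 24 := hDe.card_of_lt (hexc m hmk hml)
    ((hle m hmk hml).lt_of_ne fun e => hnD (e ▸ h.mem m n hmn))
  obtain ⟨x, hx, hx1⟩ := hDe.exists_trace_eq_one hG
  obtain ⟨I, J, hF, hI, hJ, hxc⟩ := exists_frame hG hD1 hD (fun y hy hy1 hy1' => by
    have := hDe.trace y hy hy1 hy1'
    rw [hcard] at this
    exact this.imp_right Or.inl) hx hx1
  have hIn : hF.InGroup D := ⟨hD1, hI, hJ, x, hx, hxc⟩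
  rcases hIn.apart hDe hcard (hle m hmk hml) (hle n hnk hnl) (hexc m hmk hml) (hexc n hnk hnl)
    (h.mem m n hmn) hnD (h.mem n m hmn.symm) hmD with hl | ⟨htr, hQ⟩
  · exact h.not_mem n ((hl (M n) (hle n hnk hnl)).mpr (h.mem n m hmn.symm))
  have hk : Red (M k) := (h.red_or_exc k).resolve_right fun he =>
    hQ (M k) he (h.mem k n hnk.symm) (h.mem k m hmk.symm) (g l) hDl (h.mem k l hkl)
      (h.ne_one l) (h.ne_neg_one l)
  have hl : Red (M l) := (h.red_or_exc l).resolve_right fun he =>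
    hQ (M l) he (h.mem l n hnl.symm) (h.mem l m hml.symm) (g k) hDk (h.mem l k hkl.symm)
      (h.ne_one k) (h.ne_neg_one k)
  have htrace : ∀ s t, s ≠ k → s ≠ l → t ≠ k → t ≠ l → s ≠ t → (g s).1.trace = 0 := by
    intro s t hsk hsl htk htl hst
    by_contra h0
    refine hD ⟨axis (g s).1, h.axis_ne_zero hG s, trace_axis _, ?_⟩
    rw [hDdef, Subgroup.closure_le]
    rintro x (rfl | rfl | rfl)
    · exact neg_one_mem_fixer _
    · exact h.mem_fixer_axis hG hl (hexc t htk htl).semisimple hsl hst hkl htk.symm h0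
    · exact h.mem_fixer_axis hG hk (hexc t htk htl).semisimple hsk hst hkl.symm htl.symm h0
  have hm0 := htrace m n hmk hml hnk hnl hmn
  have hn0 := htrace n m hnk hnl hmk hml hmn.symm
  obtain ⟨v, hv0, hv, hvk⟩ := h.exists_line hk
  obtain ⟨v', hv0', hv', hvl⟩ := h.exists_line hl
  have hninv : (g m)⁻¹ = -g m := by
    rw [inv_eq_iff_mul_eq_one, mul_neg, SL2.mul_self_of_trace hm0, neg_neg]
  refine htr ?_
  rw [hninv, mul_neg, Matrix.SpecialLinearGroup.coe_neg, trace_neg, neg_eq_zero]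
  refine trace_mul_eq_zero_of_two_lines h2 hn0 hm0 ?_ hv hv' hv0 hv0' ?_ ((hvk n).2 hnk)
    ((hvk m).2 hmk) ((hvl n).2 hnl) ((hvl m).2 hml)
  · intro e
    rcases SL2.eq_or_eq_neg_of_commute h2 hn0 hm0 e with e | e
    · exact h.not_mem m (e ▸ h.mem m n hmn)
    · exact h.not_mem m (e ▸ Frame.neg_mem_of (h.neg_one m) (h.mem m n hmn))
  · intro e
    exact (hvl l).1 (mem_fixer_congr h2 hv hv' hv0 e ((hvk l).2 hkl.symm)) rfl

theorem trace_eq_zero [IsAlgClosed K] (hG : IsGold f r) (h : Four g M) (k : Fin 4) :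
    (g k).1.trace = 0 := by
  by_contra hk
  have hr : ∀ i ≠ k, Red (M i) := by
    intro i hi
    refine (h.red_or_exc i).resolve_right fun he => he.irred
      ⟨axis (g k).1, h.axis_ne_zero hG k, trace_axis _, h.le_fixer i _ fun j hj => ?_⟩
    by_cases hjk : j = k
    · exact hjk ▸ _root_.mem_fixer_axis _
    have hle : Subgroup.closure {-1, g k, g j} ≤ M i := by
      rw [Subgroup.closure_le]
      rintro x (rfl | rfl | rfl)
      exacts [h.neg_one i, h.mem i k hi, h.mem i j hj.symm]
    exact (h.red_pair hG (Ne.symm hjk)).mem_fixer_axis hG.two_ne_zero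
      (fun x hx => he.semisimple x (hle hx)) (Subgroup.subset_closure (by simp)) hk
      (Subgroup.subset_closure (by simp))
  obtain ⟨v, hv0, hv, hvi⟩ := h.exists_lines hr
  exact no_three_lines_of_trace_ne_zero hG.two_ne_zero hk (h.ne_one k) (h.ne_neg_one k) hv0 hv hvi

protected theorem false [IsAlgClosed K] (hG : IsGold f r) (h : Four g M) : False := by
  have ht := h.trace_eq_zero hG
  by_cases hr : ∃ k, ∀ i ≠ k, Red (M i)
  · obtain ⟨k, hk⟩ := hr
    obtain ⟨v, hv0, hv, hvi⟩ := h.exists_lines hk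
    exact no_three_lines_of_trace_eq_zero hG.two_ne_zero k ht hv0 hv hvi
  push Not at hr
  obtain ⟨a, -, ha⟩ := hr 0
  obtain ⟨b, hab, hb⟩ := hr a
  have hQ : Quad g M := ⟨ht, h.mem, h.not_mem, h.neg_one, h.red_or_exc,
    fun i hi v hv0 hv hf => hi.irred ⟨v, hv0, hv, h.le_fixer i v hf⟩⟩
  exact hQ.false hG hab.symm ((h.red_or_exc a).resolve_left ha) ((h.red_or_exc b).resolve_left hb)

end Four

end FourElements

section LengthBound

open Matrix

/-- The group generated by `-1` and the `g i` with `i ∈ S`. -/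
def genBy {F ι : Type*} [Field F] (g : ι → SL2 F) (S : Set ι) : Subgroup (SL2 F) :=
  Subgroup.closure (insert (-1) (g '' S))

namespace genBy

variable {F ι : Type*} [Field F] {g : ι → SL2 F} {S T : Set ι}

theorem le_iff {H : Subgroup (SL2 F)} : genBy g S ≤ H ↔ -1 ∈ H ∧ ∀ i ∈ S, g i ∈ H := by
  rw [genBy, Subgroup.closure_le, Set.insert_subset_iff, Set.image_subset_iff]
  rfl

theorem neg_one_mem : -1 ∈ genBy g S := (le_iff.mp le_rfl).1

theorem mem {i : ι} (hi : i ∈ S) : g i ∈ genBy g S := (le_iff.mp le_rfl).2 i hi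

theorem mono (h : S ⊆ T) : genBy g S ≤ genBy g T :=
  le_iff.mpr ⟨neg_one_mem, fun _ hi => mem (h hi)⟩

theorem le_fixer_iff {v : M2 F} : genBy g S ≤ fixer v ↔ ∀ i ∈ S, g i ∈ fixer v := by
  rw [le_iff]
  exact and_iff_right (neg_one_mem_fixer v)

theorem map_toClosure {p : ℕ} [Fact p.Prime] {g : ι → SL2 (ZMod p)} :
    (genBy g S).map (toClosure p) = genBy (toClosure p ∘ g) S := by
  rw [genBy, MonoidHom.map_closure, Set.image_insert_eq, toClosure_neg, map_one, genBy,
    Set.image_comp]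

end genBy

/-- The `g i` and `-1` generate, but all `g i` are needed. -/
structure IrrGen {F ι : Type*} [Field F] (g : ι → SL2 F) : Prop where
  gen : genBy g Set.univ = ⊤
  ne_top : ∀ k, genBy g {j | j ≠ k} ≠ ⊤

theorem IrrGen.not_mem {F ι : Type*} [Field F] {g : ι → SL2 F} (h : IrrGen g) {k : ι} {S : Set ι}
    (hS : k ∉ S) : g k ∉ genBy g S := by
  intro hk
  apply h.ne_top k
  rw [eq_top_iff, ← h.gen, genBy.le_iff]
  refine ⟨genBy.neg_one_mem, fun i _ => ?_⟩
  by_cases hi : i = k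
  · rw [hi]
    exact genBy.mono (fun j hj (e : j = k) => hS (e ▸ hj)) hk
  · exact genBy.mem hi

theorem IrrGen.ne_top_of_not_mem {F ι : Type*} [Field F] {g : ι → SL2 F} (h : IrrGen g) {k : ι}
    {S : Set ι} (hS : k ∉ S) : genBy g S ≠ ⊤ := fun e => h.not_mem hS (e ▸ Subgroup.mem_top _)

variable {p : ℕ} [Fact p.Prime]

theorem not_red_map_top (h2 : (2 : AlgebraicClosure (ZMod p)) ≠ 0) :
    ¬Red ((⊤ : Subgroup (SL2 (ZMod p))).map (toClosure p)) := by
  rintro ⟨v, hv0, hv, hle⟩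
  have key : ∀ (i j : Fin 2) (hij : i ≠ j), v j i = 0 ∧ (v.det = 0 ∨ v i i = v j j) := by
    intro i j hij
    set t := toClosure p (Matrix.SpecialLinearGroup.transvection hij 1) with ht
    have hval : t.1 = 1 + single i j 1 := by
      have : (Matrix.SpecialLinearGroup.transvection hij (1 : ZMod p)).1 = 1 + single i j 1 := rfl
      rw [ht, toClosure_val, this, Matrix.map_add _ (map_add _), Matrix.map_one _ (map_zero _)
        (map_one _), Matrix.map_single, map_one]
    have htr : t.1.trace = 2 := by
      rw [hval, trace_add, trace_one, trace_single_eq_of_ne _ _ _ hij]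
      simp
    rcases fixer_cases (hle (Subgroup.mem_map_of_mem _ (Subgroup.mem_top _) : t ∈ _)) with h | h
    · rw [hval, add_mul, mul_add, one_mul, mul_one, add_right_inj] at h
      have h1 := congrFun (congrFun h i) i
      have h2 := congrFun (congrFun h i) j
      rw [single_mul_apply_same, mul_single_apply_of_ne _ _ _ _ _ hij] at h1
      rw [single_mul_apply_same, mul_single_apply_same] at h2
      exact ⟨by simpa using h1, Or.inr (by simpa using h2.symm)⟩
    · obtain ⟨h, h' | h'⟩ := h
      · exact (h2 (htr ▸ h')).elim
      · rw [hval, add_mul, one_mul, trace_add, hv, zero_add] at h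
        refine ⟨?_, Or.inl h'⟩
        fin_cases i <;> fin_cases j <;>
          first | exact (hij rfl).elim | simpa [trace_fin_two, single, mul_apply] using h
  obtain ⟨h10, hd⟩ := key 0 1 (by decide)
  obtain ⟨h01, -⟩ := key 1 0 (by decide)
  rw [trace_fin_two] at hv
  have h00 : v 0 0 = 0 := by
    rcases hd with h | h
    · rw [det_fin_two, h10, h01] at h
      have : v 0 0 ^ 2 = 0 := by linear_combination v 0 0 * hv - h
      exact pow_eq_zero_iff two_ne_zero |>.mp this
    · apply (mul_eq_zero_iff_left h2).mp
      linear_combination hv + h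
  apply hv0
  ext i j
  fin_cases i <;> fin_cases j
  exacts [h00, h01, h10, by simpa [h00] using hv]

theorem IrrGen.red_or_exc {ι : Type*} {g : ι → SL2 (ZMod p)} (h2 : (2 : ZMod p) ≠ 0)
    (h : IrrGen g) {S : Set ι} {k : ι} (hk : k ∉ S) :
    Red (genBy (toClosure p ∘ g) S) ∨ Exc (genBy (toClosure p ∘ g) S) := by
  rw [← genBy.map_toClosure]
  exact _root_.red_or_exc h2 genBy.neg_one_mem (h.ne_top_of_not_mem hk)

theorem IrrGen.not_mem_toClosure {ι : Type*} {g : ι → SL2 (ZMod p)} (h : IrrGen g) {S : Set ι}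
    {k : ι} (hk : k ∉ S) : toClosure p (g k) ∉ genBy (toClosure p ∘ g) S := by
  rw [← genBy.map_toClosure]
  rintro ⟨x, hx, e⟩
  exact h.not_mem hk (toClosure_injective e ▸ hx)

theorem IrrGen.not_red_univ {ι : Type*} {g : ι → SL2 (ZMod p)}
    (h2 : (2 : AlgebraicClosure (ZMod p)) ≠ 0) (h : IrrGen g) :
    ¬Red (genBy (toClosure p ∘ g) Set.univ) := by
  rw [← genBy.map_toClosure, h.gen]
  exact not_red_map_top h2

theorem card_lt_four_of_minimal {K ι : Type*} [Field K] (h2 : (2 : K) ≠ 0) {g : ι → SL2 K}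
    {T : Finset ι} (hT : ¬Red (genBy g T)) (hmin : ∀ S ⊂ T, Red (genBy g S)) : T.card < 4 := by
  classical
  by_contra! hcard
  obtain ⟨e, he⟩ : ∃ e : Fin 4 → ι, Function.Injective e ∧ ∀ k, e k ∈ T := by
    obtain ⟨U, hU, hc⟩ := Finset.exists_subset_card_eq hcard
    exact ⟨fun k => (Finset.equivFinOfCardEq hc).symm k,
      Subtype.val_injective.comp (Equiv.injective _), fun k => hU (Subtype.prop _)⟩
  obtain ⟨he, heT⟩ := he
  have hline : ∀ k, ∃ v : M2 K, v ≠ 0 ∧ v.trace = 0 ∧ ∀ j, (g ∘ e) j ∈ fixer v ↔ j ≠ k := by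
    intro k
    obtain ⟨v, hv0, hv, hle⟩ := hmin _ (Finset.erase_ssubset (heT k))
    rw [genBy.le_fixer_iff] at hle
    refine ⟨v, hv0, hv, fun j => ⟨?_, fun hj => hle _ (Finset.mem_coe.mpr
      (Finset.mem_erase.mpr ⟨he.ne hj, heT j⟩))⟩⟩
    rintro hj rfl
    refine hT ⟨v, hv0, hv, genBy.le_fixer_iff.mpr fun i hi => ?_⟩
    by_cases hij : i = e j
    · exact hij ▸ hj
    · exact hle i (Finset.mem_coe.mpr (Finset.mem_erase.mpr ⟨hij, hi⟩))
  choose v hv0 hv hvj using hline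
  by_cases h0 : ∃ k, ((g ∘ e) k).1.trace ≠ 0
  · obtain ⟨k, hk⟩ := h0
    refine no_three_lines_of_trace_ne_zero h2 hk (fun h => ?_) (fun h => ?_) (fun i _ => hv0 i)
      (fun i _ => hv i) (fun i _ => hvj i)
    · exact (hvj k k).1 (h ▸ (fixer _).one_mem) rfl
    · exact (hvj k k).1 (h ▸ neg_one_mem_fixer _) rfl
  · push Not at h0
    exact no_three_lines_of_trace_eq_zero h2 0 h0 (fun i _ => hv0 i) (fun i _ => hv i)
      (fun i _ => hvj i)

theorem IrrGen.card_le {f r : AlgebraicClosure (ZMod p)} (hG : IsGold f r) {n : ℕ}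
    {g : Fin n → SL2 (ZMod p)} (h : IrrGen g) : n ≤ 3 := by
  classical
  by_contra! hn
  have h2 := hG.two_ne_zero
  have h2' : (2 : ZMod p) ≠ 0 := fun e => h2 (by
    have := congrArg (algebraMap (ZMod p) (AlgebraicClosure (ZMod p))) e
    rwa [map_ofNat, map_zero] at this)
  obtain ⟨T, hT, hmin⟩ := (wellFounded_lt (α := Finset (Fin n))).has_min
    {T | ¬Red (genBy (toClosure p ∘ g) T)}
    ⟨Finset.univ, by simpa using h.not_red_univ h2⟩
  have hT4 := card_lt_four_of_minimal h2 hT fun S hS => not_not.mp fun hS' => hmin S hS' hS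
  obtain ⟨U, hTU, -, hU⟩ := Finset.exists_subsuperset_card_eq (Finset.subset_univ T) hT4.le
    (by simpa using Nat.succ_le_of_lt hn)
  set e : Fin 4 → Fin n := fun k => (Finset.equivFinOfCardEq hU).symm k
  have he : Function.Injective e := Subtype.val_injective.comp (Equiv.injective _)
  have hsurj : ∀ i ∈ U, ∃ k, e k = i := fun i hi =>
    ⟨Finset.equivFinOfCardEq hU ⟨i, hi⟩, by simp [e]⟩
  have hnot : ∀ k, e k ∉ e '' {j | j ≠ k} := by
    rintro k ⟨j, hj, hjk⟩
    exact hj (he hjk)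
  refine Four.false hG (g := fun k => toClosure p (g (e k)))
    (M := fun k => genBy (toClosure p ∘ g) (e '' {j | j ≠ k})) ⟨?_, ?_, ?_, ?_, ?_, ?_⟩
  · intro i j hij
    exact genBy.mem (g := toClosure p ∘ g) (Set.mem_image_of_mem e (Ne.symm hij))
  · exact fun i => h.not_mem_toClosure (hnot i)
  · exact fun i => genBy.neg_one_mem
  · exact fun i => h.red_or_exc h2' (hnot i)
  · intro i v hv
    rw [genBy.le_fixer_iff]
    rintro _ ⟨j, hj, rfl⟩
    exact hv j hj
  · intro v hv0 hv hf
    refine hT ⟨v, hv0, hv, genBy.le_fixer_iff.mpr fun i hi => ?_⟩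
    obtain ⟨k, rfl⟩ := hsurj i (hTU hi)
    exact hf k

end LengthBound

section FiniteSymmetry

open Matrix GoldInt

variable {K : Type*} [Field K]

theorem transvection_not_mem_normalizer (hK : ∀ d : ℕ, 0 < d → d ≤ 12 → (d : K) ≠ 0)
    {T : Finset (SL2 K)} (hT : T.card ≤ 12) {s : SL2 K} (hs : s ∈ T) (htr : s.1.trace ^ 2 ≠ 4) :
    Matrix.SpecialLinearGroup.transvection (zero_ne_one : (0 : Fin 2) ≠ 1) (1 : K) ∉
      Subgroup.normalizer (T : Set (SL2 K)) := by
  intro hu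
  set u := Matrix.SpecialLinearGroup.transvection (zero_ne_one : (0 : Fin 2) ≠ 1) (1 : K) with hu'
  have hmem : ∀ k : ℕ, u ^ k * s * (u ^ k)⁻¹ ∈ T := fun k =>
    Finset.mem_coe.mp ((Subgroup.mem_set_normalizer_iff.mp (Subgroup.pow_mem _ hu k) s).mp
      (Finset.mem_coe.mpr hs))
  obtain ⟨k, hk, l, hl, hne, e⟩ := Finset.exists_ne_map_eq_of_card_lt_of_maps_to
    (s := Finset.range 13) (t := T) (by simpa using Nat.lt_succ_of_le hT) (fun k _ => hmem k)
  rw [Finset.mem_range] at hk hl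
  wlog hkl : k < l generalizing k l
  · exact this l hl k hk hne.symm e.symm (hne.lt_or_gt.resolve_left hkl)
  obtain ⟨d, rfl⟩ := Nat.exists_eq_add_of_lt hkl
  have hd := hK (d + 1) (by omega) (by omega)
  have e' : u ^ (d + 1) * s = s * u ^ (d + 1) := by
    have h1 : u ^ k * s * (u ^ k)⁻¹ = u ^ k * (u ^ (d + 1) * s * (u ^ (d + 1))⁻¹) * (u ^ k)⁻¹ := by
      rw [e, show k + d + 1 = k + (d + 1) by ring, pow_add, _root_.mul_inv_rev]
      simp only [mul_assoc]
    have h2 := mul_left_cancel (mul_right_cancel h1)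
    nth_rewrite 2 [h2]
    rw [inv_mul_cancel_right]
  rw [hu', SL2.transvection_pow, mul_one] at e'
  have hval : (Matrix.SpecialLinearGroup.transvection (zero_ne_one : (0 : Fin 2) ≠ 1)
      ((d + 1 : ℕ) : K)).1 = 1 + single 0 1 ((d + 1 : ℕ) : K) := rfl
  have h := congrArg Subtype.val e'
  rw [Matrix.SpecialLinearGroup.coe_mul, Matrix.SpecialLinearGroup.coe_mul, hval, add_mul, mul_add,
    one_mul, mul_one, add_right_inj] at h
  have h1 := congrFun (congrFun h 0) 0
  have h2 := congrFun (congrFun h 0) 1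
  rw [single_mul_apply_same, mul_single_apply_of_ne _ _ _ _ _ zero_ne_one, mul_eq_zero,
    or_iff_right hd] at h1
  rw [single_mul_apply_same, mul_single_apply_same, mul_comm] at h2
  have h3 := mul_right_cancel₀ hd h2
  apply htr
  have hdet := s.2
  rw [det_fin_two, h1, h3] at hdet
  rw [trace_fin_two, h3]
  linear_combination 4 * hdet

namespace Frame

variable {f r : K} {I J : SL2 K} {l : List GoldQuat}

/-- The elements whose coordinates belong to `l`. -/
def ofCoords (hF : Frame f r I J) (l : List GoldQuat) : Set (SL2 K) := {s | ∃ b ∈ l, hF.Coord 1 s b}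

theorem exists_finset_ofCoords (hF : Frame f r I J) (l : List GoldQuat) :
    ∃ T : Finset (SL2 K), T.card ≤ l.length ∧ (T : Set (SL2 K)) = hF.ofCoords l := by
  classical
  let F : GoldQuat → SL2 K := fun b => if h : ∃ s, hF.Coord 1 s b then h.choose else 1
  refine ⟨(l.map F).toFinset.filter (· ∈ hF.ofCoords l), ?_, ?_⟩
  · exact (Finset.card_filter_le _ _).trans ((List.toFinset_card_le _).trans_eq (List.length_map _))
  · ext s
    simp only [Finset.coe_filter, List.mem_toFinset, List.mem_map, Set.mem_ofPred_eq,
      and_iff_right_iff_imp]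
    rintro ⟨b, hb, hs⟩
    refine ⟨b, hb, ?_⟩
    have hex : ∃ s, hF.Coord 1 s b := ⟨s, hs⟩
    have := hex.choose_spec
    simp only [F, dif_pos hex]
    unfold Coord at this hs
    exact Subtype.ext (smul_right_injective _ (pow_ne_zero 1 hF.two_ne_zero) (this.trans hs.symm))

end Frame

/-- Multiplication by `t` intertwines the members of `l`. -/
def GoldQuat.normalizes (l : List GoldQuat) (t : GoldQuat) : Bool :=
  l.all fun b => l.any fun c => GoldQuat.eqb (t.mul b) (c.mul t)

/-- The six units `±i`, `±j`, `±k`. -/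
def GoldQuat.axes : List GoldQuat := basis.tail ++ basis.tail.map (smul (-1))

theorem GoldQuat.axes_check :
    ((octa ++ ([⟨const 1, const 1, const 1, const 1⟩] : List GoldQuat) ++ basis).all
    (normalizes axes)) = true := by
  decide +kernel

namespace Frame

variable {f r : K} {I J : SL2 K} {l : List GoldQuat}

theorem Coord.mem_normalizer {hF : Frame f r I J} {c : SL2 K} {t : GoldQuat} (hc : hF.Coord 1 c t)
    (ht : GoldQuat.normalizes l t = true) : c ∈ Subgroup.normalizer (hF.ofCoords l) := by
  obtain ⟨T, -, hT⟩ := hF.exists_finset_ofCoords l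
  have : Finite (hF.ofCoords l) := by rw [← hT]; infer_instance
  refine Subgroup.mem_normalizer_fintype ?_
  rintro s ⟨b, hb, hs⟩
  obtain ⟨b', hb', e⟩ := List.any_eq_true.mp (List.all_eq_true.mp ht b hb)
  refine ⟨b', hb', ?_⟩
  have e := congrArg (fun q => q.ev f r I J) (eqb_iff e)
  unfold Coord at *
  simp only [hF.ev_mul, ← hc, ← hs, pow_one, smul_mul_assoc, mul_smul_comm] at e
  have e := smul_right_injective _ hF.two_ne_zero e
  rw [pow_one, Matrix.SpecialLinearGroup.coe_mul, Matrix.SpecialLinearGroup.coe_mul,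
    ← smul_mul_assoc, e, mul_assoc, SL2.mul_inv_val, mul_one]

theorem transvection_not_mem_normalizer (hF : Frame f r I J)
    (hK : ∀ d : ℕ, 0 < d → d ≤ 12 → (d : K) ≠ 0) (hl : l.length ≤ 12) {s : SL2 K}
    (hs : s ∈ hF.ofCoords l) (htr : s.1.trace ^ 2 ≠ 4) :
    Matrix.SpecialLinearGroup.transvection (zero_ne_one : (0 : Fin 2) ≠ 1) (1 : K) ∉
      Subgroup.normalizer (hF.ofCoords l) := by
  obtain ⟨T, hT, e⟩ := hF.exists_finset_ofCoords l
  rw [← e] at hs ⊢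
  exact _root_.transvection_not_mem_normalizer hK (hT.trans hl) (Finset.mem_coe.mp hs) htr

end Frame

theorem IsGold.natCast_ne_zero_of_le {f r : K} (hG : IsGold f r) (d : ℕ) (h0 : 0 < d)
    (h12 : d ≤ 12) : (d : K) ≠ 0 := by
  have h : d ∣ (2 * 3 * 5 * 7 * 11 * 19 * 31) ^ 3 := by interval_cases d <;> decide
  obtain ⟨m, hm⟩ := h
  intro e
  apply pow_ne_zero 3 hG.char
  rw [← Nat.cast_pow, hm, Nat.cast_mul, e, zero_mul]

end FiniteSymmetry

section ThreeElements

open Matrix GoldInt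

variable {K : Type*} [Field K] {f r : K}

theorem Exc.labelled_four_of_ne (hG : IsGold f r) {H : Subgroup (SL2 K)} (hH : Exc H)
    (h : ∀ x ∈ H, x.1.trace ^ 4 - 3 * x.1.trace ^ 2 + 1 ≠ 0) : Labelled f r labels4 H := by
  rcases hH.card with hc | hc | hc
  · exact hH.labelled_four hG (Or.inl hc)
  · exact hH.labelled_four hG (Or.inr hc)
  · intro g hg h1 h1'
    have := hH.trace g hg h1 h1'
    rw [hc] at this
    rcases this with h0 | h0 | h0
    · exact _root_.labelled_four hG (Or.inl h0)
    · exact _root_.labelled_four hG (Or.inr (Or.inl h0))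
    · exact (h g hg h0).elim

theorem neg_one_mem_normalizer (S : Set (SL2 K)) : -1 ∈ Subgroup.normalizer S := by
  simp [Subgroup.mem_set_normalizer_iff]

/-- An element `X` and groups `M i`, each containing `X` and all `g j` with `j ≠ i`. -/
structure Three (g : Fin 3 → SL2 K) (X : SL2 K) (M : Fin 3 → Subgroup (SL2 K)) : Prop where
  mem : ∀ i j, i ≠ j → g j ∈ M i
  mem' : ∀ i, X ∈ M i
  neg_one : ∀ i, -1 ∈ M i
  red_or_exc : ∀ i, Red (M i) ∨ Exc (M i)
  trace : X.1.trace = 1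
  trace_ne : ∀ i, ∀ x ∈ M i, x.1.trace ^ 4 - 3 * x.1.trace ^ 2 + 1 ≠ 0
  irred : ∀ v : M2 K, v ≠ 0 → v.trace = 0 → ∃ j, g j ∉ fixer v

namespace Three

variable {g : Fin 3 → SL2 K} {X : SL2 K} {M : Fin 3 → Subgroup (SL2 K)}

theorem exists_not_mem (hG : IsGold f r) (h : Three g X M) : ∃ i, g i ∉ fixer (axis X.1) := by
  refine h.irred _ ?_ (trace_axis _)
  rw [Ne, axis_eq_zero_iff hG.two_ne_zero]
  rintro (e | e) <;> have ht := h.trace <;> rw [e] at ht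
  · rw [Matrix.SpecialLinearGroup.coe_one, Matrix.trace_one] at ht
    exact one_ne_zero (by push_cast [Fintype.card_fin] at ht; linear_combination ht : (1 : K) = 0)
  · rw [Matrix.SpecialLinearGroup.coe_neg, Matrix.SpecialLinearGroup.coe_one, trace_neg,
      Matrix.trace_one] at ht
    refine hG.three_ne_zero ?_
    push_cast [Fintype.card_fin] at ht
    linear_combination -ht

variable {i j l : Fin 3}

theorem not_red_inf (hG : IsGold f r) (h : Three g X M) (hij : i ≠ j) (hil : i ≠ l)
    (hi : g i ∉ fixer (axis X.1)) (hj : Exc (M j)) : ¬Red (M j ⊓ M l) := fun hr =>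
  hi (hr.mem_fixer_axis hG.two_ne_zero (fun x hx => hj.semisimple x hx.1) ⟨h.mem' j, h.mem' l⟩
    (by rw [h.trace]; exact one_ne_zero) ⟨h.mem j i hij.symm, h.mem l i hil.symm⟩)

theorem not_red_of_red (hG : IsGold f r) (h : Three g X M) (hij : i ≠ j) (hil : i ≠ l)
    (hjl : j ≠ l) (hi : g i ∉ fixer (axis X.1)) (hj : Red (M j)) : ¬Red (M l) := by
  have hall : ∀ k, k = i ∨ k = j ∨ k = l := by
    clear h hi hj
    revert i j l
    decide
  intro hl
  have h2 := hG.two_ne_zero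
  have key : ∀ k, k ≠ i → ∀ v : M2 K, v ≠ 0 → v.trace = 0 → M k ≤ fixer v →
      (axis X.1 * v).trace = 0 := by
    intro k hk v hv0 hv hle
    rcases fixer_cases (hle (h.mem' k)) with hc | ⟨h0, -⟩
    · exact (hi (mem_fixer_congr h2 hv (trace_axis _) hv0 ((axis_mul_comm_iff h2).2 hc).symm
        (hle (h.mem k i hk)))).elim
    · rw [axis, sub_mul, smul_mul_assoc, smul_mul_assoc, one_mul, trace_sub, trace_smul,
        trace_smul, h0, hv, smul_zero, smul_zero, sub_zero]
  obtain ⟨u, hu0, hu, hju⟩ := hj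
  obtain ⟨v, hv0, hv, hlv⟩ := hl
  by_cases huv : u * v = v * u
  · obtain ⟨k, hk⟩ := h.irred v hv0 hv
    rcases hall k with rfl | rfl | rfl
    · exact hk (hlv (h.mem _ _ hil.symm))
    · exact hk (hlv (h.mem _ _ hjl.symm))
    · exact hk (mem_fixer_congr h2 hu hv hu0 huv (hju (h.mem _ _ hjl)))
  · refine hi (mem_fixer_congr h2 (trace_commutator u v) (trace_axis _) (sub_ne_zero.2 huv)
      (commute_commutator_of_orthogonal hu hv (trace_axis _) (key j hij.symm u hu0 hu hju)
        (key l hil.symm v hv0 hv hlv)).symm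
      (mem_fixer_commutator (hju (h.mem j i hij.symm)) (hlv (h.mem l i hil.symm))))

theorem exists_frame (hG : IsGold f r) (h : Three g X M) (hjl : j ≠ l)
    (hj : Exc (M j)) (hl : Exc (M l)) (hD : ¬Red (M j ⊓ M l)) :
    ∃ (I J : SL2 K) (hF : Frame f r I J),
      ∀ k, g k ∈ Subgroup.normalizer (hF.ofCoords GoldQuat.axes) := by
  have hlab : ∀ k, Exc (M k) → Labelled f r labels4 (M k) := fun k hk =>
    hk.labelled_four_of_ne hG (h.trace_ne k)
  obtain ⟨I, J, hF, hI, hJ, hX⟩ := _root_.exists_frame hG (H := M j ⊓ M l)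
    ⟨h.neg_one j, h.neg_one l⟩ hD (fun x hx hx1 hx1' => by
      obtain ⟨t, ht, e⟩ := hlab j hj x hx.1 hx1 hx1'
      rw [← e]
      simp only [labels4, List.mem_cons, List.not_mem_nil, or_false] at ht
      rcases ht with rfl | rfl | rfl | rfl | rfl <;> simp [ev, hG.sqrt]) ⟨h.mem' j, h.mem' l⟩
    h.trace
  refine ⟨I, J, hF, ?_⟩
  have hcheck := fun t ht => List.all_eq_true.mp GoldQuat.axes_check t ht
  set N := Subgroup.normalizer (hF.ofCoords GoldQuat.axes)
  set D := Subgroup.closure {-1, I, J, X} with hDdef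
  have hIn : hF.InGroup D := ⟨Subgroup.subset_closure (by simp), Subgroup.subset_closure (by simp),
    Subgroup.subset_closure (by simp), X, Subgroup.subset_closure (by simp), hX⟩
  have hDN : D ≤ N := by
    rw [hDdef, Subgroup.closure_le]
    rintro x (rfl | rfl | rfl | rfl)
    · exact neg_one_mem_normalizer _
    · exact hF.coord_left.mem_normalizer (hcheck _ (by simp [GoldQuat.basis]))
    · exact hF.coord_right.mem_normalizer (hcheck _ (by simp [GoldQuat.basis]))
    · exact hX.mem_normalizer (hcheck _ (by simp))
  have hle : D ≤ M j ⊓ M l := by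
    rw [hDdef, Subgroup.closure_le]
    rintro x (rfl | rfl | rfl | rfl)
    exacts [⟨h.neg_one j, h.neg_one l⟩, hI, hJ, ⟨h.mem' j, h.mem' l⟩]
  have hN : ∀ k, Exc (M k) → D ≤ M k → M k ≤ N := by
    intro k hk hDk x hx
    by_cases hxD : x ∈ D
    · exact hDN hxD
    · obtain ⟨t, ht, hc⟩ := hIn.coord_octa hDk (hlab k hk) hx hxD
      exact hc.mem_normalizer (hcheck t (by simp [ht]))
  intro k
  by_cases hk : k = j
  · exact hN l hl (hle.trans inf_le_right) (h.mem l k (hk ▸ hjl.symm))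
  · exact hN j hj (hle.trans inf_le_left) (h.mem j k (Ne.symm hk))

theorem exists_normalizer (hG : IsGold f r) (h : Three g X M) :
    ∃ (I J : SL2 K) (hF : Frame f r I J),
      ∀ k, g k ∈ Subgroup.normalizer (hF.ofCoords GoldQuat.axes) := by
  obtain ⟨i, hi⟩ := h.exists_not_mem hG
  obtain ⟨j, l, hij, hil, hjl⟩ : ∃ j l : Fin 3, i ≠ j ∧ i ≠ l ∧ j ≠ l := by
    clear hi
    revert i
    decide
  rcases h.red_or_exc j with hj | hj
  · have hl := (h.red_or_exc l).resolve_left (h.not_red_of_red hG hij hil hjl hi hj)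
    exact (h.not_red_inf hG hil hij hi hl (hj.mono inf_le_right)).elim
  · have hD := h.not_red_inf hG hij hil hi hj
    rcases h.red_or_exc l with hl | hl
    · exact (hD (hl.mono inf_le_right)).elim
    · exact h.exists_frame hG hjl hj hl hD

end Three

variable {p : ℕ} [Fact p.Prime]

theorem IsGold.two_ne_zero_base {f r : AlgebraicClosure (ZMod p)} (hG : IsGold f r) :
    (2 : ZMod p) ≠ 0 := by
  have h := hG.two_ne_zero
  rw [← map_ofNat (algebraMap (ZMod p) (AlgebraicClosure (ZMod p)))] at h
  exact (map_ne_zero _).mp h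

theorem toClosure_transvection {i j : Fin 2} (hij : i ≠ j) :
    toClosure p (Matrix.SpecialLinearGroup.transvection hij 1) =
      Matrix.SpecialLinearGroup.transvection hij 1 := by
  have h : ∀ (F : Type _) [Field F],
      (Matrix.SpecialLinearGroup.transvection hij (1 : F)).1 = 1 + single i j 1 := fun _ _ => rfl
  apply Subtype.ext
  rw [toClosure_val, h, h, Matrix.map_add _ (map_add _), Matrix.map_one _ (map_zero _)
    (map_one _), Matrix.map_single, map_one]

theorem Frame.not_map_top_le_normalizer {f r : AlgebraicClosure (ZMod p)}
    {I J : SL2 (AlgebraicClosure (ZMod p))} (hF : Frame f r I J) {l : List GoldQuat}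
    (hl : l.length ≤ 12) {s : SL2 (AlgebraicClosure (ZMod p))} (hs : s ∈ hF.ofCoords l)
    (htr : s.1.trace ^ 2 ≠ 4) :
    ¬(⊤ : Subgroup (SL2 (ZMod p))).map (toClosure p) ≤ Subgroup.normalizer (hF.ofCoords l) := by
  intro hle
  refine hF.transvection_not_mem_normalizer hF.natCast_ne_zero_of_le hl hs htr (hle
    ⟨Matrix.SpecialLinearGroup.transvection zero_ne_one 1, Subgroup.mem_top _, ?_⟩)
  exact toClosure_transvection _

theorem exists_genBy_update_eq_top {f r : AlgebraicClosure (ZMod p)} (hG : IsGold f r)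
    (h5 : ∀ t : ZMod p, t ^ 4 - 3 * t ^ 2 + 1 ≠ 0) {g : Fin 3 → SL2 (ZMod p)}
    (hg : genBy g Set.univ = ⊤) {x : SL2 (ZMod p)} (hx : x.1.trace = 1) :
    ∃ k, genBy (Function.update g k x) Set.univ = ⊤ := by
  by_contra! hk
  have h : Three (toClosure p ∘ g) (toClosure p x)
      fun k => (genBy (Function.update g k x) Set.univ).map (toClosure p) := by
    refine ⟨fun i j hij => ?_, fun i => ?_, fun i => ?_, fun i => ?_, ?_, fun i => ?_, ?_⟩
    · refine ⟨_, genBy.mem (Set.mem_univ j), ?_⟩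
      rw [Function.update_of_ne hij.symm]
      rfl
    · refine ⟨_, genBy.mem (Set.mem_univ i), ?_⟩
      rw [Function.update_self]
    · exact ⟨-1, genBy.neg_one_mem, by rw [toClosure_neg, map_one]⟩
    · exact red_or_exc hG.two_ne_zero_base genBy.neg_one_mem (hk i)
    · rw [trace_toClosure, hx, map_one]
    · rintro _ ⟨y, -, rfl⟩ e
      rw [trace_toClosure] at e
      apply h5 y.1.trace
      apply (algebraMap (ZMod p) (AlgebraicClosure (ZMod p))).injective
      rw [map_add, map_sub, map_mul, map_pow, map_pow, map_ofNat, map_one, map_zero]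
      exact e
    · intro v hv0 hv
      by_contra! hf
      apply not_red_map_top (p := p) hG.two_ne_zero
      rw [← hg, genBy.map_toClosure]
      exact ⟨v, hv0, hv, genBy.le_fixer_iff.mpr fun i _ => hf i⟩
  obtain ⟨I, J, hF, hN⟩ := h.exists_normalizer hG
  refine hF.not_map_top_le_normalizer (l := GoldQuat.axes) (by decide) (s := I)
    ⟨_, ?_, hF.coord_left⟩ ?_ ?_
  · simp [GoldQuat.axes, GoldQuat.basis]
  · have := hF.coord_left.trace_one
    rw [this, ev_const]
    simpa using (mul_ne_zero hG.two_ne_zero hG.two_ne_zero |> fun h e => h (by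
      linear_combination -e))
  · rw [← hg, genBy.map_toClosure, genBy.le_iff]
    exact ⟨neg_one_mem_normalizer _, fun i _ => hN i⟩

end ThreeElements

section Involutions

open Matrix

variable {K : Type*} [Field K]

/-- Three involutions modulo `±1` whose axes are linearly independent, no axis being orthogonal to
the other two. -/
structure Spread (g : Fin 3 → SL2 K) : Prop where
  trace : ∀ i, (g i).1.trace = 0
  triple : (g 0 * g 1 * g 2).1.trace ≠ 0
  pair : ∀ i j k, i ≠ j → i ≠ k → j ≠ k → (g i * g j).1.trace = 0 → (g i * g k).1.trace ≠ 0

namespace Spread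

variable {g : Fin 3 → SL2 K}

theorem triple_ne_zero (h2 : (2 : K) ≠ 0) (h : Spread g) {i j k : Fin 3} (hij : i ≠ j)
    (hik : i ≠ k) (hjk : j ≠ k) : (g i * g j * g k).1.trace ≠ 0 := by
  have h0 := h.triple
  rw [← pow_ne_zero_iff two_ne_zero, SL2.trace_triple_sq h2 (h.trace _) (h.trace _) (h.trace _)]
    at h0 ⊢
  have hc : ∀ i j, (g i * g j).1.trace = (g j * g i).1.trace := fun i j => by
    rw [Matrix.SpecialLinearGroup.coe_mul, Matrix.SpecialLinearGroup.coe_mul, trace_mul_comm]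
  convert h0 using 1
  fin_cases i <;> fin_cases j <;> first | exact (hij rfl).elim | skip
  all_goals fin_cases k <;> first | exact (hik rfl).elim | exact (hjk rfl).elim | skip
  all_goals
    simp only [Fin.zero_eta, Fin.mk_one, Fin.reduceFinMk]
  all_goals
    simp only [hc 1 0, hc 2 0, hc 2 1]
    ring

theorem not_comm (h2 : (2 : K) ≠ 0) (h : Spread g) {i j : Fin 3} (hij : i ≠ j) :
    (g i).1 * (g j).1 ≠ (g j).1 * (g i).1 := by
  intro e
  obtain ⟨k, hik, hjk⟩ : ∃ k : Fin 3, i ≠ k ∧ j ≠ k := by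
    clear e
    revert i j
    decide
  apply h.triple_ne_zero h2 hij hik hjk
  have hi := SL2.mul_self_of_trace (h.trace i)
  rcases SL2.eq_or_eq_neg_of_commute h2 (h.trace i) (h.trace j) e with e | e
  · rw [e, hi, neg_one_mul, Matrix.SpecialLinearGroup.coe_neg, trace_neg, h.trace, neg_zero]
  · rw [e, mul_neg, hi, neg_neg, one_mul, h.trace]

theorem not_red (h2 : (2 : K) ≠ 0) (h : Spread g) {H : Subgroup (SL2 K)} (hg : ∀ i, g i ∈ H) :
    ¬Red H := by
  rintro ⟨v, hv0, hv, hle⟩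
  by_cases hex : ∃ i, (g i).1 * v = v * (g i).1
  · obtain ⟨i, hi⟩ := hex
    have key : ∀ j, i ≠ j → (g i * g j).1.trace = 0 := by
      intro j hij
      have := mem_fixer_congr h2 hv (h.trace i) hv0 hi.symm (hle (hg j))
      rcases fixer_cases this with hc | ⟨h0, -⟩
      · exact (h.not_comm h2 hij.symm hc).elim
      · rw [Matrix.SpecialLinearGroup.coe_mul, trace_mul_comm, h0]
    obtain ⟨j, k, hij, hik, hjk⟩ : ∃ j k : Fin 3, i ≠ j ∧ i ≠ k ∧ j ≠ k := by
      clear hi key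
      revert i
      decide
    exact h.pair i j k hij hik hjk (key j hij) (key k hik)
  · push Not at hex
    have key := fun i => ((fixer_cases (hle (hg i))).resolve_left (hex i)).1
    exact h.triple (trace_triple_eq_zero h2 (h.trace 0) (h.trace 1) (h.trace 2) hv hv0 (key 0)
      (key 1) (key 2))

theorem red_pair (h2 : (2 : K) ≠ 0) (h : Spread g) (k : Fin 3) : Red (genBy g {j | j ≠ k}) := by
  obtain ⟨i, j, hij, hall⟩ : ∃ i j : Fin 3, i ≠ j ∧ ∀ l, l ≠ k → l = i ∨ l = j := by
    revert k
    decide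
  refine ⟨_, sub_ne_zero.2 (h.not_comm h2 hij), trace_commutator _ _,
    genBy.le_fixer_iff.mpr fun l hl =>
      mem_fixer_of_orthogonal (trace_commutator _ _) (h.trace l) ?_⟩
  rcases hall l hl with rfl | rfl
  · exact trace_mul_commutator
  · exact trace_mul_commutator'

end Spread

variable {p : ℕ} [Fact p.Prime]

theorem Spread.comp_toClosure {g : Fin 3 → SL2 (ZMod p)} (h : Spread g) :
    Spread (toClosure p ∘ g) := by
  have hinj : ∀ {t : ZMod p}, algebraMap (ZMod p) (AlgebraicClosure (ZMod p)) t ≠ 0 ↔ t ≠ 0 :=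
    map_ne_zero _
  refine ⟨fun i => ?_, ?_, fun i j k hij hik hjk h0 => ?_⟩
  · rw [Function.comp_apply, trace_toClosure, h.trace, map_zero]
  · simp only [Function.comp_apply, ← map_mul, trace_toClosure]
    exact hinj.mpr h.triple
  · simp only [Function.comp_apply, ← map_mul, trace_toClosure] at h0 ⊢
    exact hinj.mpr (h.pair i j k hij hik hjk ((map_eq_zero _).mp h0))

theorem genBy_ne_top_of_red {ι : Type*} (h2 : (2 : AlgebraicClosure (ZMod p)) ≠ 0)
    {g : ι → SL2 (ZMod p)} {S : Set ι} (h : Red (genBy (toClosure p ∘ g) S)) : genBy g S ≠ ⊤ := by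
  intro e
  rw [← genBy.map_toClosure, e] at h
  exact not_red_map_top h2 h

theorem Spread.irrGen {f r : AlgebraicClosure (ZMod p)} (hG : IsGold f r)
    {g : Fin 3 → SL2 (ZMod p)} (h : Spread (toClosure p ∘ g)) {i j : Fin 3}
    {t : AlgebraicClosure (ZMod p)} (ht : (toClosure p (g i) * toClosure p (g j)).1.trace = t)
    (h0 : t ≠ 0) (h1 : t ^ 2 ≠ 1) (h3 : t ^ 2 ≠ 2) (h4 : t ^ 2 ≠ 4)
    (h5 : t ^ 4 - 3 * t ^ 2 + 1 ≠ 0) : IrrGen g := by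
  refine ⟨?_, fun k => genBy_ne_top_of_red hG.two_ne_zero (h.red_pair hG.two_ne_zero k)⟩
  by_contra hne
  rcases red_or_exc hG.two_ne_zero_base genBy.neg_one_mem hne with hr | he
  · exact h.not_red hG.two_ne_zero
      (fun i => Subgroup.mem_map_of_mem _ (genBy.mem (Set.mem_univ i))) hr
  have hmem : toClosure p (g i) * toClosure p (g j) ∈
      (genBy g Set.univ).map (toClosure p) :=
    mul_mem (Subgroup.mem_map_of_mem _ (genBy.mem (Set.mem_univ i)))
      (Subgroup.mem_map_of_mem _ (genBy.mem (Set.mem_univ j)))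
  have key := he.trace _ hmem (fun e => h4 (by
      rw [← ht, e, Matrix.SpecialLinearGroup.coe_one, Matrix.trace_one, Fintype.card_fin]
      norm_num)) (fun e => h4 (by
      rw [← ht, e, Matrix.SpecialLinearGroup.coe_neg, Matrix.SpecialLinearGroup.coe_one,
        trace_neg, Matrix.trace_one, Fintype.card_fin]
      norm_num))
  rw [ht] at key
  rcases he.card with hc | hc | hc <;> rw [hc] at key
  · rcases key with e | e
    exacts [h0 e, h1 e]
  · rcases key with e | e | e
    exacts [h0 e, h1 e, h3 e]
  · rcases key with e | e | e
    exacts [h0 e, h1 e, h5 e]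

theorem exists_irrGen {f r : AlgebraicClosure (ZMod p)} (hG : IsGold f r) :
    ∃ g : Fin 3 → SL2 (ZMod p), IrrGen g := by
  have h2 := hG.two_ne_zero_base
  have h3 : (3 : ZMod p) ≠ 0 := by
    have h := hG.three_ne_zero
    rw [← map_ofNat (algebraMap (ZMod p) (AlgebraicClosure (ZMod p)))] at h
    exact (map_ne_zero _).mp h
  have h5 : (5 : ZMod p) ≠ 0 := by
    have h := hG.five_ne_zero
    rw [← map_ofNat (algebraMap (ZMod p) (AlgebraicClosure (ZMod p)))] at h
    exact (map_ne_zero _).mp h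
  have h11 : (11 : AlgebraicClosure (ZMod p)) ≠ 0 := by
    exact_mod_cast hG.natCast_ne_zero (n := 11) (m := 2 * 3 * 5 * 7 * 19 * 31) (by norm_num)
  set g : Fin 3 → SL2 (ZMod p) := ![⟨!![0, 1; -1, 0], by simp [det_fin_two]⟩,
    ⟨!![0, 2; -2⁻¹, 0], by simp [det_fin_two, h2]⟩,
    ⟨!![1, 1; -2, -1], by rw [det_fin_two_of]; ring⟩] with hg
  have e01 : (g 0 * g 1).1.trace = -5 / 2 := by
    rw [Matrix.SpecialLinearGroup.coe_mul]
    simp [hg, trace_fin_two]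
    field_simp
    ring
  have e02 : (g 0 * g 2).1.trace = -3 := by
    rw [Matrix.SpecialLinearGroup.coe_mul]
    simp [hg, trace_fin_two]
    ring
  have e12 : (g 1 * g 2).1.trace = -9 / 2 := by
    rw [Matrix.SpecialLinearGroup.coe_mul]
    simp [hg, trace_fin_two]
    field_simp
    ring
  have hc : ∀ i j, (g i * g j).1.trace = (g j * g i).1.trace := fun i j => by
    rw [Matrix.SpecialLinearGroup.coe_mul, Matrix.SpecialLinearGroup.coe_mul, trace_mul_comm]
  have hpair : ∀ i j, i ≠ j → (g i * g j).1.trace ≠ 0 := by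
    have n9 : (9 : ZMod p) ≠ 0 := by
      rw [show (9 : ZMod p) = 3 * 3 by norm_num]
      exact mul_ne_zero h3 h3
    intro i j hij
    fin_cases i <;> fin_cases j <;>
      first
        | exact (hij rfl).elim
        | (dsimp only [Fin.zero_eta, Fin.mk_one, Fin.reduceFinMk]
           simp only [hc 1 0, hc 2 0, hc 2 1, e01, e02, e12]
           simp [h2, h3, h5, n9])
  have hg : Spread g := by
    refine ⟨?_, ?_, fun i j k hij _ _ h0 => (hpair i j hij h0).elim⟩
    · intro i
      fin_cases i <;> simp [hg, trace_fin_two]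
    · rw [Matrix.SpecialLinearGroup.coe_mul, Matrix.SpecialLinearGroup.coe_mul]
      simp [hg, trace_fin_two]
      intro e
      apply h3
      field_simp at e
      linear_combination e
  have ht : (toClosure p (g 0) * toClosure p (g 2)).1.trace = -3 := by
    rw [← map_mul, trace_toClosure, e02, map_neg, map_ofNat]
  refine ⟨g, hg.comp_toClosure.irrGen hG ht (neg_ne_zero.mpr hG.three_ne_zero) (fun e => ?_)
    (fun e => ?_) (fun e => ?_) (fun e => ?_)⟩
  · exact pow_ne_zero 3 hG.two_ne_zero (by linear_combination e)
  · exact hG.seven_ne_zero (by linear_combination e)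
  · exact hG.five_ne_zero (by linear_combination e)
  · exact mul_ne_zero hG.five_ne_zero h11 (by linear_combination e)

end Involutions

section Icosians

open Matrix GoldInt

/-- The quaternion units and all elements of norm one with prescribed coordinates are realised over
any finite prime field. -/
theorem exists_quaternion_units {p : ℕ} [Fact p.Prime] (h2 : (2 : ZMod p) ≠ 0) :
    ∃ I J : SL2 (ZMod p), I * I = -1 ∧ J * J = -1 ∧ I * J = -(J * I) ∧
      ∀ w x y z : ZMod p, w ^ 2 + x ^ 2 + y ^ 2 + z ^ 2 = 4 → ∃ g : SL2 (ZMod p),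
        (2 : ZMod p) • g.1 = w • (1 : M2 (ZMod p)) + x • I.1 + y • J.1 + z • (I.1 * J.1) := by
  obtain ⟨a, b, hab⟩ := ZMod.sq_add_sq p (-1)
  obtain ⟨I, hI⟩ : ∃ I : SL2 (ZMod p), I.1 = !![0, 1; -1, 0] :=
    ⟨⟨!![0, 1; -1, 0], by simp [det_fin_two]⟩, rfl⟩
  obtain ⟨J, hJ⟩ : ∃ J : SL2 (ZMod p), J.1 = !![a, b; b, -a] :=
    ⟨⟨!![a, b; b, -a], by rw [det_fin_two_of]; linear_combination -hab⟩, rfl⟩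
  refine ⟨I, J, SL2.mul_self_of_trace (by simp [hI, trace_fin_two]),
    SL2.mul_self_of_trace (by simp [hJ, trace_fin_two]), ?_, ?_⟩
  · apply Subtype.ext
    rw [Matrix.SpecialLinearGroup.coe_mul, Matrix.SpecialLinearGroup.coe_neg,
      Matrix.SpecialLinearGroup.coe_mul, hI, hJ]
    ext i j
    fin_cases i <;> fin_cases j <;> simp
  · intro w x y z h
    refine ⟨⟨(2 : ZMod p)⁻¹ • !![w + y * a + z * b, x + y * b - z * a;
      -x + y * b - z * a, w - y * a - z * b], ?_⟩, ?_⟩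
    · rw [det_smul, det_fin_two_of, Fintype.card_fin]
      field_simp
      linear_combination h - (y ^ 2 + z ^ 2) * hab
    · rw [smul_inv_smul₀ h2, hI, hJ]
      ext i j
      fin_cases i <;> fin_cases j <;> simp <;> ring

namespace GoldQuat

/-- `1 + i + j + k`. -/
def omega : GoldQuat := ⟨const 1, const 1, const 1, const 1⟩

/-- The involutions used for the icosahedral generating triple. -/
def invols : Fin 3 → GoldQuat :=
  ![⟨const 0, const 2, const 0, const 0⟩, ⟨const 0, const 1, ⟨-1, 1, 0, 0⟩, ⟨0, -1, 0, 0⟩⟩,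
    ⟨const 0, const 1, ⟨0, -1, 0, 0⟩, ⟨-1, 1, 0, 0⟩⟩]

/-- Elements of real part `-φ / 2` in one binary icosahedral group. -/
def fifths : List GoldQuat := icosa'.filter fun t => GoldInt.eqb t.w ⟨0, -1, 0, 0⟩

/-- Elements of real part `(φ - 1) / 2` in the other binary icosahedral group. -/
def fifths' : List GoldQuat := icosa.filter fun t => GoldInt.eqb t.w ⟨-1, 1, 0, 0⟩

theorem fifths_check : (fifths.length ≤ 12 ∧
    memb (fifths.map (smul 4)) ((omega.mul (invols 0)).mul (invols 1)) = true ∧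
    normalizes fifths omega = true) ∧ normalizes fifths (invols 0) = true ∧
      normalizes fifths (invols 1) = true := by
  decide +kernel

theorem fifths'_check : (fifths'.length ≤ 12 ∧
    memb (fifths'.map (smul 4)) ((omega.mul (invols 0)).mul (invols 2)) = true ∧
    normalizes fifths' omega = true) ∧ normalizes fifths' (invols 0) = true ∧
      normalizes fifths' (invols 2) = true := by
  decide +kernel

theorem invols_mul : GoldInt.eqb ((invols 0).mul (invols 1)).w (const (-2)) = true ∧
    GoldInt.eqb ((invols 0).mul (invols 2)).w (const (-2)) = true ∧
    GoldInt.eqb ((invols 1).mul (invols 2)).w (const 1) = true ∧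
    GoldInt.eqb (((invols 0).mul (invols 1)).mul (invols 2)).w ⟨-2, 4, 0, 0⟩ = true := by
  decide +kernel

theorem invols_orthogonal : ∀ i, i ≠ 0 → GoldInt.eqb (invols i).w (const 0) = true ∧
    GoldInt.eqb ((invols i).mul omega).w (const 0) = true := by
  decide +kernel

theorem exists_smul_four_of_memb {l : List GoldQuat} {s : GoldQuat}
    (h : memb (l.map (smul 4)) s = true) : ∃ b ∈ l, s = b.smul 4 := by
  obtain ⟨c, hc, e⟩ := List.any_eq_true.mp h
  obtain ⟨b, hb, rfl⟩ := List.mem_map.mp hc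
  exact ⟨b, hb, Frame.eqb_iff e⟩

end GoldQuat

theorem Frame.Coord.of_smul_four {K : Type*} [Field K] {f r : K} {I J g : SL2 K}
    {hF : Frame f r I J} {n : ℕ} {s : GoldQuat} (hs : hF.Coord (n + 2) g (s.smul 4)) :
    hF.Coord n g s := by
  unfold Frame.Coord at *
  rw [Frame.Coord.ev_smul, pow_add, mul_comm, mul_smul,
    show (((4 : ℤ) : K)) = 2 ^ 2 by norm_num] at hs
  exact smul_right_injective _ (pow_ne_zero 2 hF.two_ne_zero) hs

variable {p : ℕ} [Fact p.Prime] {f r : AlgebraicClosure (ZMod p)}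

theorem Frame.genBy_ne_top {I J : SL2 (AlgebraicClosure (ZMod p))} (hF : Frame f r I J)
    {l : List GoldQuat} (hl : l.length ≤ 12) {s : SL2 (AlgebraicClosure (ZMod p))}
    (hs : s ∈ hF.ofCoords l) (htr : s.1.trace ^ 2 ≠ 4) {ι : Type*} {g : ι → SL2 (ZMod p)}
    {S : Set ι} (hg : ∀ i ∈ S, ∃ t, hF.Coord 1 (toClosure p (g i)) t ∧
      GoldQuat.normalizes l t = true) : genBy g S ≠ ⊤ := by
  intro e
  apply hF.not_map_top_le_normalizer hl hs htr
  rw [← e, genBy.map_toClosure, genBy.le_iff]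
  refine ⟨neg_one_mem_normalizer _, fun i hi => ?_⟩
  obtain ⟨t, hc, ht⟩ := hg i hi
  exact hc.mem_normalizer ht

/-- An element of order three modulo `±1` and three involutions, generating icosahedral groups. -/
structure Icosahedral {I J : SL2 (AlgebraicClosure (ZMod p))} (hF : Frame f r I J)
    (g : Fin 3 → SL2 (ZMod p)) (x : SL2 (ZMod p)) : Prop where
  invol : ∀ i, hF.Coord 1 (toClosure p (g i)) (GoldQuat.invols i)
  omega : hF.Coord 1 (toClosure p x) GoldQuat.omega

theorem exists_icosahedral (hG : IsGold f r) {a : ZMod p}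
    (ha : algebraMap (ZMod p) (AlgebraicClosure (ZMod p)) a = f) :
    ∃ (I J : SL2 (AlgebraicClosure (ZMod p))) (hF : Frame f r I J) (g : Fin 3 → SL2 (ZMod p))
      (x : SL2 (ZMod p)), Icosahedral hF g x := by
  obtain ⟨I, J, hI, hJ, hIJ, hex⟩ := exists_quaternion_units hG.two_ne_zero_base
  have ha2 : a ^ 2 = a + 1 := by
    apply (algebraMap (ZMod p) (AlgebraicClosure (ZMod p))).injective
    rw [map_pow, map_add, map_one, ha, hG.golden]
  have hF : Frame f r (toClosure p I) (toClosure p J) := by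
    refine ⟨hG, ?_, ?_, ?_⟩
    · rw [← map_mul, hI, toClosure_neg, map_one]
    · rw [← map_mul, hJ, toClosure_neg, map_one]
    · rw [← map_mul, hIJ, toClosure_neg, map_mul]
  have key : ∀ t : GoldQuat, t.w.c = 0 → t.w.d = 0 → t.x.c = 0 → t.x.d = 0 → t.y.c = 0 →
      t.y.d = 0 → t.z.c = 0 → t.z.d = 0 →
      (t.w.a + t.w.b * a) ^ 2 + (t.x.a + t.x.b * a) ^ 2 + (t.y.a + t.y.b * a) ^ 2 +
        (t.z.a + t.z.b * a) ^ 2 = 4 → ∃ g : SL2 (ZMod p), hF.Coord 1 (toClosure p g) t := by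
    intro t h1 h2 h3 h4 h5 h6 h7 h8 h
    obtain ⟨g, hg⟩ := hex _ _ _ _ h
    refine ⟨g, ?_⟩
    have e := congrArg (RingHom.mapMatrix (algebraMap (ZMod p) (AlgebraicClosure (ZMod p)))) hg
    have hsm : ∀ (c : ZMod p) (m : M2 (ZMod p)),
        (algebraMap (ZMod p) (AlgebraicClosure (ZMod p))).mapMatrix (c • m) =
          algebraMap (ZMod p) (AlgebraicClosure (ZMod p)) c •
            (algebraMap (ZMod p) (AlgebraicClosure (ZMod p))).mapMatrix m := fun c m => by
      ext i j
      simp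
    simp only [map_add, hsm, map_mul, map_one, map_intCast, map_ofNat, ha] at e
    unfold Frame.Coord GoldQuat.ev GoldInt.ev
    rw [h1, h2, h3, h4, h5, h6, h7, h8, pow_one, Int.cast_zero, zero_mul, add_zero, zero_mul]
    simp only [add_zero]
    exact e
  have hinv : ∀ i, ∃ g : SL2 (ZMod p), hF.Coord 1 (toClosure p g) (GoldQuat.invols i) := by
    intro i
    fin_cases i
    · exact key _ rfl rfl rfl rfl rfl rfl rfl rfl (by simp [GoldQuat.invols, const]; norm_num)
    · refine key _ rfl rfl rfl rfl rfl rfl rfl rfl ?_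
      simp [GoldQuat.invols, const]
      linear_combination 2 * ha2
    · refine key _ rfl rfl rfl rfl rfl rfl rfl rfl ?_
      simp [GoldQuat.invols, const]
      linear_combination 2 * ha2
  choose g hg using hinv
  obtain ⟨x, hx⟩ := key GoldQuat.omega rfl rfl rfl rfl rfl rfl rfl rfl
    (by simp [GoldQuat.omega, const]; norm_num)
  exact ⟨_, _, hF, g, x, hg, hx⟩

namespace Icosahedral

variable {I J : SL2 (AlgebraicClosure (ZMod p))} {hF : Frame f r I J} {g : Fin 3 → SL2 (ZMod p)}
  {x : SL2 (ZMod p)}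

theorem trace (h : Icosahedral hF g x) : x.1.trace = 1 := by
  apply (algebraMap (ZMod p) (AlgebraicClosure (ZMod p))).injective
  rw [← trace_toClosure, h.omega.trace_one, map_one]
  simp [GoldQuat.omega, ev_const]

theorem irrGen (h : Icosahedral hF g x) : IrrGen g := by
  have hG := hF.toIsGold
  have h2 := hG.two_ne_zero
  obtain ⟨e1, e2, e3, e4⟩ := GoldQuat.invols_mul
  have t01 : (toClosure p (g 0) * toClosure p (g 1)).1.trace = -1 := by
    have := ((h.invol 0).mul (h.invol 1)).trace
    rw [eq_of_eqb e1, ev_const] at this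
    apply mul_left_cancel₀ (pow_ne_zero 2 h2)
    push_cast at this
    linear_combination this
  have t02 : (toClosure p (g 0) * toClosure p (g 2)).1.trace = -1 := by
    have := ((h.invol 0).mul (h.invol 2)).trace
    rw [eq_of_eqb e2, ev_const] at this
    apply mul_left_cancel₀ (pow_ne_zero 2 h2)
    push_cast at this
    linear_combination this
  have t12 : 2 * (toClosure p (g 1) * toClosure p (g 2)).1.trace = 1 := by
    have := ((h.invol 1).mul (h.invol 2)).trace
    rw [eq_of_eqb e3, ev_const] at this
    apply mul_left_cancel₀ h2
    push_cast at this
    linear_combination this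
  have t012 : (toClosure p (g 0) * toClosure p (g 1) * toClosure p (g 2)).1.trace ≠ 0 := by
    have := (((h.invol 0).mul (h.invol 1)).mul (h.invol 2)).trace
    rw [eq_of_eqb e4] at this
    intro e
    rw [e] at this
    simp only [ev] at this
    push_cast at this
    have e' : 2 ^ 2 * (2 * f - 1) = 0 := by linear_combination -this
    have e'' := (mul_eq_zero.mp e').resolve_left (pow_ne_zero 2 h2)
    exact hG.five_ne_zero (by linear_combination (2 * f - 1) * e'' - 4 * hG.golden)
  have hc : ∀ i j, (toClosure p (g i) * toClosure p (g j)).1.trace =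
      (toClosure p (g j) * toClosure p (g i)).1.trace := fun i j => by
    rw [Matrix.SpecialLinearGroup.coe_mul, Matrix.SpecialLinearGroup.coe_mul, trace_mul_comm]
  have hpair : ∀ i j, i ≠ j → (toClosure p (g i) * toClosure p (g j)).1.trace ≠ 0 := by
    have n12 : (toClosure p (g 1) * toClosure p (g 2)).1.trace ≠ 0 := fun e => by
      rw [e, mul_zero] at t12
      exact zero_ne_one t12
    have n01 := t01.trans_ne (neg_ne_zero.mpr one_ne_zero)
    have n02 := t02.trans_ne (neg_ne_zero.mpr one_ne_zero)
    intro i j hij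
    match i, j with
    | 0, 0 | 1, 1 | 2, 2 => exact (hij rfl).elim
    | 0, 1 => exact n01
    | 0, 2 => exact n02
    | 1, 2 => exact n12
    | 1, 0 => exact (hc 1 0).trans_ne n01
    | 2, 0 => exact (hc 2 0).trans_ne n02
    | 2, 1 => exact (hc 2 1).trans_ne n12
  have hs : Spread (toClosure p ∘ g) := by
    refine ⟨fun i => ?_, t012, fun i j k hij _ _ h0 => (hpair i j hij h0).elim⟩
    rw [Function.comp_apply, (h.invol i).trace_one]
    fin_cases i <;> simp [GoldQuat.invols, ev_const]
  obtain ⟨t, ht⟩ : ∃ t, (toClosure p (g 1) * toClosure p (g 2)).1.trace = t := ⟨_, rfl⟩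
  have ht0 := hpair 1 2 (by decide)
  rw [ht] at t12 ht0
  refine hs.irrGen hG ht ht0 (fun e => ?_) (fun e => ?_) (fun e => ?_) (fun e => ?_)
  · exact hG.three_ne_zero (by linear_combination -4 * e + (2 * t + 1) * t12)
  · exact hG.seven_ne_zero (by linear_combination -4 * e + (2 * t + 1) * t12)
  · exact mul_ne_zero hG.three_ne_zero hG.five_ne_zero
      (by linear_combination -4 * e + (2 * t + 1) * t12)
  · exact hG.five_ne_zero (by
      linear_combination 16 * e - (8 * t ^ 3 + 4 * t ^ 2 - 22 * t - 11) * t12)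

theorem genBy_ne_top (h : Icosahedral hF g x) {l : List GoldQuat} {j : Fin 3}
    (hl : l.length ≤ 12)
    (hm : GoldQuat.memb (l.map (GoldQuat.smul 4))
      ((GoldQuat.omega.mul (GoldQuat.invols 0)).mul (GoldQuat.invols j)) = true)
    (hx : GoldQuat.normalizes l GoldQuat.omega = true)
    (h0 : GoldQuat.normalizes l (GoldQuat.invols 0) = true)
    (hj : GoldQuat.normalizes l (GoldQuat.invols j) = true)
    (htr : ∀ b ∈ l, b.w.ev f r ^ 2 ≠ 4) {u : Fin 3 → SL2 (ZMod p)}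
    (hu : ∀ i, u i = x ∨ u i = g 0 ∨ u i = g j) : genBy u Set.univ ≠ ⊤ := by
  have hmul : hF.Coord 3 (toClosure p (x * g 0 * g j))
      ((GoldQuat.omega.mul (GoldQuat.invols 0)).mul (GoldQuat.invols j)) := by
    rw [map_mul, map_mul]
    have e := (h.omega.mul (h.invol 0)).mul (h.invol j)
    exact e
  obtain ⟨b, hb, e⟩ := GoldQuat.exists_smul_four_of_memb hm
  rw [e] at hmul
  have hs : hF.Coord 1 (toClosure p (x * g 0 * g j)) b := hmul.of_smul_four
  refine hF.genBy_ne_top hl (s := toClosure p (x * g 0 * g j)) ⟨b, hb, hs⟩ ?_ fun i _ => ?_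
  · rw [hs.trace_one]
    exact htr b hb
  · rcases hu i with e | e | e <;> rw [e]
    exacts [⟨_, h.omega, hx⟩, ⟨_, h.invol 0, h0⟩, ⟨_, h.invol j, hj⟩]

theorem genBy_update_zero_ne_top (h : Icosahedral hF g x) :
    genBy (Function.update g 0 x) Set.univ ≠ ⊤ := by
  have hG := hF.toIsGold
  have h2 := hG.two_ne_zero
  obtain ⟨X, hX⟩ : ∃ X, toClosure p x = X := ⟨_, rfl⟩
  have hxt : X.1.trace = 1 := by rw [← hX, trace_toClosure, h.trace, map_one]
  have hv : ((2 : AlgebraicClosure (ZMod p)) • X.1 - 1).trace = 0 := by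
    rw [trace_sub, trace_smul, hxt, Matrix.trace_one, Fintype.card_fin]
    norm_num
  have horth : ∀ i, i ≠ 0 → toClosure p (g i) ∈
      fixer ((2 : AlgebraicClosure (ZMod p)) • X.1 - 1) := by
    intro i hi
    obtain ⟨ht, hw⟩ := GoldQuat.invols_orthogonal i hi
    have htr : (toClosure p (g i)).1.trace = 0 := by
      rw [(h.invol i).trace_one, eq_of_eqb ht, ev_const, Int.cast_zero]
    have hmt := ((h.invol i).mul h.omega).trace
    rw [eq_of_eqb hw, ev_const, Int.cast_zero, mul_zero, hX] at hmt
    refine mem_fixer_of_orthogonal hv htr ?_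
    rw [mul_sub, mul_smul_comm, mul_one, trace_sub, htr, trace_smul,
      ← Matrix.SpecialLinearGroup.coe_mul,
      (mul_eq_zero.mp hmt).resolve_left (pow_ne_zero _ h2), smul_zero, sub_zero]
  refine genBy_ne_top_of_red h2 ⟨_, fun e => ?_, hv, genBy.le_fixer_iff.mpr fun i _ => ?_⟩
  · have hd := congrArg Matrix.det (sub_eq_zero.mp e)
    rw [det_smul, X.2, det_one, Fintype.card_fin] at hd
    exact hG.three_ne_zero (by linear_combination hd)
  · by_cases hi : i = 0
    · rw [hi, Function.comp_apply, Function.update_self, hX]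
      apply mem_fixer_of_commute
      rw [mul_sub, sub_mul, mul_smul_comm, smul_mul_assoc, mul_one, one_mul]
    · rw [Function.comp_apply, Function.update_of_ne hi]
      exact horth i hi

theorem genBy_update_ne_top (h : Icosahedral hF g x) (k : Fin 3) :
    genBy (Function.update g k x) Set.univ ≠ ⊤ := by
  have hG := hF.toIsGold
  have hgold := hG.golden
  obtain rfl | rfl | rfl : k = 0 ∨ k = 1 ∨ k = 2 := by
    revert k
    decide
  · exact h.genBy_update_zero_ne_top
  · obtain ⟨⟨hl, hm, hx⟩, h0, hj⟩ := GoldQuat.fifths'_check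
    refine h.genBy_ne_top hl hm hx h0 hj (fun b hb e => ?_) fun i => ?_
    · rw [eq_of_eqb (List.mem_filter.mp hb).2] at e
      simp only [ev] at e
      push_cast at e
      have e' : f = -2 := by linear_combination hgold - e
      rw [e'] at hgold
      exact hG.five_ne_zero (by linear_combination hgold)
    · obtain rfl | rfl | rfl : i = 0 ∨ i = 1 ∨ i = 2 := by
        revert i
        decide
      exacts [.inr (.inl rfl), .inl rfl, .inr (.inr rfl)]
  · obtain ⟨⟨hl, hm, hx⟩, h0, hj⟩ := GoldQuat.fifths_check
    refine h.genBy_ne_top hl hm hx h0 hj (fun b hb e => ?_) fun i => ?_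
    · rw [eq_of_eqb (List.mem_filter.mp hb).2] at e
      simp only [ev] at e
      push_cast at e
      have e' : f = 3 := by linear_combination e - hgold
      rw [e'] at hgold
      exact hG.five_ne_zero (by linear_combination hgold)
    · obtain rfl | rfl | rfl : i = 0 ∨ i = 1 ∨ i = 2 := by
        revert i
        decide
      exacts [.inr (.inl rfl), .inr (.inr rfl), .inl rfl]

end Icosahedral

end Icosians

section Quotient

open Matrix

/-- The quotient map onto `PSL(2,p)`. -/
def toPSL (p : ℕ) [Fact p.Prime] : SL2 (ZMod p) →* PSL p :=
  QuotientGroup.mk' (Subgroup.center (Matrix.SpecialLinearGroup (Fin 2) (ZMod p)))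

variable {p : ℕ} [Fact p.Prime]

theorem toPSL_surjective : Function.Surjective (toPSL p) :=
  QuotientGroup.mk'_surjective _

theorem toPSL_eq_one_iff {g : SL2 (ZMod p)} : toPSL p g = 1 ↔ g = 1 ∨ g = -1 := by
  rw [toPSL, QuotientGroup.mk'_apply, QuotientGroup.eq_one_iff,
    Matrix.SpecialLinearGroup.mem_center_iff]
  constructor
  · rintro ⟨c, hc, e⟩
    rw [Fintype.card_fin, sq_eq_one_iff] at hc
    rcases hc with rfl | rfl
    · exact .inl (Subtype.ext (by rw [← e, map_one]; rfl))
    · exact .inr (Subtype.ext (by rw [← e, map_neg, map_one]; rfl))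
  · rintro (rfl | rfl)
    · exact ⟨1, one_pow _, map_one _⟩
    · exact ⟨-1, by simp, by rw [map_neg, map_one]; rfl⟩

theorem toPSL_neg (g : SL2 (ZMod p)) : toPSL p (-g) = toPSL p g := by
  rw [← neg_one_mul, map_mul, toPSL_eq_one_iff.mpr (.inr rfl), one_mul]

theorem genBy_eq_comap {ι : Type*} (g : ι → SL2 (ZMod p)) (S : Set ι) :
    genBy g S = (Subgroup.closure ((toPSL p ∘ g) '' S)).comap (toPSL p) := by
  apply le_antisymm
  · rw [genBy.le_iff]
    refine ⟨?_, fun i hi => Subgroup.subset_closure ⟨i, hi, rfl⟩⟩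
    rw [Subgroup.mem_comap, toPSL_eq_one_iff.mpr (.inr rfl)]
    exact one_mem _
  · intro y hy
    rw [Subgroup.mem_comap, Set.image_comp, ← MonoidHom.map_closure] at hy
    obtain ⟨z, hz, e⟩ := hy
    have hz' : z ∈ genBy g S := Subgroup.closure_mono (Set.subset_insert _ _) hz
    have hk : toPSL p (z⁻¹ * y) = 1 := by rw [map_mul, map_inv, e, inv_mul_cancel]
    rw [← mul_inv_cancel_left z y]
    refine mul_mem hz' ?_
    rcases toPSL_eq_one_iff.mp hk with e | e <;> rw [e]
    exacts [one_mem _, genBy.neg_one_mem]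

theorem genBy_eq_top_iff {ι : Type*} {g : ι → SL2 (ZMod p)} {S : Set ι} :
    genBy g S = ⊤ ↔ Subgroup.closure ((toPSL p ∘ g) '' S) = ⊤ := by
  rw [genBy_eq_comap, ← Subgroup.comap_top (toPSL p)]
  exact (Subgroup.comap_injective toPSL_surjective).eq_iff

theorem isGenSeq_iff {n : ℕ} {g : Fin n → SL2 (ZMod p)} :
    IsGenSeq (toPSL p ∘ g) ↔ genBy g Set.univ = ⊤ := by
  rw [genBy_eq_top_iff, Set.image_univ, IsGenSeq]

theorem irrGen_iff {n : ℕ} {g : Fin n → SL2 (ZMod p)} :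
    IsGenSeq (toPSL p ∘ g) ∧ IsIrred (toPSL p ∘ g) ↔ IrrGen g := by
  rw [isGenSeq_iff, IsIrred]
  simp only [ne_eq, ← genBy_eq_top_iff]
  exact ⟨fun h => ⟨h.1, h.2⟩, fun h => ⟨h.1, h.2⟩⟩

theorem isGenSeq_update_iff {n : ℕ} {g : Fin n → SL2 (ZMod p)} {k : Fin n} {x : SL2 (ZMod p)} :
    IsGenSeq (Function.update (toPSL p ∘ g) k (toPSL p x)) ↔
      genBy (Function.update g k x) Set.univ = ⊤ := by
  rw [← isGenSeq_iff, Function.comp_update]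

theorem exists_lift {ι : Type*} (g : ι → PSL p) : ∃ h : ι → SL2 (ZMod p), toPSL p ∘ h = g := by
  choose h hh using fun i => toPSL_surjective (g i)
  exact ⟨h, funext hh⟩

theorem orderOf_toPSL_eq_three {f r : AlgebraicClosure (ZMod p)} (hG : IsGold f r)
    {x : SL2 (ZMod p)} (hx : x.1.trace = 1) : orderOf (toPSL p x) = 3 := by
  have h3 : (3 : ZMod p) ≠ 0 := by
    have h := hG.three_ne_zero
    rw [← map_ofNat (algebraMap (ZMod p) (AlgebraicClosure (ZMod p)))] at h
    exact (map_ne_zero _).mp h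
  have hc : x ^ (2 + 1) = -1 := by
    apply Subtype.ext
    rw [SL2.val_pow_succ (SL2.val_sq x), hx, Matrix.SpecialLinearGroup.coe_neg,
      Matrix.SpecialLinearGroup.coe_one]
    norm_num
  refine orderOf_eq_prime ?_ fun e => ?_
  · rw [← map_pow, hc, toPSL_eq_one_iff]
    exact .inr rfl
  · rcases toPSL_eq_one_iff.mp e with rfl | rfl
    · rw [Matrix.SpecialLinearGroup.coe_one, Matrix.trace_one, Fintype.card_fin] at hx
      exact one_ne_zero (α := ZMod p) (by push_cast at hx; linear_combination hx)
    · rw [Matrix.SpecialLinearGroup.coe_neg, Matrix.SpecialLinearGroup.coe_one, trace_neg,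
        Matrix.trace_one, Fintype.card_fin] at hx
      exact h3 (by push_cast at hx; linear_combination -hx)

theorem exists_trace_eq_one (h2 : (2 : ZMod p) ≠ 0) {y : PSL p} (hy : orderOf y = 3) :
    ∃ x : SL2 (ZMod p), toPSL p x = y ∧ x.1.trace = 1 := by
  obtain ⟨x, rfl⟩ := toPSL_surjective y
  have h1 : toPSL p x ≠ 1 := fun e => by simp [e] at hy
  rw [Ne, toPSL_eq_one_iff, not_or] at h1
  have hc : toPSL p (x ^ 3) = 1 := by rw [map_pow, ← hy, pow_orderOf_eq_one]
  have h6 : x ^ (2 * 3) = 1 := by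
    rw [mul_comm, pow_mul]
    rcases toPSL_eq_one_iff.mp hc with e | e <;> rw [e]
    exacts [one_pow _, by simp]
  rcases sq_eq_one_iff.mp (SL2.trace_of_pow_six h2 h1.1 h1.2 h6) with e | e
  · exact ⟨x, rfl, e⟩
  · refine ⟨-x, toPSL_neg x, ?_⟩
    rw [Matrix.SpecialLinearGroup.coe_neg, trace_neg, e, neg_neg]

theorem maxIrredLen_PSL {f r : AlgebraicClosure (ZMod p)} (hG : IsGold f r) :
    maxIrredLen (PSL p) = 3 := by
  have hle : ∀ n ∈ {n | ∃ g : Fin n → PSL p, IsGenSeq g ∧ IsIrred g}, n ≤ 3 := by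
    rintro n ⟨g, hg⟩
    obtain ⟨g, rfl⟩ := exists_lift g
    exact (irrGen_iff.mp hg).card_le hG
  obtain ⟨g, hg⟩ := exists_irrGen hG
  exact le_antisymm (csSup_le ⟨3, _, irrGen_iff.mpr hg⟩ hle)
    (le_csSup ⟨3, hle⟩ ⟨_, irrGen_iff.mpr hg⟩)

theorem isWitnessToFailure_iff {f r : AlgebraicClosure (ZMod p)} (hG : IsGold f r)
    {x : SL2 (ZMod p)} : IsWitnessToFailure (toPSL p x) ↔ toPSL p x ≠ 1 ∧
      ∃ g : Fin 3 → SL2 (ZMod p), IrrGen g ∧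
        ∀ k, genBy (Function.update g k x) Set.univ ≠ ⊤ := by
  rw [IsWitnessToFailure, maxIrredLen_PSL hG]
  refine and_congr_right fun _ => ⟨?_, ?_⟩
  · rintro ⟨g, h1, h2, h3⟩
    obtain ⟨g, rfl⟩ := exists_lift g
    exact ⟨g, irrGen_iff.mp ⟨h1, h2⟩, fun k e => h3 k (isGenSeq_update_iff.mpr e)⟩
  · rintro ⟨g, h1, h2⟩
    obtain ⟨h3, h4⟩ := irrGen_iff.mpr h1
    exact ⟨_, h3, h4, fun k e => h2 k (isGenSeq_update_iff.mp e)⟩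

end Quotient

theorem exists_isGold (p : ℕ) [Fact p.Prime] (hp : 5 < p) (h7 : p ≠ 7) (h11 : p ≠ 11)
    (h19 : p ≠ 19) (h31 : p ≠ 31) : ∃ f r : AlgebraicClosure (ZMod p), IsGold f r := by
  have hpr : p.Prime := Fact.out
  have hchar : ((2 * 3 * 5 * 7 * 11 * 19 * 31 : ℕ) : AlgebraicClosure (ZMod p)) ≠ 0 := by
    rw [Ne, CharP.cast_eq_zero_iff (AlgebraicClosure (ZMod p)) p]
    simp only [hpr.dvd_mul, Nat.prime_dvd_prime_iff_eq hpr (by norm_num : Nat.Prime 2),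
      Nat.prime_dvd_prime_iff_eq hpr (by norm_num : Nat.Prime 3),
      Nat.prime_dvd_prime_iff_eq hpr (by norm_num : Nat.Prime 5),
      Nat.prime_dvd_prime_iff_eq hpr (by norm_num : Nat.Prime 7),
      Nat.prime_dvd_prime_iff_eq hpr (by norm_num : Nat.Prime 11),
      Nat.prime_dvd_prime_iff_eq hpr (by norm_num : Nat.Prime 19),
      Nat.prime_dvd_prime_iff_eq hpr (by norm_num : Nat.Prime 31)]
    omega
  have h2 : (2 : AlgebraicClosure (ZMod p)) ≠ 0 := fun h => hchar (by
    rw [mul_assoc, mul_assoc, mul_assoc, mul_assoc, mul_assoc, Nat.cast_mul, Nat.cast_ofNat, h,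
      zero_mul])
  obtain ⟨s, hs⟩ := IsAlgClosed.exists_pow_nat_eq (5 : AlgebraicClosure (ZMod p)) two_pos
  obtain ⟨r, hr⟩ := IsAlgClosed.exists_pow_nat_eq (2 : AlgebraicClosure (ZMod p)) two_pos
  refine ⟨(1 + s) / 2, r, ?_, hr, hchar⟩
  field_simp
  linear_combination hs

theorem isSquare_five_iff (p : ℕ) [Fact p.Prime] (hp : 5 < p) :
    IsSquare (5 : ZMod p) ↔ p % 10 = 1 ∨ p % 10 = 9 := by
  have hpr : p.Prime := Fact.out
  have hdec : ∀ t : ℕ, t < 5 → t ≠ 0 → (IsSquare (t : ZMod 5) ↔ t = 1 ∨ t = 4) := by decide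
  have : Fact (Nat.Prime 5) := ⟨by norm_num⟩
  have h2 : p % 2 = 1 := hpr.eq_two_or_odd.resolve_left (by omega)
  have h5 : p % 5 ≠ 0 := fun h => by
    have := (Nat.prime_dvd_prime_iff_eq (by norm_num) hpr).mp (Nat.dvd_of_mod_eq_zero h)
    omega
  have key := ZMod.exists_sq_eq_prime_iff_of_mod_four_eq_one (p := 5) (q := p) rfl (by omega)
  rw [← Nat.cast_ofNat, ← key, ← ZMod.natCast_mod p 5]
  have hlt := Nat.mod_lt p (by norm_num : 0 < 5)
  rw [hdec _ hlt h5]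
  omega

theorem psl_witness_of_order_three_iff (p : ℕ) [Fact p.Prime] (hp : 5 < p)
    (h7 : p ≠ 7) (h11 : p ≠ 11) (h19 : p ≠ 19) (h31 : p ≠ 31) :
    (∃ g : PSL p, IsWitnessToFailure g ∧ orderOf g = 3) ↔
      (p % 10 = 1 ∨ p % 10 = 9) := by
  obtain ⟨f, r, hG⟩ := exists_isGold p hp h7 h11 h19 h31
  have h2 := hG.two_ne_zero_base
  rw [← isSquare_five_iff p hp]
  constructor
  · rintro ⟨y, hw, hy⟩
    obtain ⟨x, rfl, hx⟩ := exists_trace_eq_one h2 hy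
    obtain ⟨-, g, hg, hk⟩ := (isWitnessToFailure_iff hG).mp hw
    by_contra h5
    obtain ⟨k, e⟩ := exists_genBy_update_eq_top hG
      (fun t ht => h5 ⟨2 * t ^ 2 - 3, by linear_combination -4 * ht⟩) hg.gen hx
    exact hk k e
  · rintro ⟨s, hs⟩
    have ha : ((1 + s) / 2) ^ 2 = (1 + s) / 2 + 1 := by
      field_simp
      linear_combination -hs
    have hG' : IsGold (algebraMap (ZMod p) (AlgebraicClosure (ZMod p)) ((1 + s) / 2)) r :=
      ⟨by rw [← map_pow, ha, map_add, map_one], hG.sqrt, hG.char⟩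
    obtain ⟨I, J, hF, g, x, h⟩ := exists_icosahedral hG' rfl
    have ho := orderOf_toPSL_eq_three hG h.trace
    refine ⟨toPSL p x, (isWitnessToFailure_iff hG).mpr
      ⟨fun e => ?_, g, h.irrGen, h.genBy_update_ne_top⟩, ho⟩
    rw [e, orderOf_one] at ho
    omega
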